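/- If a countable group G endowed with a proper left-invariant metric admits a coarse embedding into a countable abelian group endowed with a proper left-invariant metric, then G is locally nilpotent-by-finite. -/

import Mathlib

/-- A map between metric spaces is bornologous. -/
def Bornologous {X Y : Type*} [MetricSpace X] [MetricSpace Y] (f : X → Y) : Prop :=
  ∀ δ : ℝ, 0 ≤ δ → ∃ ε : ℝ, 0 ≤ ε ∧ ∀ x x' : X, dist x x' ≤ δ → dist (f x) (f x') ≤ ε

/-- A map between metric spaces is a coarse embedding. -/
def CoarseEmbedding {X Y : Type*} [MetricSpace X] [MetricSpace Y] (f : X → Y) : Prop :=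
  Bornologous f ∧
    ∀ R : ℝ, 0 ≤ R → ∃ S : ℝ, 0 ≤ S ∧ ∀ x x' : X, dist (f x) (f x') ≤ R → dist x x' ≤ S

/-- A group is nilpotent-by-finite: it has a nilpotent normal subgroup with finite
quotient. -/
def NilpotentByFinite (G : Type*) [Group G] : Prop :=
  ∃ N : Subgroup G, N.Normal ∧ Group.IsNilpotent N ∧ Finite (G ⧸ N)

section PartP1
open scoped Pointwise

/-- Polynomial growth of degree at most `d`, for all finite subsets. -/
def PG (d : ℕ) (G : Type) [Group G] : Prop :=
  ∀ S : Set G, S.Finite → ∃ C : ℕ, ∀ n : ℕ, (S ^ n).ncard ≤ C * (n + 1) ^ d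

theorem set_pow_finite {G : Type} [Group G] {S : Set G} (hS : S.Finite) (n : ℕ) :
    (S ^ n).Finite := by
  induction n with
  | zero => simp
  | succ k ih => rw [pow_succ]; exact ih.mul hS

theorem PG.of_injective {d : ℕ} {G H : Type} [Group G] [Group H] (f : H →* G)
    (hf : Function.Injective f) (h : PG d G) : PG d H := by
  intro S hS
  obtain ⟨C, hC⟩ := h (f '' S) (hS.image _)
  refine ⟨C, fun n => ?_⟩
  have : f '' (S ^ n) = (f '' S) ^ n := Set.image_pow f S n
  rw [← Set.ncard_image_of_injective _ hf, this]
  exact hC n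

theorem PG.subgroup {d : ℕ} {G : Type} [Group G] (h : PG d G) (H : Subgroup G) : PG d H :=
  h.of_injective H.subtype H.subtype_injective

theorem PG.of_surjective {d : ℕ} {G H : Type} [Group G] [Group H] (f : G →* H)
    (hf : Function.Surjective f) (h : PG d G) : PG d H := by
  intro S hS
  obtain ⟨g, hg⟩ := hf.hasRightInverse
  obtain ⟨C, hC⟩ := h (g '' S) (hS.image _)
  refine ⟨C, fun n => le_trans ?_ (hC n)⟩
  have : f '' ((g '' S) ^ n) = S ^ n := by
    rw [Set.image_pow f, Set.image_image]
    simp [hg _]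
  rw [← this]
  exact Set.ncard_image_le (set_pow_finite (hS.image _) n)

theorem PG.mono {d e : ℕ} {G : Type} [Group G] (h : PG d G) (hde : d ≤ e) : PG e G := by
  intro S hS
  obtain ⟨C, hC⟩ := h S hS
  refine ⟨C, fun n => (hC n).trans ?_⟩
  gcongr
  omega

theorem poly_lt_exp (C d : ℕ) (r : ℝ) (hr : 1 < r) (c : ℕ):
    ∃ N : ℕ, ∀ n ≥ N, (C : ℝ) * ((c * n + 1 : ℕ) : ℝ) ^ d < r ^ n := by
  have h1 : Filter.Tendsto (fun n : ℕ => (n : ℝ) ^ d / r ^ n) Filter.atTop (nhds 0) :=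
    tendsto_pow_const_div_const_pow_of_one_lt d hr
  have h2 := h1.const_mul ((C : ℝ) * ((c + 1 : ℕ) : ℝ) ^ d)
  rw [mul_zero] at h2
  have h3 := (h2.eventually (gt_mem_nhds (zero_lt_one))).and (Filter.eventually_ge_atTop 1)
  obtain ⟨N, hN⟩ := Filter.eventually_atTop.1 h3
  refine ⟨N, fun n hn => ?_⟩
  obtain ⟨h4, h5⟩ := hN n hn
  have hp : 0 < r ^ n := by positivity
  rw [← mul_div_assoc, div_lt_one hp] at h4
  refine lt_of_le_of_lt ?_ h4
  rw [mul_assoc, ← mul_pow]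
  gcongr
  have : c * n + 1 ≤ (c + 1) * n := by nlinarith
  exact_mod_cast this

/-- The word used in the collision argument. -/
noncomputable def colWord {G : Type} [Group G] (g t : G) : ℕ → Finset ℕ → G
  | 0, _ => 1
  | n + 1, I => colWord g t n I * (if n ∈ I then t ^ n * g * (t ^ n)⁻¹ else 1)

theorem colWord_mem {G : Type} [Group G] (g t : G) (n : ℕ) (I : Finset ℕ) :
    colWord g t n I * t ^ n ∈ ({t, g * t} : Set G) ^ n := by
  induction n with
  | zero => simp [colWord]
  | succ k ih =>
    rw [pow_succ ({t, g * t} : Set G)]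
    by_cases hk : k ∈ I
    · refine Set.mem_mul.2 ⟨_, ih, g * t, by simp, ?_⟩
      simp [colWord, hk, pow_succ, mul_assoc]
    · refine Set.mem_mul.2 ⟨_, ih, t, by simp, ?_⟩
      simp [colWord, hk, pow_succ, mul_assoc]

theorem PG.collision {d : ℕ} {G : Type} [Group G] (h : PG d G) (g t : G) :
    ∃ n : ℕ, ∃ I J : Finset ℕ, I ⊆ Finset.range n ∧ J ⊆ Finset.range n ∧ I ≠ J ∧
      colWord g t n I = colWord g t n J := by
  have hS : ({t, g * t} : Set G).Finite := by simp
  obtain ⟨C, hC⟩ := h {t, g * t} hS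
  obtain ⟨N, hN⟩ := poly_lt_exp C d 2 (by norm_num) 1
  have hN := hN N le_rfl
  rw [one_mul] at hN
  have hN' : C * (N + 1) ^ d < 2 ^ N := by exact_mod_cast hN
  have hfin := set_pow_finite hS N
  obtain ⟨I, hI, J, hJ, hne, heq⟩ := Finset.exists_ne_map_eq_of_card_lt_of_maps_to
    (s := (Finset.range N).powerset) (t := hfin.toFinset)
    (f := fun I => colWord g t N I * t ^ N) (by
      rw [Finset.card_powerset, Finset.card_range, ← Set.ncard_eq_toFinset_card _ hfin]
      exact lt_of_le_of_lt (hC N) hN') (by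
      intro I _
      simpa using colWord_mem g t N I)
  refine ⟨N, I, J, Finset.mem_powerset.1 hI, Finset.mem_powerset.1 hJ, hne, ?_⟩
  exact mul_right_cancel heq

theorem colWord_mem_closure {G : Type} [Group G] (g t : G) (n : ℕ) (I : Finset ℕ) :
    colWord g t n I ∈ Subgroup.closure ((fun i : ℕ => t ^ i * g * (t ^ i)⁻¹) '' Set.Iio n) := by
  induction n with
  | zero => exact Subgroup.one_mem _
  | succ k ih =>
    refine Subgroup.mul_mem _ (Subgroup.closure_mono (Set.image_mono ?_) ih) ?_
    · exact Set.Iio_subset_Iio (Nat.le_succ k)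
    · split_ifs
      · exact Subgroup.subset_closure ⟨k, by simp, rfl⟩
      · exact Subgroup.one_mem _

theorem colWord_top {G : Type} [Group G] (g t : G) (n : ℕ) (I J : Finset ℕ)
    (heq : colWord g t n I = colWord g t n J) (hne : ∃ i < n, ¬ (i ∈ I ↔ i ∈ J)) :
    ∃ j : ℕ, t ^ j * g * (t ^ j)⁻¹ ∈
      Subgroup.closure ((fun i : ℕ => t ^ i * g * (t ^ i)⁻¹) '' Set.Iio j) := by
  induction n with
  | zero => obtain ⟨i, hi, _⟩ := hne; omega
  | succ k ih =>
    simp only [colWord] at heq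
    have hI := colWord_mem_closure g t k I
    have hJ := colWord_mem_closure g t k J
    by_cases h1 : k ∈ I <;> by_cases h2 : k ∈ J
    · simp only [h1, h2, if_true, mul_left_inj] at heq
      apply ih heq
      obtain ⟨i, hi, hi'⟩ := hne
      refine ⟨i, ?_, hi'⟩
      rcases Nat.lt_succ_iff_lt_or_eq.1 hi with h | rfl
      · exact h
      · simp [h1, h2] at hi'
    · simp only [h1, h2, if_true, if_false, mul_one] at heq
      refine ⟨k, ?_⟩
      rw [← eq_inv_mul_iff_mul_eq] at heq
      rw [heq]
      exact Subgroup.mul_mem _ (Subgroup.inv_mem _ hI) hJ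
    · simp only [h1, h2, if_true, if_false, mul_one] at heq
      refine ⟨k, ?_⟩
      have heq := heq.symm
      rw [← eq_inv_mul_iff_mul_eq] at heq
      rw [heq]
      exact Subgroup.mul_mem _ (Subgroup.inv_mem _ hJ) hI
    · simp only [h1, h2, if_false, mul_one] at heq
      apply ih heq
      obtain ⟨i, hi, hi'⟩ := hne
      refine ⟨i, ?_, hi'⟩
      rcases Nat.lt_succ_iff_lt_or_eq.1 hi with h | rfl
      · exact h
      · simp [h1, h2] at hi'

theorem PG.collision_top {d : ℕ} {G : Type} [Group G] (h : PG d G) (g t : G) :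
    ∃ j : ℕ, t ^ j * g * (t ^ j)⁻¹ ∈
      Subgroup.closure ((fun i : ℕ => t ^ i * g * (t ^ i)⁻¹) '' Set.Iio j) := by
  obtain ⟨n, I, J, hI, hJ, hne, heq⟩ := h.collision g t
  refine colWord_top g t n I J heq ?_
  by_contra hcon
  push Not at hcon
  apply hne
  ext i
  constructor
  · intro hi; exact (hcon i (Finset.mem_range.1 (hI hi))).1 hi
  · intro hi; exact (hcon i (Finset.mem_range.1 (hJ hi))).2 hi

/-- All nonnegative conjugates lie in a finitely generated subgroup. -/
theorem PG.collision_all {d : ℕ} {G : Type} [Group G] (h : PG d G) (g t : G) :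
    ∃ j : ℕ, ∀ k : ℕ, t ^ k * g * (t ^ k)⁻¹ ∈
      Subgroup.closure ((fun i : ℕ => t ^ i * g * (t ^ i)⁻¹) '' Set.Iio j) := by
  obtain ⟨j, hj⟩ := h.collision_top g t
  refine ⟨j, fun k => ?_⟩
  set P := Subgroup.closure ((fun i : ℕ => t ^ i * g * (t ^ i)⁻¹) '' Set.Iio j) with hP
  have hconj : ∀ x ∈ P, t * x * t⁻¹ ∈ P := by
    have : P ≤ P.comap (MulAut.conj t).toMonoidHom := by
      conv_lhs => rw [hP]
      rw [Subgroup.closure_le]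
      rintro _ ⟨i, hi, rfl⟩
      have hi : i < j := hi
      have e : (MulAut.conj t).toMonoidHom (t ^ i * g * (t ^ i)⁻¹) =
          t ^ (i + 1) * g * (t ^ (i + 1))⁻¹ := by
        simp [pow_succ', mul_assoc]
      simp only [SetLike.mem_coe, Subgroup.mem_comap]
      rw [e]
      by_cases hlt : i + 1 < j
      · exact Subgroup.subset_closure ⟨i + 1, hlt, rfl⟩
      · have : i + 1 = j := by omega
        rw [this]; exact hj
    intro x hx
    exact this hx
  induction k with
  | zero =>
    by_cases h0 : 0 < j
    · exact Subgroup.subset_closure ⟨0, h0, rfl⟩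
    · have : j = 0 := by omega
      rw [this] at hj; exact hj
  | succ k ih =>
    have := hconj _ ih
    have e : t * (t ^ k * g * (t ^ k)⁻¹) * t⁻¹ = t ^ (k + 1) * g * (t ^ (k + 1))⁻¹ := by
      simp [pow_succ', mul_assoc]
    rwa [e] at this

end PartP1

section PartP3
open scoped Pointwise

theorem PG.ker {d : ℕ} {G : Type} [Group G] (h : PG (d + 1) G) (φ : G →* Multiplicative ℤ)
    (hφ : Function.Surjective φ) : PG d φ.ker := by
  obtain ⟨t, ht⟩ := hφ (Multiplicative.ofAdd 1)
  intro S hS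
  set S' : Set G := (φ.ker.subtype '' S) ∪ {1, t} with hS'
  have hfin : S'.Finite := (hS.image _).union (by simp)
  obtain ⟨C, hC⟩ := h S' hfin
  refine ⟨C * 2 ^ (d + 1), fun n => ?_⟩
  have key : (S ^ n).ncard * (n + 1) ≤ (S' ^ (2 * n)).ncard := by
    have h1 : ((S ^ n) ×ˢ (Set.Iio (n + 1))).ncard = (S ^ n).ncard * (n + 1) := by
      rw [Set.ncard_prod]
      congr 1
      rw [Set.ncard_eq_toFinset_card']
      simp
    rw [← h1]
    refine Set.ncard_le_ncard_of_injOn (fun p : φ.ker × ℕ => (p.1 : G) * t ^ p.2) ?_ ?_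
      (set_pow_finite hfin _)
    · rintro ⟨x, i⟩ ⟨hx, hi⟩
      have hi : i < n + 1 := hi
      rw [two_mul, pow_add]
      refine Set.mul_mem_mul ?_ ?_
      · have h2 : (x : G) ∈ (φ.ker.subtype '' S) ^ n := by
          rw [← Set.image_pow]
          exact ⟨x, hx, rfl⟩
        exact Set.pow_subset_pow_left (Set.subset_union_left) h2
      · have h3 : t ^ i ∈ S' ^ i := Set.pow_mem_pow (by simp [hS'])
        exact Set.pow_subset_pow_right (by simp [hS']) (by omega) h3
    · rintro ⟨x, i⟩ _ ⟨y, j⟩ _ hxy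
      simp only at hxy
      have h4 := congrArg φ hxy
      rw [map_mul, map_mul, map_pow, map_pow, ht, (MonoidHom.mem_ker.1 x.2),
        (MonoidHom.mem_ker.1 y.2), one_mul, one_mul] at h4
      have hij : i = j := by
        have := congrArg Multiplicative.toAdd h4
        simpa using this
      subst hij
      have := mul_right_cancel hxy
      simp only [Prod.mk.injEq, and_true]
      exact Subtype.ext this
  have h5 := key.trans (hC (2 * n))
  have h6 : C * (2 * n + 1) ^ (d + 1) ≤ (C * 2 ^ (d + 1) * (n + 1) ^ d) * (n + 1) := by
    calc C * (2 * n + 1) ^ (d + 1) ≤ C * (2 * (n + 1)) ^ (d + 1) := by gcongr; omega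
      _ = _ := by rw [mul_pow]; ring
  exact Nat.le_of_mul_le_mul_right (h5.trans h6) (Nat.succ_pos n)

theorem PG.ker_fg {d : ℕ} {G : Type} [Group G] (h : PG d G) [hG : Group.FG G]
    (φ : G →* Multiplicative ℤ) (hφ : Function.Surjective φ) : Group.FG φ.ker := by
  obtain ⟨t, ht⟩ := hφ (Multiplicative.ofAdd 1)
  obtain ⟨S, hScl, hSfin⟩ := Group.fg_iff.1 hG
  set e : G → ℤ := fun g => Multiplicative.toAdd (φ g) with he
  have hte : ∀ n : ℤ, φ (t ^ n) = Multiplicative.ofAdd n := by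
    intro n
    rw [map_zpow, ht, ← ofAdd_zsmul]; simp
  set r : G → G := fun s => s * t ^ (-(e s)) with hr
  have hrk : ∀ s, r s ∈ φ.ker := by
    intro s
    rw [MonoidHom.mem_ker, hr]
    simp only [map_mul, hte, he]
    rw [ofAdd_neg, ofAdd_toAdd, mul_inv_cancel]
  choose j hj using fun s => h.collision_all (r s) t
  choose j' hj' using fun s => h.collision_all (r s) t⁻¹
  set U : Set G := ⋃ s ∈ S, (((fun i : ℕ => t ^ i * r s * (t ^ i)⁻¹) '' Set.Iio (j s)) ∪
    ((fun i : ℕ => (t⁻¹) ^ i * r s * ((t⁻¹) ^ i)⁻¹) '' Set.Iio (j' s))) with hU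
  have hUfin : U.Finite := hSfin.biUnion fun s _ =>
    ((Set.finite_Iio _).image _).union ((Set.finite_Iio _).image _)
  set Q := Subgroup.closure U with hQ
  have hconjmem : ∀ s ∈ S, ∀ k : ℤ, t ^ k * r s * (t ^ k)⁻¹ ∈ Q := by
    intro s hs k
    obtain ⟨n, rfl | rfl⟩ := k.eq_nat_or_neg
    · have := hj s n
      rw [zpow_natCast]
      exact Subgroup.closure_mono (fun x hx => Set.mem_biUnion hs (Or.inl hx)) this
    · have := hj' s n
      rw [zpow_neg, zpow_natCast, ← inv_pow]
      exact Subgroup.closure_mono (fun x hx => Set.mem_biUnion hs (Or.inr hx)) this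
  have hinv : ∀ (m : ℤ), ∀ x ∈ Q, t ^ m * x * (t ^ m)⁻¹ ∈ Q := by
    intro m
    have : Q ≤ Q.comap (MulAut.conj (t ^ m)).toMonoidHom := by
      conv_lhs => rw [hQ]
      rw [Subgroup.closure_le]
      intro x hx
      obtain ⟨s, hs, hx⟩ := Set.mem_iUnion₂.1 hx
      simp only [SetLike.mem_coe, Subgroup.mem_comap]
      rcases hx with ⟨i, _, rfl⟩ | ⟨i, _, rfl⟩
      · have := hconjmem s hs (m + i)
        convert this using 1
        change t ^ m * (t ^ i * r s * (t ^ i)⁻¹) * (t ^ m)⁻¹ = _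
        simp [zpow_add, mul_assoc]
      · have := hconjmem s hs (m - i)
        convert this using 1
        change t ^ m * (t⁻¹ ^ i * r s * (t⁻¹ ^ i)⁻¹) * (t ^ m)⁻¹ = _
        simp [zpow_sub, mul_assoc]
    intro x hx
    exact this hx
  have hmain : ∀ g : G, g * t ^ (-(e g)) ∈ Q := by
    intro g
    have hg : g ∈ Subgroup.closure S := by rw [hScl]; trivial
    have hemul : ∀ a b, e (a * b) = e a + e b := by intro a b; simp [he]
    have heinv : ∀ a, e (a⁻¹) = - e a := by intro a; simp [he]
    induction hg using Subgroup.closure_induction with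
    | mem s hs =>
      have := hconjmem s hs 0
      rw [zpow_zero, one_mul, inv_one, mul_one] at this
      exact this
    | one => simp [he]
    | mul a b _ _ ha hb =>
      rw [hemul]
      have := Subgroup.mul_mem _ ha (hinv (e a) _ hb)
      convert this using 1
      simp only [← zpow_neg]
      group
    | inv a _ ha =>
      rw [heinv]
      have := hinv (-(e a)) _ (Subgroup.inv_mem _ ha)
      convert this using 1
      group
  have hQker : Q = φ.ker := by
    apply le_antisymm
    · rw [hQ, Subgroup.closure_le]
      intro x hx
      obtain ⟨s, hs, hx⟩ := Set.mem_iUnion₂.1 hx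
      rcases hx with ⟨i, _, rfl⟩ | ⟨i, _, rfl⟩
      · exact (MonoidHom.normal_ker φ).conj_mem _ (hrk s) _
      · exact (MonoidHom.normal_ker φ).conj_mem _ (hrk s) _
    · intro g hg
      have := hmain g
      have h0 : e g = 0 := by simp [he, MonoidHom.mem_ker.1 hg]
      simpa [h0] using this
  rw [← hQker, Group.fg_iff_subgroup_fg, Subgroup.fg_iff]
  exact ⟨U, rfl, hUfin⟩

end PartP3

section PartP2
open scoped Pointwise

/-- The group surjects onto the integers. -/
def SurjZ (G : Type) [Group G] : Prop :=
  ∃ φ : G →* Multiplicative ℤ, Function.Surjective φ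

theorem SurjZ.of_surjective {G H : Type} [Group G] [Group H] (f : G →* H)
    (hf : Function.Surjective f) (h : SurjZ H) : SurjZ G := by
  obtain ⟨φ, hφ⟩ := h
  exact ⟨φ.comp f, hφ.comp hf⟩

theorem surjZ_of_comm (A : Type) [AddCommGroup A] [AddGroup.FG A] [Infinite A] :
    ∃ φ : A →+ ℤ, Function.Surjective φ := by
  have hfin : Module.Finite ℤ A := Module.Finite.iff_addGroup_fg.2 inferInstance
  let T := Submodule.torsion ℤ A
  have hT : Finite T := by
    have : Module.IsTorsion ℤ T := Submodule.torsion_isTorsion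
    exact Module.finite_of_fg_torsion T this
  have hinf : Infinite (A ⧸ T) := by
    by_contra hcon
    have hcon : Finite (A ⧸ T) := not_infinite_iff_finite.1 hcon
    have : Finite A := by
      have h1 : Finite (A ⧸ T.toAddSubgroup) := hcon
      have h2 : Finite T.toAddSubgroup := hT
      exact AddSubgroup.finite_iff_finite_and_finiteIndex (H := T.toAddSubgroup) |>.2
        ⟨h2, AddSubgroup.finiteIndex_of_finite_quotient⟩
    exact not_finite A
  have hfree : Module.Free ℤ (A ⧸ T) := inferInstance
  let b := Module.Free.chooseBasis ℤ (A ⧸ T)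
  have hne : Nonempty (Module.Free.ChooseBasisIndex ℤ (A ⧸ T)) := by
    by_contra hcon
    rw [not_nonempty_iff] at hcon
    have : Subsingleton (A ⧸ T) := b.repr.toEquiv.subsingleton
    exact not_finite (A ⧸ T)
  obtain ⟨i⟩ := hne
  refine ⟨((b.coord i).comp T.mkQ).toAddMonoidHom, fun n => ?_⟩
  obtain ⟨a, ha⟩ := T.mkQ_surjective (n • b i)
  refine ⟨a, ?_⟩
  change b.coord i (T.mkQ a) = n
  rw [ha]
  simp

theorem surjZ_of_infinite_range {G A : Type} [Group G] [Group.FG G] [CommGroup A] (f : G →* A)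
    (hf : (Set.range f).Infinite) : SurjZ G := by
  have h1 : Group.FG f.range := Group.fg_of_surjective f.rangeRestrict_surjective
  have h2 : AddGroup.FG (Additive f.range) := GroupFG.iff_add_fg.1 h1
  have h3 : Infinite (Additive f.range) := by
    have : Infinite (Set.range f) := hf.to_subtype
    exact this
  obtain ⟨φ, hφ⟩ := surjZ_of_comm (Additive f.range)
  refine SurjZ.of_surjective f.rangeRestrict f.rangeRestrict_surjective
    ⟨AddMonoidHom.toMultiplicativeRight φ, ?_⟩
  intro n
  obtain ⟨a, ha⟩ := hφ n.toAdd
  exact ⟨a.toMul, by simp [ha]⟩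

theorem surjZ_of_torsionfree {G A : Type} [Group G] [Group.FG G] [AddCommGroup A]
    (f : G →* Multiplicative A)
    (htf : ∀ (n : ℕ) (a : A), n ≠ 0 → n • a = 0 → a = 0) (g : G) (hg : f g ≠ 1) : SurjZ G := by
  apply surjZ_of_infinite_range f
  refine Set.infinite_of_injective_forall_mem (f := fun n : ℕ => f (g ^ n)) ?_
    (fun n => ⟨_, rfl⟩)
  have hkey : ∀ m n : ℕ, m < n → f (g ^ m) ≠ f (g ^ n) := by
    intro m n hmn heq
    apply hg
    obtain ⟨k, rfl⟩ := Nat.exists_eq_add_of_lt hmn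
    rw [add_assoc, pow_add, map_mul, left_eq_mul, map_pow] at heq
    have h2 : (k + 1) • (f g).toAdd = 0 := by
      rw [← toAdd_pow, heq]; rfl
    exact htf _ _ (by omega) h2
  intro m n hmn
  rcases lt_trichotomy m n with h | h | h
  · exact absurd hmn (hkey _ _ h)
  · exact h
  · exact absurd hmn.symm (hkey _ _ h)

open scoped IsMulCommutative in
theorem surjZ_of_nilpotent_aux (n : ℕ) : ∀ (G : Type) [Group G] [Group.IsNilpotent G] [Group.FG G]
    [Infinite G], Group.nilpotencyClass G = n → SurjZ G := by
  induction n with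
  | zero =>
    intro G _ _ _ _ h
    have := Group.nilpotencyClass_zero_iff_subsingleton.mp h
    exact absurd (inferInstance : Finite G) (not_finite_iff_infinite.2 inferInstance)
  | succ n ih =>
    intro G _ _ _ _ h
    by_cases hfin : Finite (G ⧸ Subgroup.center G)
    · have hfi : (Subgroup.center G).FiniteIndex := Subgroup.finiteIndex_of_finite_quotient
      have hinf : Infinite (Subgroup.center G) := by
        by_contra hcon
        have hcon := not_infinite_iff_finite.1 hcon
        have : Finite G := Subgroup.finite_iff_finite_and_finiteIndex (H := Subgroup.center G) |>.2
          ⟨hcon, hfi⟩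
        exact not_finite G
      obtain ⟨ψ, hψ⟩ := surjZ_of_infinite_range (G := Subgroup.center G)
        (A := Subgroup.center G) (MonoidHom.id _) (by
          rw [MonoidHom.coe_id, Set.range_id]; exact Set.infinite_univ)
      obtain ⟨z, hz⟩ := hψ (Multiplicative.ofAdd 1)
      refine surjZ_of_torsionfree (A := ℤ) (ψ.comp (MonoidHom.transferCenterPow G)) ?_ (z : G) ?_
      · intro m a hm ha
        simpa [hm] using ha
      · have e : MonoidHom.transferCenterPow G (z : G) = z ^ (Subgroup.center G).index := by
          apply Subtype.ext
          simp [MonoidHom.transferCenterPow_apply]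
        rw [MonoidHom.comp_apply, e, map_pow, hz, ← ofAdd_nsmul]
        intro hcon
        have := congrArg Multiplicative.toAdd hcon
        simp only [toAdd_ofAdd, toAdd_one, nsmul_eq_mul, mul_one] at this
        exact hfi.index_ne_zero (by exact_mod_cast this)
    · have hinf : Infinite (G ⧸ Subgroup.center G) := not_finite_iff_infinite.1 hfin
      have hn : Group.nilpotencyClass (G ⧸ Subgroup.center G) = n := by
        simp [Group.nilpotencyClass_quotient_center, h]
      exact SurjZ.of_surjective (QuotientGroup.mk' _) (QuotientGroup.mk'_surjective _) (ih _ hn)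

theorem surjZ_of_nilpotent (G : Type) [Group G] [Group.IsNilpotent G] [Group.FG G]
    [Infinite G] : SurjZ G := surjZ_of_nilpotent_aux _ G rfl

/-- Every subgroup is finitely generated. -/
def AllFG (G : Type) [Group G] : Prop := ∀ H : Subgroup G, H.FG

theorem fg_of_ext {G Q : Type} [Group G] [Group Q] (f : G →* Q) (h1 : f.ker.FG)
    (h2 : f.range.FG) : Group.FG G := by
  obtain ⟨S, hS, hSf⟩ := (Subgroup.fg_iff _).1 h1
  obtain ⟨T, hT, hTf⟩ := (Subgroup.fg_iff _).1 h2
  have hTsub : ∀ q ∈ T, ∃ g, f g = q := by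
    intro q hq
    have : q ∈ f.range := by rw [← hT]; exact Subgroup.subset_closure hq
    exact this
  choose! u hu using hTsub
  rw [Group.fg_iff]
  refine ⟨S ∪ u '' T, ?_, hSf.union (hTf.image _)⟩
  rw [eq_top_iff]
  intro g _
  have hk : f.ker ≤ Subgroup.closure (S ∪ u '' T) := by
    rw [← hS]; exact Subgroup.closure_mono Set.subset_union_left
  have hr : f.range ≤ (Subgroup.closure (S ∪ u '' T)).map f := by
    rw [← hT, Subgroup.closure_le]
    intro q hq
    exact ⟨u q, Subgroup.subset_closure (Or.inr ⟨q, hq, rfl⟩), hu q hq⟩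
  obtain ⟨x, hx, hxg⟩ := hr ⟨g, rfl⟩
  have : x⁻¹ * g ∈ f.ker := by
    rw [MonoidHom.mem_ker, map_mul, map_inv, hxg, inv_mul_cancel]
  have := Subgroup.mul_mem _ hx (hk this)
  simpa using this

theorem AllFG.of_ext {G Q : Type} [Group G] [Group Q] (f : G →* Q) (h1 : AllFG f.ker)
    (h2 : AllFG Q) : AllFG G := by
  intro H
  rw [← Group.fg_iff_subgroup_fg]
  refine fg_of_ext (f.comp H.subtype) ?_ (h2 _)
  let j : (f.comp H.subtype).ker →* f.ker :=
    { toFun := fun x => ⟨(x : H), x.2⟩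
      map_one' := rfl
      map_mul' := fun _ _ => rfl }
  have hj : Function.Injective j := by
    intro x y hxy
    have := congrArg (fun z : f.ker => (z : G)) hxy
    exact Subtype.ext (Subtype.ext this)
  have e : (f.comp H.subtype).ker ≃* j.range := MonoidHom.ofInjective hj
  rw [← Group.fg_iff_subgroup_fg]
  have h3 : Group.FG j.range := (Group.fg_iff_subgroup_fg _).2 (h1 _)
  exact Group.fg_of_surjective (f := e.symm.toMonoidHom) e.symm.surjective

theorem AllFG.of_finite (G : Type) [Group G] [Finite G] : AllFG G := by
  intro H
  rw [← Group.fg_iff_subgroup_fg]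
  infer_instance

theorem fg_of_cyclic (C : Type) [Group C] [hc : IsCyclic C] : Group.FG C := by
  obtain ⟨g, hg⟩ := hc.exists_zpow_surjective
  rw [Group.fg_iff]
  refine ⟨{g}, ?_, Set.finite_singleton g⟩
  rw [eq_top_iff]
  intro x _
  obtain ⟨n, hn⟩ := hg x
  rw [← hn]
  exact Subgroup.zpow_mem _ (Subgroup.subset_closure (Set.mem_singleton g)) n

theorem AllFG.int : AllFG (Multiplicative ℤ) := fun H =>
  (Group.fg_iff_subgroup_fg H).1 (fg_of_cyclic H)

theorem AllFG.subgroup {G : Type} [Group G] (h : AllFG G) (H : Subgroup G) : AllFG H := by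
  intro K
  have h1 : Group.FG (K.map H.subtype) := (Group.fg_iff_subgroup_fg _).2 (h _)
  have e : K ≃* K.map H.subtype := K.equivMapOfInjective _ H.subtype_injective
  rw [← Group.fg_iff_subgroup_fg]
  exact Group.fg_of_surjective (f := e.symm.toMonoidHom) e.symm.surjective

theorem AllFG.of_surjective {G Q : Type} [Group G] [Group Q] (f : G →* Q)
    (hf : Function.Surjective f) (h : AllFG G) : AllFG Q := by
  intro H
  obtain ⟨S, hS, hSf⟩ := (Subgroup.fg_iff _).1 (h (H.comap f))
  refine (Subgroup.fg_iff _).2 ⟨f '' S, ?_, hSf.image _⟩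
  rw [← MonoidHom.map_closure, hS, Subgroup.map_comap_eq_self_of_surjective hf]

theorem AllFG.of_finiteIndex {G : Type} [Group G] (H : Subgroup G) [H.FiniteIndex]
    (h : AllFG H) : AllFG G := by
  have e : AllFG H.normalCore := by
    have h1 := h.subgroup (H.normalCore.subgroupOf H)
    have e := Subgroup.subgroupOfEquivOfLe H.normalCore_le
    exact AllFG.of_surjective e.toMonoidHom e.surjective h1
  have : AllFG (QuotientGroup.mk' H.normalCore).ker := by
    rw [QuotientGroup.ker_mk']; exact e
  exact AllFG.of_ext _ this (AllFG.of_finite _)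

end PartP2

section PartP4
open scoped Pointwise

open Polynomial in
/-- the difference polynomial of two finite sets of exponents -/
noncomputable def diffPoly (I J : Finset ℕ) : ℤ[X] := ∑ i ∈ I, X ^ i - ∑ i ∈ J, X ^ i

theorem diffPoly_coeff (I J : Finset ℕ) (i : ℕ) :
    (diffPoly I J).coeff i = (if i ∈ I then 1 else 0) - (if i ∈ J then 1 else 0) := by
  simp [diffPoly, Polynomial.coeff_X_pow]

theorem diffPoly_ne_zero {I J : Finset ℕ} (h : I ≠ J) : diffPoly I J ≠ 0 := by
  intro h0
  apply h
  ext i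
  have := diffPoly_coeff I J i
  rw [h0] at this
  by_cases h1 : i ∈ I <;> by_cases h2 : i ∈ J <;> simp_all

theorem diffPoly_root {I J : Finset ℕ} (h : I ≠ J) (z : ℂ)
    (hz : Polynomial.aeval z (diffPoly I J) = 0) : ‖z‖ ≤ 2 := by
  have h0 := diffPoly_ne_zero h
  set p := (diffPoly I J).map (Int.castRingHom ℂ) with hp
  have hp0 : p ≠ 0 := (Polynomial.map_ne_zero_iff (RingHom.injective_int _)).2 h0
  have hr : p.IsRoot z := by
    rw [Polynomial.IsRoot, hp, Polynomial.eval_map]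
    exact hz
  have hb := hr.norm_lt_cauchyBound hp0
  have hc : ∀ i, ‖p.coeff i‖₊ ≤ 1 := by
    intro i
    rw [hp, Polynomial.coeff_map, diffPoly_coeff]
    by_cases h1 : i ∈ I <;> by_cases h2 : i ∈ J <;> simp [h1, h2]
  have hl : ‖p.leadingCoeff‖₊ = 1 := by
    have h2 : p.leadingCoeff ≠ 0 := Polynomial.leadingCoeff_ne_zero.2 hp0
    rw [Polynomial.leadingCoeff] at h2 ⊢
    rw [hp, Polynomial.coeff_map, diffPoly_coeff] at h2 ⊢
    split_ifs at h2 ⊢ <;> simp_all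
  have h3 : p.cauchyBound ≤ 2 := by
    rw [Polynomial.cauchyBound, hl, div_one]
    have : (Finset.range p.natDegree).sup (fun i => ‖p.coeff i‖₊) ≤ 1 :=
      Finset.sup_le fun i _ => hc i
    calc _ ≤ (1 : NNReal) + 1 := by gcongr
      _ = 2 := by norm_num
  exact (hb.trans_le (by exact_mod_cast h3)).le

open Polynomial in
/-- the ideal of rational polynomials with an integer multiple killing `T` -/
def ratAnn {A : Type} [AddCommGroup A] (T : Module.End ℤ A) : Ideal ℚ[X] where
  carrier := {p | ∃ c : ℤ, c ≠ 0 ∧ ∃ q : ℤ[X], q.map (Int.castRingHom ℚ) = C (c : ℚ) * p ∧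
    aeval T q = 0}
  zero_mem' := ⟨1, one_ne_zero, 0, by simp, by simp⟩
  add_mem' := by
    rintro p p' ⟨c, hc, q, hq, hT⟩ ⟨c', hc', q', hq', hT'⟩
    refine ⟨c * c', mul_ne_zero hc hc', C c' * q + C c * q', ?_, by simp [hT, hT']⟩
    simp only [Polynomial.map_add, Polynomial.map_mul, hq, hq', map_C, Int.cast_mul,
      Int.coe_castRingHom, C_mul]
    ring
  smul_mem' := by
    rintro r p ⟨c, hc, q, hq, hT⟩
    obtain ⟨b, hbm, hb⟩ := IsLocalization.integerNormalization_spec (nonZeroDivisors ℤ) r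
    refine ⟨b * c, mul_ne_zero (nonZeroDivisors.ne_zero hbm) hc,
      IsLocalization.integerNormalization (nonZeroDivisors ℤ) r * q, ?_, by simp [hT]⟩
    rw [Polynomial.map_mul, hq]
    have : (IsLocalization.integerNormalization (nonZeroDivisors ℤ) r).map (Int.castRingHom ℚ)
      = C ((b : ℤ) : ℚ) * r := by
      have e : Int.castRingHom ℚ = algebraMap ℤ ℚ := rfl
      rw [e, hb]
      ext i
      simp
    rw [this]
    simp only [Int.cast_mul, C_mul, smul_eq_mul]
    ring

open Polynomial in
theorem ratAnn_of_aeval {A : Type} [AddCommGroup A] (T : Module.End ℤ A) (q : ℤ[X])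
    (h : aeval T q = 0) : q.map (Int.castRingHom ℚ) ∈ ratAnn T :=
  ⟨1, one_ne_zero, q, by simp, h⟩

open Polynomial in
theorem ratAnn_aeval {A : Type} [AddCommGroup A] (T : Module.End ℤ A) (q : ℤ[X])
    (h : q.map (Int.castRingHom ℚ) ∈ ratAnn T) : ∃ c : ℤ, c ≠ 0 ∧ c • aeval T q = 0 := by
  obtain ⟨c, hc, q', hq, hT⟩ := h
  refine ⟨c, hc, ?_⟩
  have : q' = C c * q := by
    apply Polynomial.map_injective (Int.castRingHom ℚ) (RingHom.injective_int _)
    rw [hq]; simp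
  rw [this] at hT
  simpa [Algebra.smul_def] using hT

open Polynomial in
theorem ratAnn_X {A : Type} [AddCommGroup A] (T : Module.End ℤ A) (hinj : Function.Injective T)
    (p : ℚ[X]) (h : X * p ∈ ratAnn T) : p ∈ ratAnn T := by
  obtain ⟨b, hbm, hb⟩ := IsLocalization.integerNormalization_spec (nonZeroDivisors ℤ) p
  have e : Int.castRingHom ℚ = algebraMap ℤ ℚ := rfl
  set r := IsLocalization.integerNormalization (nonZeroDivisors ℤ) p with hr
  have hrp : r.map (Int.castRingHom ℚ) = C ((b : ℤ) : ℚ) * p := by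
    rw [e, hb]
    ext i
    simp
  have hb0 : (b : ℤ) ≠ 0 := nonZeroDivisors.ne_zero hbm
  have h1 : (X * r).map (Int.castRingHom ℚ) ∈ ratAnn T := by
    rw [Polynomial.map_mul, hrp, map_X, mul_left_comm]
    exact Ideal.mul_mem_left _ _ h
  obtain ⟨c, hc, h2⟩ := ratAnn_aeval T _ h1
  refine ⟨c * b, mul_ne_zero hc hb0, C c * r, by simp [hrp, mul_assoc], ?_⟩
  ext a
  apply hinj
  have := LinearMap.congr_fun h2 a
  simpa using this

open Polynomial in
theorem quasi_unipotent {A : Type} [AddCommGroup A] [Module.Finite ℤ A] (T : Module.End ℤ A)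
    (hT : Function.Injective T)
    (hcol : ∀ (k : ℕ) (a : A), ∃ I J : Finset ℕ, I ≠ J ∧ aeval (T ^ k) (diffPoly I J) a = 0) :
    ∃ m : ℕ, 0 < m ∧ ∃ n : ℕ, (T ^ m - 1) ^ n = 0 := by
  classical
  obtain ⟨f, hf, hfT⟩ := LinearMap.exists_monic_and_aeval_eq_zero ℤ T
  set g := Submodule.IsPrincipal.generator (ratAnn T) with hg
  have hgI : g ∈ ratAnn T := Submodule.IsPrincipal.generator_mem _
  have hdvd : ∀ p ∈ ratAnn T, g ∣ p := fun p hp =>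
    (Submodule.IsPrincipal.mem_iff_generator_dvd _).1 hp
  have hgf : g ∣ f.map (algebraMap ℤ ℚ) := hdvd _ (ratAnn_of_aeval T f hfT)
  obtain ⟨g', hg'⟩ := IsIntegrallyClosed.eq_map_mul_C_of_dvd ℚ hf hgf
  have hg0 : g ≠ 0 := ne_zero_of_dvd_ne_zero (Monic.ne_zero <| hf.map (algebraMap ℤ ℚ)) hgf
  have hmon : g'.Monic := by
    have h1 := congrArg leadingCoeff hg'
    rw [leadingCoeff_mul, leadingCoeff_C, leadingCoeff_map_of_injective
      (RingHom.injective_int _)] at h1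
    have h2 : algebraMap ℤ ℚ g'.leadingCoeff = 1 :=
      mul_right_cancel₀ (leadingCoeff_ne_zero.2 hg0) (by rw [h1, one_mul])
    have h3 : ((g'.leadingCoeff : ℤ) : ℚ) = 1 := h2
    exact_mod_cast h3
  have hg'dvd : ∀ p ∈ ratAnn T, g'.map (Int.castRingHom ℚ) ∣ p := fun p hp =>
    (Dvd.intro _ hg').trans (hdvd p hp)
  -- integer version
  have hz' : ∀ q : ℤ[X], aeval T q = 0 → g' ∣ q := by
    intro q hq
    have := hg'dvd _ (ratAnn_of_aeval T q hq)
    exact (map_dvd_map (Int.castRingHom ℚ) (RingHom.injective_int _) hmon).1 this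
  have hg'I : g'.map (Int.castRingHom ℚ) ∈ ratAnn T := by
    have e : g'.map (Int.castRingHom ℚ) = C (g.leadingCoeff⁻¹) * g := by
      have h5 : C (g.leadingCoeff⁻¹) * g = C (g.leadingCoeff⁻¹) *
          (C g.leadingCoeff * g'.map (Int.castRingHom ℚ)) := by
        congr 1
        rw [mul_comm]
        exact hg'.symm
      rw [h5, ← mul_assoc, ← C_mul, inv_mul_cancel₀ (leadingCoeff_ne_zero.2 hg0), C_1, one_mul]
    rw [e]
    exact Ideal.mul_mem_left _ _ hgI
  -- zero is not a root
  have hX : ¬ (X ∣ g') := by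
    rintro ⟨h, rfl⟩
    have h1 : h.map (Int.castRingHom ℚ) ∈ ratAnn T := by
      apply ratAnn_X T hT
      simpa using hg'I
    have h2 := hg'dvd _ h1
    have h3 : X * h ∣ h := (map_dvd_map (Int.castRingHom ℚ) (RingHom.injective_int _) hmon).1 h2
    have h0 : h ≠ 0 := by rintro rfl; simp at hmon
    have := natDegree_le_of_dvd h3 h0
    rw [natDegree_X_mul h0] at this
    omega
  obtain ⟨s, hs⟩ := (Module.Finite.fg_top : (⊤ : Submodule ℤ A).FG)
  have hroot : ∀ z : ℂ, aeval z g' = 0 → ‖z‖ ≤ 1 := by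
    intro z hz
    have hk : ∀ k : ℕ, ‖z ^ k‖ ≤ 2 := by
      intro k
      choose I J hne hIJ using hcol k
      let P : ℤ[X] := ∏ a ∈ s, diffPoly (I a) (J a)
      have hP : aeval (T ^ k) P = 0 := by
        have : (⊤ : Submodule ℤ A) ≤ LinearMap.ker (aeval (T ^ k) P) := by
          rw [← hs, Submodule.span_le]
          intro a ha
          have ha : a ∈ s := ha
          have hPa : P = (∏ b ∈ s.erase a, diffPoly (I b) (J b)) * diffPoly (I a) (J a) :=
            (Finset.prod_erase_mul s _ ha).symm
          change aeval (T ^ k) P a = 0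
          rw [hPa, map_mul, Module.End.mul_apply, hIJ, map_zero]
        exact LinearMap.ker_eq_top.1 (top_le_iff.1 this)
      have h2 := hz' (expand ℤ k P) (by rw [expand_aeval, hP])
      have h3 : aeval z (expand ℤ k P) = 0 := by
        obtain ⟨r, hr⟩ := h2
        rw [hr, map_mul, hz, zero_mul]
      rw [expand_aeval, map_prod, Finset.prod_eq_zero_iff] at h3
      obtain ⟨a, _, ha⟩ := h3
      exact diffPoly_root (hne a) _ ha
    by_contra hcon
    obtain ⟨k, hk'⟩ := pow_unbounded_of_one_lt 2 (not_le.1 hcon)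
    have := hk k
    rw [norm_pow] at this
    linarith
  have hM : (g'.map (Int.castRingHom ℂ)).mahlerMeasure = 1 := by
    rw [mahlerMeasure_eq_leadingCoeff_mul_prod_roots, (hmon.map _).leadingCoeff, norm_one, one_mul]
    apply Multiset.prod_eq_one
    intro x hx
    obtain ⟨z, hz, rfl⟩ := Multiset.mem_map.1 hx
    have h1 : aeval z g' = 0 := by
      have := isRoot_of_mem_roots hz
      rw [IsRoot, eval_map] at this
      exact this
    exact max_eq_left (hroot z h1)
  have hunity : ∀ z ∈ g'.aroots ℂ, ∃ n, 0 < n ∧ z ^ n = 1 := by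
    intro z hz
    refine pow_eq_one_of_mahlerMeasure_eq_one hM ?_ hz
    rintro rfl
    apply hX
    rw [X_dvd_iff]
    have h := (mem_aroots.1 hz).2
    rw [aeval_def, eval₂_at_zero] at h
    exact (RingHom.injective_int (algebraMap ℤ ℂ)) (by rw [h, map_zero])
  choose! o ho ho1 using hunity
  let m := ((g'.aroots ℂ).map o).prod
  have hm : 0 < m := by
    apply Nat.pos_of_ne_zero
    apply Multiset.prod_ne_zero
    intro h0
    obtain ⟨z, hz, h1⟩ := Multiset.mem_map.1 h0
    have := ho z hz
    omega
  have hmz : ∀ z ∈ g'.aroots ℂ, z ^ m = 1 := by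
    intro z hz
    obtain ⟨c, hc⟩ := Multiset.dvd_prod (Multiset.mem_map_of_mem o hz)
    change z ^ ((g'.aroots ℂ).map o).prod = 1
    rw [hc, pow_mul, ho1 z hz, one_pow]
  have hdiv : g' ∣ (X ^ m - 1) ^ (Multiset.card (g'.aroots ℂ)) := by
    apply (map_dvd_map (Int.castRingHom ℂ) (RingHom.injective_int _) hmon).1
    have hsp := (IsAlgClosed.splits (g'.map (Int.castRingHom ℂ))).eq_prod_roots_of_monic
      (hmon.map _)
    rw [hsp]
    have : ((X ^ m - 1 : ℤ[X]) ^ (Multiset.card (g'.aroots ℂ))).map (Int.castRingHom ℂ)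
      = ((g'.aroots ℂ).map (fun _ => (X ^ m - 1 : ℂ[X]))).prod := by
      simp
    rw [this]
    apply Multiset.prod_dvd_prod_of_dvd
    intro z hz
    rw [dvd_iff_isRoot]
    simp [hmz z hz]
  obtain ⟨c, hc, hcT⟩ := ratAnn_aeval T g' hg'I
  set N := Multiset.card (g'.aroots ℂ)
  have hcN : c • (T ^ m - 1) ^ N = 0 := by
    obtain ⟨r, hr⟩ := hdiv
    have h1 : (T ^ m - 1) ^ N = aeval T ((X ^ m - 1 : ℤ[X]) ^ N) := by simp
    rw [h1, hr, mul_comm, map_mul, ← mul_smul_comm, hcT, mul_zero]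
  -- torsion part
  let W := Submodule.torsion ℤ A
  have hW : Finite W := by
    have : Module.IsTorsion ℤ W := Submodule.torsion_isTorsion
    exact Module.finite_of_fg_torsion W this
  have hWT : ∀ w ∈ W, T w ∈ W := by
    intro w hw
    obtain ⟨a, ha⟩ := (Submodule.mem_torsion_iff _).1 hw
    refine (Submodule.mem_torsion_iff _).2 ⟨a, ?_⟩
    have : a • T w = T (a • w) := (T.map_smul (a : ℤ) w).symm
    rw [this, ha, map_zero]
  let τ : W → W := fun w => ⟨T w, hWT w w.2⟩
  have hτinj : Function.Injective τ := by
    intro a b hab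
    exact Subtype.ext (hT (congrArg Subtype.val hab))
  let e : Equiv.Perm W := Equiv.ofBijective τ (Finite.injective_iff_bijective.1 hτinj)
  have hite : ∀ (n : ℕ) (w : W), (((e ^ n) w : W) : A) = (T ^ n) w := by
    intro n
    induction n with
    | zero => intro w; simp
    | succ n ih =>
      intro w
      rw [pow_succ', Equiv.Perm.mul_apply, pow_succ', Module.End.mul_apply, ← ih]
      rfl
  obtain ⟨l, hl, hl1⟩ := isOfFinOrder_iff_pow_eq_one.1 (isOfFinOrder_of_finite e)
  have hlW : ∀ w ∈ W, (T ^ l - 1) w = 0 := by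
    intro w hw
    have := hite l ⟨w, hw⟩
    rw [hl1] at this
    simp only [LinearMap.sub_apply, Module.End.one_apply, sub_eq_zero]
    exact this.symm
  have hfin : (T ^ l - 1) * (T ^ m - 1) ^ N = 0 := by
    ext a
    apply hlW
    refine (Submodule.mem_torsion_iff _).2 ⟨⟨c, mem_nonZeroDivisors_of_ne_zero hc⟩, ?_⟩
    exact LinearMap.congr_fun hcN a
  refine ⟨l * m, by positivity, N + 1, ?_⟩
  have d1 : (X ^ l - 1 : ℤ[X]) * (X ^ m - 1) ^ N ∣ (X ^ (l * m) - 1) ^ (N + 1) := by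
    rw [pow_succ']
    apply mul_dvd_mul
    · rw [pow_mul]; simpa using sub_dvd_pow_sub_pow (X ^ l : ℤ[X]) 1 m
    · apply pow_dvd_pow_of_dvd
      rw [mul_comm, pow_mul]; simpa using sub_dvd_pow_sub_pow (X ^ m : ℤ[X]) 1 l
  obtain ⟨r, hr⟩ := d1
  have h1 : (T ^ (l * m) - 1) ^ (N + 1) = aeval T ((X ^ (l * m) - 1 : ℤ[X]) ^ (N + 1)) := by simp
  have h2 : aeval T ((X ^ l - 1 : ℤ[X]) * (X ^ m - 1) ^ N) = 0 := by simpa using hfin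
  rw [h1, hr, map_mul, h2, zero_mul]

end PartP4

section PartP4b
open scoped Pointwise

theorem ucs_subgroup {H : Type} [Group H] (z : H) (j : ℕ) : ∃ L : Subgroup H, ∀ h, h ∈ L ↔
    z * h * z⁻¹ * h⁻¹ ∈ Subgroup.upperCentralSeries H j := by
  refine ⟨(Subgroup.centralizer {(QuotientGroup.mk' (Subgroup.upperCentralSeries H j)) z}).comap
    (QuotientGroup.mk' (Subgroup.upperCentralSeries H j)), fun h => ?_⟩
  rw [Subgroup.mem_comap, Subgroup.mem_centralizer_singleton_iff]
  have e : z * h * z⁻¹ * h⁻¹ ∈ Subgroup.upperCentralSeries H j ↔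
      QuotientGroup.mk' (Subgroup.upperCentralSeries H j) (z * h * z⁻¹ * h⁻¹) = 1 :=
    (QuotientGroup.eq_one_iff _).symm
  rw [e, map_mul, map_mul, map_mul, map_inv, map_inv, mul_inv_eq_one, mul_inv_eq_iff_eq_mul]
  exact eq_comm

theorem nilpotent_of_lcs_le_ucs {H : Type} [Group H] (k : ℕ) : ∀ K : ℕ,
    (⊤ : Subgroup H).lowerCentralSeries K ≤ Subgroup.upperCentralSeries H k →
    Group.IsNilpotent H := by
  induction k with
  | zero =>
    intro K h
    rw [Subgroup.nilpotent_iff_lowerCentralSeries]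
    refine ⟨K, ?_⟩
    rw [Subgroup.upperCentralSeries_zero] at h
    exact le_bot_iff.1 h
  | succ k ih =>
    intro K h
    apply ih (K + 1)
    rw [Subgroup.lowerCentralSeries_succ]
    exact (Subgroup.commutator_mono h le_rfl).trans
      (Subgroup.commutator_upperCentralSeries_top_le _ k)

/-- the commutator map -/
def comMap {G : Type} [Group G] (s z : G) : G := z * s * z⁻¹ * s⁻¹

open scoped IsMulCommutative in
theorem colWord_comm {G : Type} [Group G] (Z : Subgroup G) [Z.Normal] [IsMulCommutative Z]
    (s : G) (z : Z) (T : Module.End ℤ (Additive Z))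
    (hT : ∀ x : Z, T (Additive.ofMul x) = Additive.ofMul (MulAut.conjNormal s x)) (n : ℕ)
    (I : Finset ℕ) :
    colWord (z : G) s n I =
      ((Additive.toMul (∑ i ∈ (Finset.range n).filter (· ∈ I), (T ^ i) (Additive.ofMul z)) : Z) : G)
      := by
  have hTi : ∀ (i : ℕ) (x : Z), (T ^ i) (Additive.ofMul x) =
      Additive.ofMul (MulAut.conjNormal (s ^ i) x) := by
    intro i
    induction i with
    | zero => intro x; simp
    | succ i ih =>
      intro x
      rw [pow_succ, Module.End.mul_apply, hT, ih, pow_succ, map_mul, MulAut.mul_apply]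
  induction n with
  | zero => simp [colWord]
  | succ n ih =>
    rw [colWord, ih, Finset.range_add_one, Finset.filter_insert]
    split_ifs with h
    · rw [Finset.sum_insert (by simp), add_comm, toMul_add, Subgroup.coe_mul, hTi n z]
      rfl
    · simp

open scoped IsMulCommutative in
theorem abelian_unip {d : ℕ} {G : Type} [Group G] (hG : PG d G) (Z : Subgroup G) [Z.Normal]
    [IsMulCommutative Z] (hZ : Z.FG) (t : G) :
    ∃ m : ℕ, 0 < m ∧ ∃ k : ℕ, ∀ l : ℕ, ∀ z ∈ Z, (comMap (t ^ (m * l)))^[k] z = 1 := by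
  have hfg : Group.FG Z := (Group.fg_iff_subgroup_fg _).2 hZ
  have hfg2 : AddGroup.FG (Additive Z) := GroupFG.iff_add_fg.1 hfg
  have hfin : Module.Finite ℤ (Additive Z) := Module.Finite.iff_addGroup_fg.2 inferInstance
  let T : Module.End ℤ (Additive Z) :=
    AddMonoidHom.toIntLinearMap
      (MonoidHom.toAdditive (MulAut.conjNormal t : MulAut Z).toMonoidHom)
  have hT : ∀ x : Z, T (Additive.ofMul x) = Additive.ofMul (MulAut.conjNormal t x) := fun x => rfl
  have hTi : ∀ (i : ℕ) (x : Z), (T ^ i) (Additive.ofMul x) =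
      Additive.ofMul (MulAut.conjNormal (t ^ i) x) := by
    intro i
    induction i with
    | zero => intro x; simp
    | succ i ih =>
      intro x
      rw [pow_succ, Module.End.mul_apply, hT, ih, pow_succ, map_mul, MulAut.mul_apply]
  have hTinj : Function.Injective T := by
    intro a b hab
    exact (MulAut.conjNormal t : MulAut Z).injective hab
  obtain ⟨m, hm, k, hk⟩ := quasi_unipotent T hTinj (by
    intro k a
    obtain ⟨n, I, J, hI, hJ, hne, h⟩ := hG.collision ((Additive.toMul a : Z) : G) (t ^ k)
    refine ⟨I, J, hne, ?_⟩
    rw [colWord_comm Z (t ^ k) (Additive.toMul a) (T ^ k) (hTi k),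
      colWord_comm Z (t ^ k) (Additive.toMul a) (T ^ k) (hTi k)] at h
    have h2 := Subtype.ext h
    have h3 := Additive.toMul.injective h2
    have e : ∀ I ⊆ Finset.range n, (Finset.range n).filter (· ∈ I) = I := by
      intro I hI
      ext i
      simp only [Finset.mem_filter, and_iff_right_iff_imp]
      exact fun h => hI h
    rw [e I hI, e J hJ] at h3
    simp only [diffPoly, map_sub, map_sum, map_pow, Polynomial.aeval_X, LinearMap.sub_apply,
      LinearMap.sum_apply, sub_eq_zero]
    exact h3)
  refine ⟨m, hm, k, fun l z hz => ?_⟩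
  have hkl : (1 - T ^ (m * l)) ^ k = 0 := by
    have hc : Commute (T ^ m) 1 := Commute.one_right _
    have h1 : T ^ (m * l) - 1 = (T ^ m - 1) * ∑ i ∈ Finset.range l, (T ^ m) ^ i := by
      rw [mul_geom_sum, pow_mul]
    have h2 : Commute (T ^ m - 1) (∑ i ∈ Finset.range l, (T ^ m) ^ i) := by
      apply Commute.sum_right
      intro i _
      exact ((Commute.refl (T ^ m)).sub_left (Commute.one_left _)).pow_right i
    rw [← neg_sub, h1, neg_pow, h2.mul_pow, hk, zero_mul, mul_zero]
  have hit : ∀ (j : ℕ) (x : Z), (comMap (t ^ (m * l)))^[j] (x : G) =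
      ((Additive.toMul (((1 - T ^ (m * l)) ^ j) (Additive.ofMul x)) : Z) : G) := by
    intro j
    induction j with
    | zero => intro x; simp
    | succ j ih =>
      intro x
      have e : comMap (t ^ (m * l)) (x : G) =
          ((Additive.toMul ((1 - T ^ (m * l)) (Additive.ofMul x)) : Z) : G) := by
        rw [LinearMap.sub_apply, hTi, Module.End.one_apply, toMul_sub, div_eq_mul_inv,
          toMul_ofMul, toMul_ofMul, Subgroup.coe_mul, Subgroup.coe_inv,
          MulAut.conjNormal_apply]
        simp only [comMap, mul_assoc, mul_inv_rev, inv_inv]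
      rw [Function.iterate_succ_apply, e, ih, pow_succ, Module.End.mul_apply]
      rfl
  rw [hit k ⟨z, hz⟩, hkl]
  rfl

theorem struct_aux {d : ℕ} (n : ℕ) : ∀ (G : Type) [Group G] (N : Subgroup G) [N.Normal] (t : G),
    AllFG G → PG d G → N.lowerCentralSeries n = ⊥ →
    ∃ m : ℕ, 0 < m ∧ ∃ K : ℕ, (N ⊔ Subgroup.zpowers (t ^ m)).lowerCentralSeries K = ⊥ := by
  induction n with
  | zero =>
    intro G _ N _ t hA hG h
    rw [Subgroup.lowerCentralSeries_zero] at h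
    refine ⟨1, one_pos, 1, ?_⟩
    rw [h, bot_sup_eq, Subgroup.lowerCentralSeries_succ, Subgroup.lowerCentralSeries_zero,
      Subgroup.commutator_eq_bot_iff_le_centralizer, Subgroup.le_centralizer_iff_isMulCommutative]
    infer_instance
  | succ n ih =>
    intro G _ N _ t hA hG h
    let Z := N.lowerCentralSeries n
    have hZN : Z ≤ Subgroup.centralizer N := by
      rw [← Subgroup.commutator_eq_bot_iff_le_centralizer]
      exact h
    have hZle : Z ≤ N := Subgroup.lowerCentralSeries_le_self N n
    have hZc : IsMulCommutative Z := by
      rw [← Subgroup.le_centralizer_iff_isMulCommutative]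
      exact hZN.trans (Subgroup.centralizer_le hZle)
    obtain ⟨m2, hm2, k, hk⟩ := abelian_unip hG Z (hA Z) t
    let q := QuotientGroup.mk' Z
    have hq : Function.Surjective q := QuotientGroup.mk'_surjective Z
    have hNn : (N.map q).Normal := Subgroup.Normal.map inferInstance q hq
    obtain ⟨m1, hm1, K, hK⟩ := ih (G ⧸ Z) (N.map q) (q t) (hA.of_surjective q hq)
      (hG.of_surjective q hq) (by
        rw [← Subgroup.map_lowerCentralSeries]
        rw [Subgroup.map_eq_bot_iff, QuotientGroup.ker_mk'])
    refine ⟨m2 * m1, by positivity, ?_⟩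
    set s := t ^ (m2 * m1) with hs
    set H := N ⊔ Subgroup.zpowers s with hH
    have hHK : H.lowerCentralSeries K ≤ Z := by
      have h1 : H.map q ≤ N.map q ⊔ Subgroup.zpowers (q t ^ m1) := by
        rw [hH, Subgroup.map_sup]
        apply sup_le_sup_left
        rw [MonoidHom.map_zpowers, Subgroup.zpowers_le, hs, map_pow, mul_comm, pow_mul]
        exact Subgroup.pow_mem _ (Subgroup.mem_zpowers _) _
      have h2 : (H.map q).lowerCentralSeries K ≤
        (N.map q ⊔ Subgroup.zpowers (q t ^ m1)).lowerCentralSeries K :=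
        Subgroup.lowerCentralSeries_mono K h1
      rw [hK, ← Subgroup.map_lowerCentralSeries, le_bot_iff, Subgroup.map_eq_bot_iff,
        QuotientGroup.ker_mk'] at h2
      exact h2
    have hucs : ∀ (j : ℕ) (z : H), (z : G) ∈ Z → (comMap s)^[j] (z : G) = 1 →
        z ∈ Subgroup.upperCentralSeries H j := by
      intro j
      induction j with
      | zero =>
        intro z _ hz
        have : z = 1 := Subtype.ext hz
        rw [this]; exact Subgroup.one_mem _
      | succ j ihj =>
        intro z hzZ hz
        obtain ⟨L, hL⟩ := ucs_subgroup z j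
        have hLtop : H ≤ L.map H.subtype := by
          have h1 : N ≤ L.map H.subtype := by
            intro x hx
            have hxH : x ∈ H := Subgroup.mem_sup_left hx
            refine ⟨⟨x, hxH⟩, ?_, rfl⟩
            apply (hL _).2
            have : z * ⟨x, hxH⟩ * z⁻¹ * (⟨x, hxH⟩ : H)⁻¹ = 1 := by
              apply Subtype.ext
              have := Subgroup.mem_centralizer_iff.1 (hZN hzZ) x hx
              simp [← this]
            rw [this]
            exact Subgroup.one_mem _
          have h2 : Subgroup.zpowers s ≤ L.map H.subtype := by
            rw [Subgroup.zpowers_le]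
            have hxH : s ∈ H := Subgroup.mem_sup_right (Subgroup.mem_zpowers s)
            refine ⟨⟨s, hxH⟩, ?_, rfl⟩
            apply (hL _).2
            apply ihj
            · change (z : G) * s * (z : G)⁻¹ * s⁻¹ ∈ Z
              rw [mul_assoc, mul_assoc]
              apply Subgroup.mul_mem _ hzZ
              rw [← mul_assoc]
              exact Subgroup.Normal.conj_mem inferInstance _ (Subgroup.inv_mem _ hzZ) s
            · rw [Function.iterate_succ_apply] at hz
              exact hz
          exact sup_le h1 h2
        rw [Subgroup.mem_upperCentralSeries_succ_iff]
        intro y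
        obtain ⟨y', hy', hyy⟩ := hLtop y.2
        have : y' = y := Subtype.ext hyy
        rw [this] at hy'
        exact (hL y).1 hy'
    have hnil : Group.IsNilpotent H := by
      apply nilpotent_of_lcs_le_ucs k K
      intro x hx
      have hxZ : (x : G) ∈ Z := by
        apply hHK
        rw [← Subgroup.top_subtype_lowerCentralSeries]
        exact ⟨x, hx, rfl⟩
      exact hucs k x hxZ (hk m1 x hxZ)
    exact (Subgroup.isNilpotent_iff_lowerCentralSeries _).1 hnil

theorem exists_char_finiteIndex {K : Type} [Group K] [Group.FG K] (N0 : Subgroup K)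
    [N0.FiniteIndex] : ∃ N : Subgroup K, N.Characteristic ∧ N.FiniteIndex ∧ N ≤ N0 := by
  have hfin : Finite (K →* Equiv.Perm (K ⧸ N0)) := by
    obtain ⟨S, hS, hSf⟩ := Group.fg_iff.1 (inferInstance : Group.FG K)
    have : Finite S := hSf.to_subtype
    refine Finite.of_injective
      (fun (f : K →* Equiv.Perm (K ⧸ N0)) (s : S) => f s) ?_
    intro f g hfg
    apply MonoidHom.eq_of_eqOn_dense hS
    intro s hs
    exact congrFun hfg ⟨s, hs⟩
  refine ⟨⨅ f : K →* Equiv.Perm (K ⧸ N0), f.ker, ?_, ?_, ?_⟩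
  · rw [Subgroup.characteristic_iff_le_comap]
    intro φ x hx
    rw [Subgroup.mem_comap, Subgroup.mem_iInf]
    intro f
    exact (Subgroup.mem_iInf.1 hx) (f.comp φ.toMonoidHom)
  · apply Subgroup.finiteIndex_iInf
    intro f
    infer_instance
  · intro x hx
    have h := (Subgroup.mem_iInf.1 hx) (MulAction.toPermHom K (K ⧸ N0))
    rw [MonoidHom.mem_ker] at h
    have h1 := Equiv.congr_fun h ((1 : K) : K ⧸ N0)
    have h2 : ((x * 1 : K) : K ⧸ N0) = ((1 : K) : K ⧸ N0) := h1
    rw [mul_one] at h2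
    rw [QuotientGroup.eq] at h2
    simpa using h2

theorem virt_nilp_of_ker {d : ℕ} {G : Type} [Group G] (hG : PG d G)
    (φ : G →* Multiplicative ℤ) (hφ : Function.Surjective φ) (hK : AllFG φ.ker)
    (hv : Group.IsVirtuallyNilpotent φ.ker) : AllFG G ∧ Group.IsVirtuallyNilpotent G := by
  have hA : AllFG G := AllFG.of_ext φ hK AllFG.int
  refine ⟨hA, ?_⟩
  obtain ⟨N0, hN0, hN0f⟩ := hv
  have hfg : Group.FG φ.ker := (Group.fg_iff_subgroup_fg _).2 (hA _)
  obtain ⟨N', hN'c, hN'f, hN'le⟩ := exists_char_finiteIndex N0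
  have hNnil : Group.IsNilpotent N' := by
    have e := Subgroup.subgroupOfEquivOfLe hN'le
    exact Group.nilpotent_of_mulEquiv e
  let N := N'.map φ.ker.subtype
  have hNnil2 : Group.IsNilpotent N :=
    Group.nilpotent_of_mulEquiv (N'.equivMapOfInjective _ φ.ker.subtype_injective)
  obtain ⟨n, hn⟩ := (Subgroup.isNilpotent_iff_lowerCentralSeries _).1 hNnil2
  have hNn : N.Normal := inferInstance
  obtain ⟨t, ht⟩ := hφ (Multiplicative.ofAdd 1)
  obtain ⟨m, hm, K, hmK⟩ := struct_aux n G N t hA hG hn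
  refine ⟨N ⊔ Subgroup.zpowers (t ^ m),
    (Subgroup.isNilpotent_iff_lowerCentralSeries _).2 ⟨K, hmK⟩, ?_⟩
  set H := N ⊔ Subgroup.zpowers (t ^ m) with hH
  have hpow : ∀ i : ℤ, φ (t ^ i) = Multiplicative.ofAdd i := by
    intro i
    rw [map_zpow, ht, ← ofAdd_zsmul]; simp
  have : Finite (G ⧸ H) := by
    have hf1 : Finite (φ.ker ⧸ N') := inferInstance
    refine Finite.of_surjective (fun p : Fin m × (φ.ker ⧸ N') =>
      ((t ^ ((p.1 : ℕ) : ℤ) * ((Quotient.out p.2 : φ.ker) : G) : G) : G ⧸ H)) ?_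
    intro x
    induction x using QuotientGroup.induction_on with
    | H g =>
      set a := (φ g).toAdd with ha
      have hmZ : (0 : ℤ) < m := by exact_mod_cast hm
      have hi0 : 0 ≤ a % m := Int.emod_nonneg _ hmZ.ne'
      have hi1 : a % m < m := Int.emod_lt_of_pos _ hmZ
      have hk : t ^ (-(a % m)) * g * t ^ (-(m * (a / m))) ∈ φ.ker := by
        rw [MonoidHom.mem_ker, map_mul, map_mul, hpow, hpow]
        apply Multiplicative.toAdd.injective
        simp only [toAdd_mul, toAdd_ofAdd, toAdd_one]
        rw [← ha]
        have := Int.emod_add_mul_ediv a m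
        linarith
      set κ : φ.ker := ⟨_, hk⟩ with hκ
      refine ⟨(⟨(a % m).toNat, by omega⟩, (κ : φ.ker ⧸ N')), ?_⟩
      obtain ⟨ν, hν⟩ := QuotientGroup.mk_out_eq_mul N' κ
      simp only
      rw [hν]
      rw [QuotientGroup.eq]
      have e1 : (((a % m).toNat : ℕ) : ℤ) = a % m := Int.toNat_of_nonneg hi0
      rw [e1]
      have hνH : ((ν : φ.ker) : G) ∈ H := Subgroup.mem_sup_left ⟨ν, ν.2, rfl⟩
      have htH : t ^ (m * (a / m)) ∈ H := by
        rw [zpow_mul, zpow_natCast]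
        exact Subgroup.mem_sup_right (Subgroup.zpow_mem _ (Subgroup.mem_zpowers _) _)
      have e2 : (t ^ (a % (m : ℤ)) * ((κ * (ν : φ.ker) : φ.ker) : G))⁻¹ * g
        = ((ν : φ.ker) : G)⁻¹ * t ^ (m * (a / m)) := by
        rw [Subgroup.coe_mul, hκ]
        simp only [zpow_neg]
        group
      rw [e2]
      exact Subgroup.mul_mem _ (Subgroup.inv_mem _ hνH) htH
  exact Subgroup.finiteIndex_of_finite_quotient

end PartP4b

section PartP5
open scoped Pointwise

/-- left-normed iterated commutators along a sequence -/
def chn {G : Type} [Group G] (s : ℕ → G) : ℕ → G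
  | 0 => s 0
  | k + 1 => comMap (s (k + 1)) (chn s k)

theorem chn_congr {G : Type} [Group G] (s s' : ℕ → G) (k : ℕ) (h : ∀ i ≤ k, s i = s' i) :
    chn s k = chn s' k := by
  induction k with
  | zero => exact h 0 le_rfl
  | succ k ih => rw [chn, chn, h (k + 1) le_rfl, ih fun i hi => h i (by omega)]

/-- ordered products of powers -/
def powProd {G : Type} [Group G] (g : ℕ → G) (i : ℕ → ℕ) : ℕ → ℕ → G
  | _, 0 => 1
  | k, n + 1 => g k ^ i k * powProd g i (k + 1) n

section
variable {G R : Type} [Group G] [NormedRing R] (ρ : G →* R) (hρ : ∀ g, ‖ρ g‖ ≤ 1)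
include hρ

theorem rho_mul_left (g : G) (x : R) : ‖ρ g * x‖ = ‖x‖ := by
  have h : ∀ (g : G) (x : R), ‖ρ g * x‖ ≤ ‖x‖ := by
    intro g x
    calc _ ≤ ‖ρ g‖ * ‖x‖ := norm_mul_le _ _
      _ ≤ 1 * ‖x‖ := by gcongr; exact hρ g
      _ = _ := one_mul _
  refine le_antisymm (h g x) ?_
  have := h g⁻¹ (ρ g * x)
  rwa [← mul_assoc, ← map_mul, inv_mul_cancel, map_one, one_mul] at this

theorem rho_mul_right (g : G) (x : R) : ‖x * ρ g‖ = ‖x‖ := by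
  have h : ∀ (g : G) (x : R), ‖x * ρ g‖ ≤ ‖x‖ := by
    intro g x
    calc _ ≤ ‖x‖ * ‖ρ g‖ := norm_mul_le _ _
      _ ≤ ‖x‖ * 1 := by gcongr; exact hρ g
      _ = _ := mul_one _
  refine le_antisymm (h g x) ?_
  have := h g⁻¹ (x * ρ g)
  rwa [mul_assoc, ← map_mul, mul_inv_cancel, map_one, mul_one] at this

theorem rho_delta_mul (g h : G) : ‖ρ (g * h) - 1‖ ≤ ‖ρ g - 1‖ + ‖ρ h - 1‖ := by
  have : ρ (g * h) - 1 = (ρ g - 1) * ρ h + (ρ h - 1) := by rw [map_mul]; noncomm_ring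
  rw [this]
  exact (norm_add_le _ _).trans (by rw [rho_mul_right ρ hρ])

theorem rho_delta_inv (g : G) : ‖ρ g⁻¹ - 1‖ = ‖ρ g - 1‖ := by
  have := rho_mul_left ρ hρ g (ρ g⁻¹ - 1)
  rw [mul_sub, ← map_mul, mul_inv_cancel, map_one, mul_one] at this
  rw [← this, norm_sub_rev]

theorem rho_delta_pow (g : G) (n : ℕ) : ‖ρ (g ^ n) - 1‖ ≤ n * ‖ρ g - 1‖ := by
  induction n with
  | zero => simp
  | succ n ih =>
    rw [pow_succ]
    refine (rho_delta_mul ρ hρ _ _).trans ?_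
    push_cast
    linarith

theorem rho_delta_com (g h : G) : ‖ρ (comMap h g) - 1‖ ≤ 2 * ‖ρ g - 1‖ * ‖ρ h - 1‖ := by
  have e : ρ (comMap h g) - 1 = (ρ (g * h) - ρ (h * g)) * ρ (g⁻¹ * h⁻¹) := by
    rw [sub_mul, ← map_mul, ← map_mul, comMap]
    have : h * g * (g⁻¹ * h⁻¹) = 1 := by group
    rw [this, map_one]
    simp only [mul_assoc]
  have e2 : ρ (g * h) - ρ (h * g) = (ρ g - 1) * (ρ h - 1) - (ρ h - 1) * (ρ g - 1) := by
    rw [map_mul, map_mul]; noncomm_ring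
  rw [e, rho_mul_right ρ hρ, e2]
  refine (norm_sub_le _ _).trans ?_
  have h1 := norm_mul_le (ρ g - 1) (ρ h - 1)
  have h2 := norm_mul_le (ρ h - 1) (ρ g - 1)
  linarith

theorem rho_delta_pow_lower [NormedAlgebra ℝ R] (g : G) (M c : ℕ) (hc : 1 ≤ c) (hcM : c ≤ M)
    (hM : M * ‖ρ g - 1‖ ≤ 1 / 2) : ‖ρ g - 1‖ / 2 ≤ ‖ρ (g ^ c) - 1‖ := by
  have e : ρ (g ^ c) - 1 = c • (ρ g - 1) + ∑ j ∈ Finset.range c, (ρ (g ^ j) - 1) * (ρ g - 1) := by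
    rw [← Finset.sum_mul, Finset.sum_sub_distrib, sub_mul]
    simp only [map_pow]
    rw [geom_sum_mul]
    simp
  have h1 : ‖∑ j ∈ Finset.range c, (ρ (g ^ j) - 1) * (ρ g - 1)‖ ≤ c * (1 / 2 * ‖ρ g - 1‖) := by
    calc _ ≤ ∑ j ∈ Finset.range c, (1 / 2 * ‖ρ g - 1‖) := by
          apply norm_sum_le_of_le
          intro j hj
          refine (norm_mul_le _ _).trans ?_
          gcongr
          refine (rho_delta_pow ρ hρ g j).trans (le_trans ?_ hM)
          gcongr
          have := Finset.mem_range.1 hj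
          omega
      _ = _ := by simp
  have h2 : (c : ℝ) * ‖ρ g - 1‖ ≤ ‖ρ (g ^ c) - 1‖ + c * (1 / 2 * ‖ρ g - 1‖) := by
    have e3 : c • (ρ g - 1) = (ρ (g ^ c) - 1) -
        ∑ j ∈ Finset.range c, (ρ (g ^ j) - 1) * (ρ g - 1) := by rw [e]; abel
    have e4 : ‖c • (ρ g - 1)‖ = c * ‖ρ g - 1‖ := by
      rw [← Nat.cast_smul_eq_nsmul ℝ, norm_smul]; simp
    rw [← e4, e3]
    exact (norm_sub_le _ _).trans (by gcongr)
  have : (1 : ℝ) ≤ c := by exact_mod_cast hc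
  nlinarith [norm_nonneg (ρ g - 1)]

theorem powProd_delta (g : ℕ → G) (i : ℕ → ℕ) (M : ℕ) (hi : ∀ k, i k ≤ M)
    (hg : ∀ k, ‖ρ (g (k + 1)) - 1‖ ≤ ‖ρ (g k) - 1‖ / 2) (n : ℕ) : ∀ k,
    ‖ρ (powProd g i k n) - 1‖ ≤ 2 * M * ‖ρ (g k) - 1‖ := by
  induction n with
  | zero => intro k; simp only [powProd, map_one, sub_self, norm_zero]; positivity
  | succ n ih =>
    intro k
    rw [powProd]
    refine (rho_delta_mul ρ hρ _ _).trans ?_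
    have h1 := rho_delta_pow ρ hρ (g k) (i k)
    have h2 := ih (k + 1)
    have h3 : (i k : ℝ) * ‖ρ (g k) - 1‖ ≤ M * ‖ρ (g k) - 1‖ := by
      gcongr; exact hi k
    have h4 : 2 * (M : ℝ) * ‖ρ (g (k + 1)) - 1‖ ≤ 2 * M * (‖ρ (g k) - 1‖ / 2) := by
      gcongr; exact hg k
    linarith

theorem powProd_inj [NormedAlgebra ℝ R] (g : ℕ → G) (i i' : ℕ → ℕ) (M : ℕ) (hM : 1 ≤ M)
    (hi : ∀ k, i k ≤ M)
    (hi' : ∀ k, i' k ≤ M) (ε : ℝ) (hε : ε = 1 / (32 * M))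
    (hg : ∀ k, ‖ρ (g (k + 1)) - 1‖ ≤ 2 * ε * ‖ρ (g k) - 1‖)
    (hgε : ∀ k, ‖ρ (g k) - 1‖ ≤ ε) (n : ℕ) : ∀ k, (∀ j < k + n, ρ (g j) ≠ 1) →
    ρ (powProd g i k n) = ρ (powProd g i' k n) → ∀ j, k ≤ j → j < k + n → i j = i' j := by
  have hMr : (1 : ℝ) ≤ M := by exact_mod_cast hM
  have hεM : ε * M = 1 / 32 := by rw [hε]; field_simp
  have hε2 : 2 * ε ≤ 1 / 2 := by
    have : ε ≤ ε * M := by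
      have : 0 ≤ ε := by rw [hε]; positivity
      nlinarith
    linarith
  have hg2 : ∀ k, ‖ρ (g (k + 1)) - 1‖ ≤ ‖ρ (g k) - 1‖ / 2 := by
    intro k
    have := hg k
    nlinarith [norm_nonneg (ρ (g k) - 1)]
  have key : ∀ (n k : ℕ) (i i' : ℕ → ℕ), (∀ k, i k ≤ M) → (∀ k, i' k ≤ M) → ρ (g k) ≠ 1 →
      ρ (powProd g i k (n + 1)) = ρ (powProd g i' k (n + 1)) → ¬ i k < i' k := by
    intro n k i i' hi hi' hk h hlt
    rw [powProd, powProd] at h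
    obtain ⟨c, hc⟩ := Nat.exists_eq_add_of_lt hlt
    rw [hc, add_assoc, pow_add, mul_assoc, map_mul, map_mul ρ (g k ^ i k)] at h
    have h2 := congrArg (fun x => ρ (g k ^ i k)⁻¹ * x) h
    simp only [← mul_assoc, ← map_mul, inv_mul_cancel, one_mul] at h2
    have h3 : ρ (g k ^ (c + 1)) =
        ρ (powProd g i (k + 1) n * (powProd g i' (k + 1) n)⁻¹) := by
      rw [map_mul, h2, ← map_mul, mul_assoc, mul_inv_cancel, mul_one]
    have h4 := rho_delta_pow_lower ρ hρ (g k) M (c + 1) (by omega)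
      (by have := hi' k; omega) (by
        have h6 : (M : ℝ) * ‖ρ (g k) - 1‖ ≤ M * ε := by gcongr; exact hgε k
        linarith)
    rw [h3] at h4
    have h5 := rho_delta_mul ρ hρ (powProd g i (k + 1) n) (powProd g i' (k + 1) n)⁻¹
    rw [rho_delta_inv ρ hρ] at h5
    have h6 := powProd_delta ρ hρ g i M hi hg2 n (k + 1)
    have h7 := powProd_delta ρ hρ g i' M hi' hg2 n (k + 1)
    have h8 : 2 * (M : ℝ) * ‖ρ (g (k + 1)) - 1‖ ≤ 2 * M * (2 * ε * ‖ρ (g k) - 1‖) := by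
      gcongr; exact hg k
    have h9 : 2 * (M : ℝ) * (2 * ε * ‖ρ (g k) - 1‖) = 4 * (ε * M) * ‖ρ (g k) - 1‖ := by ring
    rw [hεM] at h9
    have h10 : 0 < ‖ρ (g k) - 1‖ := norm_pos_iff.2 (sub_ne_zero.2 hk)
    linarith
  induction n with
  | zero => intro k _ _ j h1 h2; omega
  | succ n ih =>
    intro k hne h j h1 h2
    have hk : i k = i' k := by
      have a1 := key n k i i' hi hi' (hne k (by omega)) h
      have a2 := key n k i' i hi' hi (hne k (by omega)) h.symm
      omega
    rcases Nat.eq_or_lt_of_le h1 with rfl | h1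
    · exact hk
    · refine ih (k + 1) (fun j hj => hne j (by omega)) ?_ j h1 (by omega)
      rw [powProd, powProd, hk, map_mul, map_mul ρ (g k ^ i' k)] at h
      have h2 := congrArg (fun x => ρ (g k ^ i' k)⁻¹ * x) h
      simpa only [← mul_assoc, ← map_mul, inv_mul_cancel, one_mul] using h2

theorem chn_trivial [NormedAlgebra ℝ R] {d : ℕ} (hG : PG d G) (S : Set G) (hS : S.Finite) (M : ℕ)
    (hM : M = 2 * 4 ^ d) (hSε : ∀ s ∈ S, ‖ρ s - 1‖ ≤ 1 / (32 * M)) :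
    ∃ m : ℕ, ∀ s : ℕ → G, (∀ k, s k ∈ S) → ρ (chn s m) = 1 := by
  have hM1 : 1 ≤ M := by
    have : 0 < 4 ^ d := by positivity
    omega
  let W : Set G := insert 1 (S ∪ S⁻¹)
  have hWf : W.Finite := (hS.union hS.inv).insert 1
  have hW1 : (1 : G) ∈ W := Set.mem_insert _ _
  have hWinv : W⁻¹ = W := by
    ext x
    simp only [W, Set.mem_inv, Set.mem_insert_iff, Set.mem_union, inv_eq_one, inv_inv]
    tauto
  have hWpinv : ∀ (n : ℕ) (x : G), x ∈ W ^ n → x⁻¹ ∈ W ^ n := by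
    intro n x hx
    rw [← Set.mem_inv, ← inv_pow, hWinv]
    exact hx
  obtain ⟨C, hC⟩ := hG W hWf
  obtain ⟨n, hn⟩ : ∃ n : ℕ, C * (2 * M) ^ d < 2 ^ n := ⟨_, Nat.lt_two_pow_self⟩
  refine ⟨n, fun s hs => ?_⟩
  by_contra hcon
  have hMr : (1 : ℝ) ≤ M := by exact_mod_cast hM1
  set ε : ℝ := 1 / (32 * M) with hε
  have hε0 : 0 < ε := by rw [hε]; positivity
  have hε1 : 2 * ε ≤ 1 := by
    rw [hε, ← mul_div_assoc, div_le_one (by positivity)]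
    linarith
  have hg : ∀ k, ‖ρ (chn s (k + 1)) - 1‖ ≤ 2 * ε * ‖ρ (chn s k) - 1‖ := by
    intro k
    rw [chn]
    refine (rho_delta_com ρ hρ _ _).trans ?_
    have := hSε _ (hs (k + 1))
    have h2 := norm_nonneg (ρ (chn s k) - 1)
    nlinarith
  have hgε : ∀ k, ‖ρ (chn s k) - 1‖ ≤ ε := by
    intro k
    induction k with
    | zero => exact hSε _ (hs 0)
    | succ k ih =>
      have := hg k
      nlinarith [norm_nonneg (ρ (chn s k) - 1)]
  have hne : ∀ j ≤ n, ρ (chn s j) ≠ 1 := by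
    have : ∀ l j, ρ (chn s j) = 1 → ρ (chn s (j + l)) = 1 := by
      intro l
      induction l with
      | zero => intro j h; exact h
      | succ l ih =>
        intro j h
        have h1 := ih j h
        have h2 := hg (j + l)
        rw [h1, sub_self, norm_zero, mul_zero] at h2
        exact sub_eq_zero.1 (norm_le_zero_iff.1 h2)
    intro j hj h
    obtain ⟨l, rfl⟩ := Nat.exists_eq_add_of_le hj
    exact hcon (this l j h)
  have hmemg : ∀ k, chn s k ∈ W ^ (4 ^ k) := by
    intro k
    induction k with
    | zero => simpa [chn, W] using Or.inr (Or.inl (hs 0))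
    | succ k ih =>
      have hsk : s (k + 1) ∈ W ^ (4 ^ k) := by
        apply Set.pow_subset_pow_right hW1 (Nat.one_le_pow _ _ (by norm_num))
        rw [pow_one]
        exact Set.mem_insert_of_mem _ (Or.inl (hs _))
      have e : W ^ (4 ^ (k + 1)) = W ^ (4 ^ k) * W ^ (4 ^ k) * W ^ (4 ^ k) * W ^ (4 ^ k) := by
        rw [← pow_add, ← pow_add, ← pow_add]; congr 1; ring
      rw [chn, comMap, e]
      exact Set.mul_mem_mul (Set.mul_mem_mul (Set.mul_mem_mul ih hsk) (hWpinv _ _ ih))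
        (hWpinv _ _ hsk)
  have hmemp : ∀ (i : ℕ → ℕ), (∀ k, i k ≤ M) → ∀ (l k : ℕ),
      ∃ L, L + M * 4 ^ k ≤ M * 4 ^ (k + l) ∧ powProd (chn s) i k l ∈ W ^ L := by
    intro i hi l
    induction l with
    | zero => intro k; exact ⟨0, by simp, by simp [powProd]⟩
    | succ l ih =>
      intro k
      obtain ⟨L, hL, hmem⟩ := ih (k + 1)
      refine ⟨4 ^ k * M + L, ?_, ?_⟩
      · have e1 : k + 1 + l = k + (l + 1) := by ring
        rw [e1, pow_succ] at hL
        have q1 : M * (4 ^ k * 4) = 4 * (4 ^ k * M) := by ring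
        have q2 : M * 4 ^ k = 4 ^ k * M := by ring
        omega
      · rw [powProd, pow_add]
        apply Set.mul_mem_mul _ hmem
        rw [pow_mul]
        have h1 := Set.pow_mem_pow (hmemg k) (n := i k)
        refine Set.pow_subset_pow_right ?_ (hi k) h1
        exact Set.one_mem_pow hW1
  have hcard : M ^ n ≤ (W ^ (M * 4 ^ n)).ncard := by
    let ext : (Fin n → Fin M) → ℕ → ℕ := fun f k => if h : k < n then (f ⟨k, h⟩ : ℕ) else 0
    have hext : ∀ f k, ext f k ≤ M := by
      intro f k
      simp only [ext]
      split_ifs with h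
      · exact (f ⟨k, h⟩).2.le
      · exact Nat.zero_le _
    have hinj : Function.Injective (fun f : Fin n → Fin M => powProd (chn s) (ext f) 0 n) := by
      intro f f' hff
      funext j
      have := powProd_inj ρ hρ (chn s) (ext f) (ext f') M hM1 (hext f) (hext f') ε hε hg hgε n 0
        (fun j hj => hne j (by omega)) (congrArg ρ hff) j (Nat.zero_le _) (by simp)
      simp only [ext, j.2, dif_pos] at this
      exact Fin.ext this
    have h1 : (Set.range (fun f : Fin n → Fin M => powProd (chn s) (ext f) 0 n)).ncard = M ^ n := by
      rw [← Set.image_univ, Set.ncard_image_of_injective _ hinj, Set.ncard_univ]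
      simp
    rw [← h1]
    apply Set.ncard_le_ncard _ (set_pow_finite hWf _)
    rintro _ ⟨f, rfl⟩
    obtain ⟨L, hL, hmem⟩ := hmemp (ext f) (hext f) n 0
    refine Set.pow_subset_pow_right hW1 ?_ hmem
    simp only [zero_add] at hL
    omega
  have hle := hcard.trans (hC _)
  have h4 : 1 ≤ M * 4 ^ n := Nat.one_le_iff_ne_zero.2 (by positivity)
  have h5 : C * (M * 4 ^ n + 1) ^ d ≤ C * (2 * M) ^ d * (4 ^ d) ^ n := by
    have : (M * 4 ^ n + 1) ^ d ≤ (2 * M * 4 ^ n) ^ d := by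
      apply Nat.pow_le_pow_left; linarith
    calc _ ≤ C * (2 * M * 4 ^ n) ^ d := Nat.mul_le_mul_left _ this
      _ = _ := by rw [mul_pow, ← pow_mul, ← pow_mul, mul_comm n d, mul_assoc]
  have h6 : M ^ n = 2 ^ n * (4 ^ d) ^ n := by rw [hM, mul_pow]
  have h7 : C * (2 * M) ^ d * (4 ^ d) ^ n < 2 ^ n * (4 ^ d) ^ n :=
    Nat.mul_lt_mul_of_pos_right hn (by positivity)
  omega

theorem compact_linear_nilp [NormedAlgebra ℝ R] [ProperSpace R] [Group.FG G] {d : ℕ}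
    (hG : PG d G) : ∃ G' : Subgroup G, G'.FiniteIndex ∧
      Group.IsNilpotent (G' ⧸ (ρ.comp G'.subtype).ker) := by
  set M := 2 * 4 ^ d with hM
  set ε : ℝ := 1 / (32 * M) with hε
  have hMpos : 0 < M := by positivity
  have hε0 : 0 < ε := by positivity
  let U : Set G := {g | ‖ρ g - 1‖ < ε}
  let G' := Subgroup.closure U
  have hfin : Finite (G ⧸ G') := by
    have htb : TotallyBounded (Set.range ρ) := by
      refine ((isCompact_closedBall (0 : R) 1).totallyBounded).subset ?_
      rintro _ ⟨g, rfl⟩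
      simpa using hρ g
    obtain ⟨t, ht, hcov⟩ := Metric.totallyBounded_iff.1 htb (ε / 2) (by positivity)
    have hch : ∀ g : G, ∃ y ∈ t, dist (ρ g) y < ε / 2 := by
      intro g
      obtain ⟨y, hy, h⟩ := Set.mem_iUnion₂.1 (hcov ⟨g, rfl⟩)
      exact ⟨y, hy, h⟩
    choose y hyt hy using hch
    have : Finite t := ht.to_subtype
    refine Finite.of_injective (fun q : G ⧸ G' => (⟨y q.out, hyt _⟩ : t)) ?_
    intro q q' hqq
    have h1 : y q.out = y q'.out := congrArg Subtype.val hqq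
    have h2 : dist (ρ q.out) (ρ q'.out) < ε := by
      have a1 := hy q.out
      have a2 := hy q'.out
      rw [← h1] at a2
      have := dist_triangle_right (ρ q.out) (ρ q'.out) (y q.out)
      linarith
    have h3 : (q.out)⁻¹ * q'.out ∈ G' := by
      apply Subgroup.subset_closure
      change ‖ρ ((q.out)⁻¹ * q'.out) - 1‖ < ε
      rw [← rho_mul_left ρ hρ q.out, mul_sub, ← map_mul, mul_inv_cancel_left, mul_one,
        ← dist_eq_norm, dist_comm]
      exact h2
    rw [← QuotientGroup.out_eq' q, ← QuotientGroup.out_eq' q']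
    exact QuotientGroup.eq.2 h3
  have hfi : G'.FiniteIndex := Subgroup.finiteIndex_of_finite_quotient
  refine ⟨G', hfi, ?_⟩
  have hfg : G'.FG := (Group.fg_iff_subgroup_fg _).1 inferInstance
  have hFU : ∀ x ∈ G', ∃ F : Set G, F.Finite ∧ F ⊆ U ∧ x ∈ Subgroup.closure F := by
    intro x hx
    induction hx using Subgroup.closure_induction with
    | mem x hx => exact ⟨{x}, Set.finite_singleton x, by simpa using hx,
        Subgroup.subset_closure rfl⟩
    | one => exact ⟨∅, Set.finite_empty, by simp, Subgroup.one_mem _⟩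
    | mul x y _ _ hx hy =>
      obtain ⟨F, h1, h2, h3⟩ := hx
      obtain ⟨F', h1', h2', h3'⟩ := hy
      exact ⟨F ∪ F', h1.union h1', Set.union_subset h2 h2', Subgroup.mul_mem _
        (Subgroup.closure_mono Set.subset_union_left h3)
        (Subgroup.closure_mono Set.subset_union_right h3')⟩
    | inv x _ hx =>
      obtain ⟨F, h1, h2, h3⟩ := hx
      exact ⟨F, h1, h2, Subgroup.inv_mem _ h3⟩
  obtain ⟨X, hX, hXf⟩ := (Subgroup.fg_iff _).1 hfg
  have hXG : ∀ x ∈ X, x ∈ G' := fun x hx => by rw [← hX]; exact Subgroup.subset_closure hx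
  choose! F hFf hFsub hFx using hFU
  let S : Set G := ⋃ x ∈ X, F x
  have hSf : S.Finite := hXf.biUnion fun x hx => hFf x (hXG x hx)
  have hSU : S ⊆ U := Set.iUnion₂_subset fun x hx => hFsub x (hXG x hx)
  have hSgen : G' ≤ Subgroup.closure S := by
    rw [← hX, Subgroup.closure_le]
    intro x hx
    exact Subgroup.closure_mono (Set.subset_biUnion_of_mem hx) (hFx x (hXG x hx))
  obtain ⟨m, hm⟩ := chn_trivial ρ hρ hG S hSf M hM (fun s hs => (hSU hs).le)
  set f : G' →* R := ρ.comp G'.subtype with hf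
  let q := QuotientGroup.mk' f.ker
  have hSG : ∀ s ∈ S, s ∈ G' := fun s hs => Subgroup.subset_closure (hSU hs)
  have hchnG : ∀ (s : ℕ → G), (∀ k, s k ∈ S) → ∀ k, chn s k ∈ G' := by
    intro s hs k
    induction k with
    | zero => exact hSG _ (hs 0)
    | succ k ih =>
      have := hSG _ (hs (k + 1))
      exact Subgroup.mul_mem _ (Subgroup.mul_mem _ (Subgroup.mul_mem _ ih this)
        (Subgroup.inv_mem _ ih)) (Subgroup.inv_mem _ this)
  have hgen : ∀ (z : G') (j : ℕ), (∀ s (hs : s ∈ S),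
      q (z * ⟨s, hSG s hs⟩ * z⁻¹ * ⟨s, hSG s hs⟩⁻¹) ∈ Subgroup.upperCentralSeries _ j) →
      q z ∈ Subgroup.upperCentralSeries _ (j + 1) := by
    intro z j h
    obtain ⟨L, hL⟩ := ucs_subgroup (q z) j
    have h1 : G' ≤ (L.comap q).map G'.subtype := by
      refine hSgen.trans ?_
      rw [Subgroup.closure_le]
      intro s hs
      refine ⟨⟨s, hSG s hs⟩, ?_, rfl⟩
      apply (hL _).2
      have := h s hs
      simpa only [map_mul, map_inv] using this
    rw [Subgroup.mem_upperCentralSeries_succ_iff]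
    intro y
    obtain ⟨y, rfl⟩ := QuotientGroup.mk'_surjective _ y
    obtain ⟨y', hy', hyy⟩ := h1 y.2
    have : y' = y := Subtype.ext hyy
    rw [this] at hy'
    exact (hL _).1 hy'
  have hchain : ∀ j k : ℕ, k + j = m → ∀ (s : ℕ → G) (hs : ∀ k, s k ∈ S),
      q ⟨chn s k, hchnG s hs k⟩ ∈ Subgroup.upperCentralSeries (G' ⧸ f.ker) j := by
    intro j
    induction j with
    | zero =>
      intro k hk s hs
      have hkm : k = m := by omega
      subst hkm
      have : (⟨chn s k, hchnG s hs k⟩ : G') ∈ f.ker := hm s hs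
      have h2 : q ⟨chn s k, hchnG s hs k⟩ = 1 := (QuotientGroup.eq_one_iff _).2 this
      rw [h2]
      exact Subgroup.one_mem _
    | succ j ih =>
      intro k hk s hs
      apply hgen
      intro x hx
      let s' : ℕ → G := fun i => if i ≤ k then s i else x
      have hs' : ∀ i, s' i ∈ S := by
        intro i
        simp only [s']
        split_ifs
        · exact hs i
        · exact hx
      have h1 := ih (k + 1) (by omega) s' hs'
      convert h1 using 2
      apply Subtype.ext
      have e1 : chn s' k = chn s k := chn_congr _ _ _ fun i hi => by simp [s', hi]
      have e2 : s' (k + 1) = x := by simp [s']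
      simp only [chn, comMap, e1, e2]
      rfl
  refine ⟨m + 1, ?_⟩
  rw [eq_top_iff]
  intro y _
  obtain ⟨y, rfl⟩ := QuotientGroup.mk'_surjective _ y
  have h1 : G' ≤ ((Subgroup.upperCentralSeries (G' ⧸ f.ker) (m + 1)).comap q).map G'.subtype := by
    refine hSgen.trans ?_
    rw [Subgroup.closure_le]
    intro s hs
    refine ⟨⟨s, hSG s hs⟩, ?_, rfl⟩
    have := hchain m 0 (by omega) (fun _ => s) (fun _ => hs)
    exact Subgroup.upperCentralSeries_mono _ (Nat.le_succ m) this
  obtain ⟨y', hy', hyy⟩ := h1 y.2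
  have : y' = y := Subtype.ext hyy
  rw [this] at hy'
  exact hy'

end

end PartP5

section PartP6
open scoped Pointwise

/-- completion of a pre-inner product space with isometric action -/
theorem exists_completion {G V : Type} [Group G] [AddCommGroup V] [Module ℝ V]
    (c : PreInnerProductSpace.Core ℝ V) (ρ : G → V →ₗ[ℝ] V)
    (h1 : ∀ v, ρ 1 v = v) (hm : ∀ g h v, ρ (g * h) v = ρ g (ρ h v))
    (hi : ∀ g v, c.inner (ρ g v) (ρ g v) = c.inner v v) :
    ∃ (H : Type) (_ : NormedAddCommGroup H) (_ : InnerProductSpace ℝ H) (_ : CompleteSpace H)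
      (π : G →* (H →L[ℝ] H)) (i : V →ₗ[ℝ] H), (∀ g v, ‖π g v‖ = ‖v‖) ∧
      (∀ g v, π g (i v) = i (ρ g v)) ∧ (∀ v w, inner ℝ (i v) (i w) = c.inner v w) := by
  let _ : SeminormedAddCommGroup V := InnerProductSpace.Core.toSeminormedAddCommGroup (𝕜 := ℝ)
  let _ : InnerProductSpace ℝ V := .ofCore c
  have hin : ∀ v w : V, inner ℝ v w = c.inner v w := fun _ _ => rfl
  have hno : ∀ g v, ‖ρ g v‖ = ‖v‖ := by
    intro g v
    have := hi g v
    rw [← hin, ← hin, real_inner_self_eq_norm_sq, real_inner_self_eq_norm_sq] at this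
    exact (sq_eq_sq₀ (norm_nonneg _) (norm_nonneg _)).1 this
  let L : G → V →L[ℝ] V := fun g => (ρ g).mkContinuous 1 (fun v => by rw [hno, one_mul])
  have hL : ∀ g v, L g v = ρ g v := fun _ _ => rfl
  have hLc : ∀ g (v : V), (L g).completion (v : UniformSpace.Completion V) = ((ρ g v : V) : UniformSpace.Completion V) := by
    intro g v
    rw [← hL]
    simp
  refine ⟨UniformSpace.Completion V, inferInstance, inferInstance, inferInstance,
    { toFun := fun g => (L g).completion
      map_one' := ?_
      map_mul' := ?_ }, (UniformSpace.Completion.toComplL (𝕜 := ℝ) (E := V)).toLinearMap, ?_, ?_, ?_⟩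
  · ext v
    induction v using UniformSpace.Completion.induction_on with
    | hp => exact isClosed_eq (by fun_prop) (by fun_prop)
    | ih a => rw [hLc, h1]; rfl
  · intro g h
    ext v
    induction v using UniformSpace.Completion.induction_on with
    | hp => exact isClosed_eq (by fun_prop) (by fun_prop)
    | ih a => rw [hLc, hm]; change _ = (L g).completion ((L h).completion _); rw [hLc, hLc]
  · intro g v
    change ‖(L g).completion v‖ = _
    induction v using UniformSpace.Completion.induction_on with
    | hp => exact isClosed_eq (by fun_prop) (by fun_prop)
    | ih a => rw [hLc, UniformSpace.Completion.norm_coe, UniformSpace.Completion.norm_coe, hno]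
  · intro g v
    exact hLc g v
  · intro v w
    exact UniformSpace.Completion.inner_coe v w

theorem exists_regular (G : Type) [Group G] :
    ∃ (H : Type) (_ : NormedAddCommGroup H) (_ : InnerProductSpace ℝ H)
      (π : G →* (H →L[ℝ] H)) (u : H), (∀ g v, ‖π g v‖ = ‖v‖) ∧
      Orthonormal ℝ (fun g => π g u) := by
  classical
  let c : PreInnerProductSpace.Core ℝ (G →₀ ℝ) :=
    { inner := fun f g => f.sum (fun x a => a * g x)
      conj_inner_symm := by
        intro f g
        simp only [conj_trivial]
        rw [Finsupp.sum_of_support_subset f (s := f.support ∪ g.support) (by simp) _ (by simp),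
          Finsupp.sum_of_support_subset g (s := f.support ∪ g.support) (by simp) _ (by simp)]
        exact Finset.sum_congr rfl fun _ _ => mul_comm _ _
      re_inner_nonneg := by
        intro f
        exact Finset.sum_nonneg fun _ _ => mul_self_nonneg _
      add_left := by
        intro f g h
        rw [Finsupp.sum_add_index'] <;> simp [add_mul]
      smul_left := by
        intro f g r
        rw [Finsupp.sum_smul_index] <;> simp [Finsupp.mul_sum, mul_assoc] }
  obtain ⟨H, _, _, _, π, i, hπ, hπi, hin⟩ := exists_completion c
    (fun g : G => Finsupp.lmapDomain ℝ ℝ (fun x => g * x)) (by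
      intro v; simp only [Finsupp.lmapDomain_apply, one_mul]; exact Finsupp.mapDomain_id) (by
      intro g h v
      simp only [Finsupp.lmapDomain_apply, ← Finsupp.mapDomain_comp]
      congr 1; ext x; simp [mul_assoc]) (by
      intro g v
      change (Finsupp.mapDomain _ v).sum (fun x a => a * (Finsupp.mapDomain (fun x => g * x) v) x) = v.sum (fun x a => a * v x)
      rw [Finsupp.sum_mapDomain_index_inj (mul_right_injective g)]
      simp only [Finsupp.mapDomain_apply (mul_right_injective g)])
  refine ⟨H, _, _, π, i (Finsupp.single 1 1), hπ, ?_⟩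
  rw [orthonormal_iff_ite]
  intro g h
  rw [hπi, hπi, hin]
  simp only [Finsupp.lmapDomain_apply, Finsupp.mapDomain_single, mul_one]
  change (Finsupp.single g (1:ℝ)).sum (fun x a => a * (Finsupp.single h (1:ℝ)) x) = _
  rw [Finsupp.sum_single_index (by simp)]
  simp [Finsupp.single_apply, eq_comm]

open Filter Topology in
noncomputable def ulim (f : ℕ → ℝ) : ℝ := limUnder (hyperfilter ℕ : Filter ℕ) f

open Filter Topology in
theorem ulim_tendsto (f : ℕ → ℝ) (C : ℝ) (h : ∀ k, |f k| ≤ C) :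
    Tendsto f (hyperfilter ℕ : Filter ℕ) (𝓝 (ulim f)) := by
  have hc : IsCompact (Set.Icc (-C) C) := isCompact_Icc
  have := hc.ultrafilter_le_nhds ((hyperfilter ℕ).map f) (by
    rw [Filter.le_principal_iff]
    change f ⁻¹' _ ∈ hyperfilter ℕ
    exact Filter.univ_mem' fun k => abs_le.1 (h k))
  obtain ⟨x, _, hx⟩ := this
  exact tendsto_nhds_limUnder ⟨x, hx⟩

open Filter Topology in
theorem ulim_eq {f : ℕ → ℝ} {a : ℝ} (h : Tendsto f (hyperfilter ℕ : Filter ℕ) (𝓝 a)) : ulim f = a :=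
  h.limUnder_eq

/-- bounded sequences -/
def bddSeq (E : Type) [NormedAddCommGroup E] [InnerProductSpace ℝ E] : Submodule ℝ (ℕ → E) where
  carrier := {x | ∃ C : ℝ, ∀ k, ‖x k‖ ≤ C}
  zero_mem' := ⟨0, fun k => by simp⟩
  add_mem' := by
    rintro x y ⟨C, hC⟩ ⟨D, hD⟩
    exact ⟨C + D, fun k => (norm_add_le _ _).trans (add_le_add (hC k) (hD k))⟩
  smul_mem' := by
    rintro r x ⟨C, hC⟩
    refine ⟨|r| * C, fun k => ?_⟩
    rw [Pi.smul_apply, norm_smul, Real.norm_eq_abs]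
    exact mul_le_mul_of_nonneg_left (hC k) (abs_nonneg _)

section
variable {G E : Type} [Group G] [NormedAddCommGroup E] [InnerProductSpace ℝ E]

open Filter Topology in
theorem bddSeq_tendsto (x y : bddSeq E) : Tendsto (fun k => inner ℝ (x.1 k) (y.1 k))
    (hyperfilter ℕ : Filter ℕ) (𝓝 (ulim fun k => inner ℝ (x.1 k) (y.1 k))) := by
  obtain ⟨C, hC⟩ := x.2
  obtain ⟨D, hD⟩ := y.2
  refine ulim_tendsto _ (C * D) fun k => ?_
  exact (abs_real_inner_le_norm _ _).trans (mul_le_mul (hC k) (hD k) (norm_nonneg _)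
    ((norm_nonneg _).trans (hC k)))

open Filter Topology in
theorem ultra_limit (l : G →* (E →L[ℝ] E)) (hl : ∀ g v, ‖l g v‖ = ‖v‖) (b : ℕ → G → E)
    (hb : ∀ k g h, b k (g * h) = b k g + l g (b k h)) (hbd : ∀ g, ∃ C : ℝ, ∀ k, ‖b k g‖ ≤ C) :
    ∃ (H : Type) (_ : NormedAddCommGroup H) (_ : InnerProductSpace ℝ H) (_ : CompleteSpace H)
      (π : G →* (H →L[ℝ] H)) (B : G → H), (∀ g v, ‖π g v‖ = ‖v‖) ∧
      (∀ g h, B (g * h) = B g + π g (B h)) ∧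
      ∀ g h, Tendsto (fun k => inner ℝ (b k g) (b k h)) (hyperfilter ℕ : Filter ℕ)
        (𝓝 (inner ℝ (B g) (B h))) := by
  let c : PreInnerProductSpace.Core ℝ (bddSeq E) :=
    { inner := fun x y => ulim fun k => inner ℝ (x.1 k) (y.1 k)
      conj_inner_symm := by
        intro x y
        simp only [conj_trivial]
        congr 1; ext k; exact real_inner_comm _ _
      re_inner_nonneg := by
        intro x
        exact ge_of_tendsto' (bddSeq_tendsto x x) fun k => real_inner_self_nonneg
      add_left := by
        intro x y z
        apply ulim_eq
        refine ((bddSeq_tendsto x z).add (bddSeq_tendsto y z)).congr fun k => ?_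
        simp [inner_add_left]
      smul_left := by
        intro x y r
        apply ulim_eq
        refine ((bddSeq_tendsto x y).const_mul r).congr fun k => ?_
        simp [real_inner_smul_left] }
  let ρ : G → bddSeq E →ₗ[ℝ] bddSeq E := fun g =>
    { toFun := fun x => ⟨fun k => l g (x.1 k), by
        obtain ⟨C, hC⟩ := x.2
        exact ⟨C, fun k => by rw [hl]; exact hC k⟩⟩
      map_add' := by intro x y; ext k; simp
      map_smul' := by intro r x; ext k; simp }
  have hρ : ∀ g x k, (ρ g x).1 k = l g (x.1 k) := fun _ _ _ => rfl
  obtain ⟨H, i1, i2, i3, π, i, hπ, hπi, hin⟩ := exists_completion c ρ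
    (by intro v; ext k; rw [hρ]; simp)
    (by intro g h v; ext k; rw [hρ, hρ, hρ]; simp)
    (by
      intro g v
      change ulim (fun k => inner ℝ (l g (v.1 k)) (l g (v.1 k))) = ulim fun k => inner ℝ (v.1 k) (v.1 k)
      congr 1; ext k
      rw [real_inner_self_eq_norm_sq, real_inner_self_eq_norm_sq, hl])
  refine ⟨H, i1, i2, i3, π, fun g => i ⟨fun k => b k g, hbd g⟩, hπ, ?_, ?_⟩
  · intro g h
    rw [hπi, ← map_add]
    exact congrArg i (Subtype.ext (funext fun k => hb k g h))
  · intro g h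
    rw [hin]
    exact bddSeq_tendsto _ _
end

end PartP6

section PartP7
open scoped Pointwise

section
variable {G E ι : Type} [Group G] [NormedAddCommGroup E] [InnerProductSpace ℝ E] [Fintype ι] [Nonempty ι]
  (π : G →* (E →L[ℝ] E)) (hπ : ∀ g v, ‖π g v‖ = ‖v‖) (t : ι → G) (σ : ι ≃ ι) (hσ : ∀ i, t (σ i) = (t i)⁻¹)

theorem rep_mul (g h : G) (v : E) : π (g * h) v = π g (π h v) := by
  rw [map_mul]; rfl

include hπ in
theorem rep_inner (g : G) (v w : E) : inner ℝ (π g v) (π g w) = inner ℝ v w :=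
  LinearIsometry.inner_map_map ⟨(π g).toLinearMap, hπ g⟩ v w

include hπ in
theorem rep_inner_left (g : G) (v w : E) : inner ℝ (π g v) w = inner ℝ v (π g⁻¹ w) := by
  rw [← rep_inner π hπ g v (π g⁻¹ w), ← rep_mul]; simp

/-- averaging operator -/
noncomputable def avgOp : E →L[ℝ] E := (Fintype.card ι : ℝ)⁻¹ • ∑ i, π (t i)

theorem avgOp_apply (v : E) : avgOp π t v = (Fintype.card ι : ℝ)⁻¹ • ∑ i, π (t i) v := by
  simp [avgOp]

include hπ hσ in
theorem avgOp_symm (v w : E) : inner ℝ (avgOp π t v) w = inner ℝ v (avgOp π t w) := by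
  rw [avgOp_apply, avgOp_apply, real_inner_smul_left, real_inner_smul_right, sum_inner, inner_sum]
  congr 1
  rw [← σ.sum_comp]
  refine Finset.sum_congr rfl fun i _ => ?_
  rw [rep_inner_left π hπ, hσ, inv_inv]

include hπ in
theorem avgOp_norm (v : E) : ‖avgOp π t v‖ ≤ ‖v‖ := by
  rw [avgOp_apply, norm_smul]
  have h1 : ‖∑ i, π (t i) v‖ ≤ Fintype.card ι * ‖v‖ := by
    refine (norm_sum_le _ _).trans ?_
    simp [hπ]
  have hm : (0 : ℝ) < Fintype.card ι := by exact_mod_cast Fintype.card_pos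
  rw [norm_inv, Real.norm_natCast]
  rw [inv_mul_le_iff₀ hm]
  exact h1

theorem avgOp_sq (v : E) : ((Fintype.card ι : ℝ)⁻¹ ^ 2) • ∑ p : ι × ι, π (t p.1 * t p.2) v = avgOp π t (avgOp π t v) := by
  rw [avgOp_apply, avgOp_apply]
  simp only [map_smul, map_sum, ← Finset.smul_sum, smul_smul, Fintype.sum_prod_type, rep_mul, sq]

include hπ hσ in
theorem avg_energy (v : E) : ∑ p : ι × ι, ‖π (t p.1 * t p.2) v - v‖ ^ 2 =
    (Fintype.card ι : ℝ) ^ 2 * (2 * (‖v‖ ^ 2 - ‖avgOp π t v‖ ^ 2)) := by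
  have hm : (Fintype.card ι : ℝ) ≠ 0 := by exact_mod_cast Fintype.card_ne_zero
  have h1 : ∀ p : ι × ι, ‖π (t p.1 * t p.2) v - v‖ ^ 2 = 2 * ‖v‖ ^ 2 - 2 * inner ℝ (π (t p.1 * t p.2) v) v := by
    intro p
    rw [norm_sub_sq_real, hπ]; ring
  simp only [h1, Finset.sum_sub_distrib, ← Finset.mul_sum, ← sum_inner]
  have h2 := avgOp_sq π t v
  have h3 : ∑ p : ι × ι, π (t p.1 * t p.2) v = (Fintype.card ι : ℝ) ^ 2 • avgOp π t (avgOp π t v) := by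
    rw [← h2, smul_smul, ← mul_pow, mul_inv_cancel₀ hm]; simp
  rw [h3, real_inner_smul_left, avgOp_symm π hπ t σ hσ, real_inner_self_eq_norm_sq]
  simp
  ring

/-- u_k -/
noncomputable def uk (u : E) : ℕ → E
  | 0 => u
  | k + 1 => avgOp π t (uk u k)

variable (u : E)

noncomputable def ck (k : ℕ) : ℝ := ‖uk π t u k‖ ^ 2 - ‖uk π t u (k + 1)‖ ^ 2

include hπ in
theorem ck_nonneg (k : ℕ) : 0 ≤ ck π t u k := by
  have := avgOp_norm π hπ t (uk π t u k)
  have h2 : ‖uk π t u (k+1)‖ ^ 2 ≤ ‖uk π t u k‖ ^ 2 := pow_le_pow_left₀ (norm_nonneg _) this 2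
  unfold ck; linarith

include hπ hσ in
theorem ck_diff (k : ℕ) : ck π t u k - ck π t u (k + 1) = ‖uk π t u (k + 2) - uk π t u k‖ ^ 2 := by
  rw [norm_sub_sq_real]
  have : inner ℝ (uk π t u (k + 2)) (uk π t u k) = ‖uk π t u (k + 1)‖ ^ 2 := by
    change inner ℝ (avgOp π t (uk π t u (k+1))) _ = _
    rw [avgOp_symm π hπ t σ hσ, ← real_inner_self_eq_norm_sq]; rfl
  rw [this]; unfold ck; ring

include hπ hσ in
theorem uk_shift (j k : ℕ) : inner ℝ (uk π t u j) (uk π t u k) = inner ℝ (uk π t u (j + k)) u := by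
  induction k generalizing j with
  | zero => rfl
  | succ k ih =>
    have : inner ℝ (uk π t u j) (uk π t u (k+1)) = inner ℝ (uk π t u (j+1)) (uk π t u k) := by
      change inner ℝ _ (avgOp π t (uk π t u k)) = inner ℝ (avgOp π t (uk π t u j)) _
      rw [avgOp_symm π hπ t σ hσ]
    rw [this, ih]; congr 2; omega

include hπ in
theorem ck_sum (k n : ℕ) : ∑ j ∈ Finset.range n, ck π t u (k + j) = ‖uk π t u k‖ ^ 2 - ‖uk π t u (k + n)‖ ^ 2 := by
  induction n with
  | zero => simp
  | succ n ih => rw [Finset.sum_range_succ, ih]; unfold ck; rw [← add_assoc]; ring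

include hπ in
open Filter Topology in
theorem ck_tendsto : Tendsto (ck π t u) atTop (𝓝 0) := by
  have h : Summable (ck π t u) := by
    refine summable_of_sum_range_le (c := ‖u‖ ^ 2) (ck_nonneg π hπ t u) fun n => ?_
    have := ck_sum π hπ t u 0 n
    simp only [zero_add] at this
    rw [this]
    have := sq_nonneg ‖uk π t u n‖
    have : ‖uk π t u 0‖ = ‖u‖ := rfl
    rw [this]; linarith
  exact h.tendsto_atTop_zero

include hπ hσ in
open Filter Topology in
theorem uk_almost_inv (h1 : 1 ∈ Set.range t) (hgen : Subgroup.closure (Set.range t) = ⊤) (g : G) :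
    Tendsto (fun k => ‖π g (uk π t u k) - uk π t u k‖) atTop (𝓝 0) := by
  have hg : g ∈ Subgroup.closure (Set.range t) := by rw [hgen]; trivial
  induction hg using Subgroup.closure_induction with
  | mem x hx =>
    obtain ⟨i, rfl⟩ := hx
    obtain ⟨j, hj⟩ := h1
    have hlim : Tendsto (fun k => Real.sqrt ((Fintype.card ι : ℝ) ^ 2 * (2 * ck π t u k))) atTop (𝓝 0) := by
      have := (((ck_tendsto π hπ t u).const_mul 2).const_mul ((Fintype.card ι : ℝ) ^ 2)).sqrt
      simpa using this
    refine squeeze_zero (fun _ => norm_nonneg _) (fun k => ?_) hlim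
    apply Real.le_sqrt_of_sq_le
    have := avg_energy π hπ t σ hσ (uk π t u k)
    change _ = (Fintype.card ι : ℝ) ^ 2 * (2 * ck π t u k) at this
    rw [← this]
    have h2 := Finset.single_le_sum (f := fun p : ι × ι => ‖π (t p.1 * t p.2) (uk π t u k) - uk π t u k‖ ^ 2)
      (fun _ _ => sq_nonneg _) (Finset.mem_univ (i, j))
    simpa [hj] using h2
  | one => simp
  | mul x y _ _ hx hy =>
    refine squeeze_zero (fun _ => norm_nonneg _) (fun k => ?_) (by simpa using hx.add hy)
    have : π (x * y) (uk π t u k) - uk π t u k = (π x (uk π t u k) - uk π t u k) + π x (π y (uk π t u k) - uk π t u k) := by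
      rw [rep_mul, map_sub]; abel
    rw [this]
    refine (norm_add_le _ _).trans ?_
    rw [hπ]
  | inv x _ hx =>
    refine hx.congr fun k => ?_
    rw [← hπ x (π x⁻¹ _ - _), map_sub, ← rep_mul, norm_sub_rev]; simp

include hπ hσ in
open Filter Topology in
theorem uk_tendsto [Infinite G] (h1 : 1 ∈ Set.range t) (hgen : Subgroup.closure (Set.range t) = ⊤)
    (ho : Orthonormal ℝ (fun g => π g u)) : Tendsto (fun k => ‖uk π t u k‖ ^ 2) atTop (𝓝 0) := by
  have hn : ∀ k, ‖uk π t u k‖ ≤ 1 := by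
    intro k
    induction k with
    | zero => have := ho.1 1; simp only [hπ] at this; exact this.le
    | succ k ih => exact (avgOp_norm π hπ t _).trans ih
  have hg : ∀ g, Tendsto (fun k => inner ℝ (π g u) (uk π t u k) - inner ℝ u (uk π t u k)) atTop (𝓝 0) := by
    intro g
    have h2 := uk_almost_inv π hπ t σ hσ u h1 hgen g⁻¹
    refine squeeze_zero_norm (fun k => ?_) h2
    rw [rep_inner_left π hπ, ← inner_sub_right]
    refine (norm_inner_le_norm _ _).trans ?_
    have : ‖u‖ = 1 := by have := ho.1 1; simpa only [hπ] using this
    rw [this, one_mul]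
  have hu : Tendsto (fun k => inner ℝ u (uk π t u k)) atTop (𝓝 0) := by
    rw [Metric.tendsto_atTop]
    intro ε hε
    obtain ⟨N, hN⟩ := exists_nat_gt (4 / ε ^ 2)
    obtain ⟨F, hF⟩ := Infinite.exists_subset_card_eq G N
    have hev : ∀ᶠ k in atTop, ∀ g ∈ F, |inner ℝ (π g u) (uk π t u k) - inner ℝ u (uk π t u k)| < ε / 2 := by
      rw [Finset.eventually_all]
      intro g _
      have := (Metric.tendsto_nhds.1 (hg g)) (ε / 2) (by positivity)
      simpa [Real.dist_eq] using this
    obtain ⟨K, hK⟩ := eventually_atTop.1 hev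
    refine ⟨K, fun k hk => ?_⟩
    rw [Real.dist_eq, sub_zero]
    by_contra hcon
    push Not at hcon
    have hb := ho.sum_inner_products_le (x := uk π t u k) (s := F)
    have h3 : ∀ g ∈ F, (ε / 2) ^ 2 ≤ ‖inner ℝ (π g u) (uk π t u k)‖ ^ 2 := by
      intro g hgF
      have := hK k hk g hgF
      refine pow_le_pow_left₀ (by positivity) ?_ 2
      rw [Real.norm_eq_abs]
      have := abs_sub_abs_le_abs_sub (inner ℝ u (uk π t u k)) (inner ℝ (π g u) (uk π t u k))
      rw [abs_sub_comm] at this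
      linarith
    have h4 := Finset.card_nsmul_le_sum F _ _ h3
    rw [hF, nsmul_eq_mul] at h4
    have h5 : ‖uk π t u k‖ ^ 2 ≤ 1 := pow_le_one₀ (norm_nonneg _) (hn k)
    rw [div_lt_iff₀ (by positivity)] at hN
    nlinarith
  have h6 : Tendsto (fun k : ℕ => k + k) atTop atTop := tendsto_atTop_mono (fun k => Nat.le_add_left k k) tendsto_id
  refine (hu.comp h6).congr fun k => ?_
  rw [Function.comp, ← real_inner_self_eq_norm_sq, uk_shift π hπ t σ hσ u, real_inner_comm]

include hπ in
theorem uk_lower (ho : Orthonormal ℝ (fun g => π g u)) (k : ℕ) (W : Finset G)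
    (hW : (Set.range t) ^ k ⊆ W) : inner ℝ (uk π t u k) (∑ g ∈ W, π g u) = 1 := by
  classical
  induction k generalizing W with
  | zero =>
    have h1 : (1 : G) ∈ W := hW (by simp)
    change inner ℝ u _ = 1
    rw [inner_sum, Finset.sum_eq_single_of_mem 1 h1]
    · have := (orthonormal_iff_ite.1 ho) 1 1
      simpa using this
    · intro g _ hg
      have := (orthonormal_iff_ite.1 ho) 1 g
      simpa [hg.symm] using this
  | succ k ih =>
    change inner ℝ (avgOp π t _) _ = 1
    rw [avgOp_apply, real_inner_smul_left, sum_inner]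
    have : ∀ i, inner ℝ (π (t i) (uk π t u k)) (∑ g ∈ W, π g u) = 1 := by
      intro i
      rw [rep_inner_left π hπ, map_sum]
      simp only [← rep_mul]
      have h2 := ih (W.image fun g => (t i)⁻¹ * g) (by
        intro x hx
        rw [Finset.coe_image]
        refine ⟨t i * x, hW ?_, by simp⟩
        rw [pow_succ']
        exact Set.mul_mem_mul ⟨i, rfl⟩ hx)
      rw [Finset.sum_image (by intro a _ b _ hab; simpa using hab)] at h2
      exact h2
    have hm : (Fintype.card ι : ℝ) ≠ 0 := by exact_mod_cast Fintype.card_ne_zero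
    simp [this, hm]

include hπ in
theorem uk_lower' (ho : Orthonormal ℝ (fun g => π g u)) (k : ℕ) :
    1 ≤ ‖uk π t u k‖ ^ 2 * (((Set.range t) ^ k).ncard : ℝ) := by
  have hfin : ((Set.range t) ^ k).Finite := set_pow_finite (Set.finite_range t) k
  have h1 := uk_lower π hπ t u ho k hfin.toFinset (by simp)
  have h2 := real_inner_mul_inner_self_le (uk π t u k) (∑ g ∈ hfin.toFinset, π g u)
  rw [h1, real_inner_self_eq_norm_sq, real_inner_self_eq_norm_sq] at h2
  have h3 : ‖∑ g ∈ hfin.toFinset, π g u‖ ^ 2 = (((Set.range t) ^ k).ncard : ℝ) := by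
    rw [← real_inner_self_eq_norm_sq, sum_inner]
    have : ∀ g ∈ hfin.toFinset, inner ℝ (π g u) (∑ g ∈ hfin.toFinset, π g u) = (1 : ℝ) := by
      intro g hg
      classical
      simp only [inner_sum, orthonormal_iff_ite.1 ho]
      rw [Finset.sum_ite_eq, if_pos hg]
    rw [Finset.sum_congr rfl this]
    simp [Set.ncard_eq_toFinset_card _ hfin]
  rw [h3] at h2
  linarith
end

end PartP7

section PartP7b
open scoped Pointwise

section
variable {G E ι : Type} [Group G] [NormedAddCommGroup E] [InnerProductSpace ℝ E] [Fintype ι] [Nonempty ι]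
  (π : G →* (E →L[ℝ] E)) (hπ : ∀ g v, ‖π g v‖ = ‖v‖) (t : ι → G) (σ : ι ≃ ι) (hσ : ∀ i, t (σ i) = (t i)⁻¹)
  (u : E)

include hπ hσ in
open Filter Topology in
theorem exists_good_k [Infinite G] (h1 : 1 ∈ Set.range t) (hgen : Subgroup.closure (Set.range t) = ⊤)
    (ho : Orthonormal ℝ (fun g => π g u)) {d : ℕ} (hG : PG d G) (ε : ℝ) (hε : 0 < ε) (hε1 : ε < 1) :
    ∃ k, 0 < ck π t u k ∧ ck π t u k - ck π t u (k + 1) ≤ ε * ck π t u k := by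
  by_contra hcon
  push Not at hcon
  have hc0 := ck_nonneg π hπ t u
  have hstep : ∀ k, ck π t u (k + 1) ≤ (1 - ε) * ck π t u k := by
    intro k
    rcases (hc0 k).lt_or_eq with h | h
    · have := hcon k h; linarith
    · have h2 := ck_diff π hπ t σ hσ u k
      have := sq_nonneg ‖uk π t u (k + 2) - uk π t u k‖
      rw [← h] at h2 ⊢
      linarith
  have hgeo : ∀ k j, ck π t u (k + j) ≤ (1 - ε) ^ j * ck π t u k := by
    intro k j
    induction j with
    | zero => simp
    | succ j ih =>
      calc ck π t u (k + (j + 1)) ≤ (1 - ε) * ck π t u (k + j) := hstep (k + j)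
        _ ≤ (1 - ε) * ((1 - ε) ^ j * ck π t u k) := mul_le_mul_of_nonneg_left ih (by linarith)
        _ = _ := by ring
  have hsum : ∀ k n, ∑ j ∈ Finset.range n, ck π t u (k + j) ≤ ck π t u k / ε := by
    intro k n
    have h2 : ∑ j ∈ Finset.range n, (1 - ε) ^ j ≤ 1 / ε := by
      have := mul_neg_geom_sum (1 - ε) n
      have h4 : 0 ≤ (1 - ε) ^ n := pow_nonneg (by linarith) n
      rw [le_div_iff₀ hε]
      have h5 : (1 - (1 - ε)) * ∑ j ∈ Finset.range n, (1 - ε) ^ j = ε * ∑ j ∈ Finset.range n, (1 - ε) ^ j := by ring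
      linarith
    calc _ ≤ ∑ j ∈ Finset.range n, (1 - ε) ^ j * ck π t u k := Finset.sum_le_sum fun j _ => hgeo k j
      _ = (∑ j ∈ Finset.range n, (1 - ε) ^ j) * ck π t u k := by rw [Finset.sum_mul]
      _ ≤ 1 / ε * ck π t u k := mul_le_mul_of_nonneg_right h2 (hc0 k)
      _ = _ := by ring
  have hak : ∀ k, ‖uk π t u k‖ ^ 2 ≤ ck π t u k / ε := by
    intro k
    have ht := uk_tendsto π hπ t σ hσ u h1 hgen ho
    have ht2 : Tendsto (fun n => ‖uk π t u k‖ ^ 2 - ‖uk π t u (k + n)‖ ^ 2) atTop (𝓝 (‖uk π t u k‖ ^ 2 - 0)) := by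
      refine Tendsto.sub tendsto_const_nhds ?_
      exact ht.comp (tendsto_atTop_mono (fun n => Nat.le_add_left n k) tendsto_id)
    rw [sub_zero] at ht2
    refine le_of_tendsto' ht2 fun n => ?_
    rw [← ck_sum π hπ]
    exact hsum k n
  have hau : ∀ k, ‖uk π t u k‖ ^ 2 ≤ (1 - ε) ^ k * (ck π t u 0 / ε) := by
    intro k
    refine (hak k).trans ?_
    have := hgeo 0 k
    rw [zero_add] at this
    calc ck π t u k / ε ≤ (1 - ε) ^ k * ck π t u 0 / ε := by gcongr
      _ = _ := by ring
  obtain ⟨C, hC⟩ := hG (Set.range t) (Set.finite_range t)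
  obtain ⟨M, hM⟩ := exists_nat_gt (ck π t u 0 / ε)
  have hr : 1 < (1 - ε)⁻¹ := (one_lt_inv₀ (by linarith)).2 (by linarith)
  obtain ⟨N, hN⟩ := poly_lt_exp (M * C) d (1 - ε)⁻¹ hr 1
  have h3 := hN N le_rfl
  have h4 := uk_lower' π hπ t u ho N
  have h5 := hau N
  have h6 : (((Set.range t) ^ N).ncard : ℝ) ≤ C * ((N + 1 : ℕ) : ℝ) ^ d := by exact_mod_cast hC N
  rw [one_mul] at h3
  have hp : 0 < (1 - ε) ^ N := pow_pos (by linarith) N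
  have h7 : (1 - ε) ^ N * (((M * C : ℕ) : ℝ) * ((N + 1 : ℕ) : ℝ) ^ d) < 1 := by
    have := mul_lt_mul_of_pos_left h3 hp
    rwa [inv_pow, mul_inv_cancel₀ hp.ne'] at this
  have h8 : ‖uk π t u N‖ ^ 2 * (((Set.range t) ^ N).ncard : ℝ) ≤ ((1 - ε) ^ N * M) * (C * ((N + 1 : ℕ) : ℝ) ^ d) := by
    refine mul_le_mul (h5.trans ?_) h6 (by positivity) (by positivity)
    gcongr
  push_cast at h7 h8
  nlinarith

end

open Filter Topology in
theorem exists_harmonic {G ι : Type} [Group G] [Fintype ι] [Nonempty ι] [Infinite G]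
    (t : ι → G) (σ : ι ≃ ι) (hσ : ∀ i, t (σ i) = (t i)⁻¹)
    (h1 : 1 ∈ Set.range t) (hgen : Subgroup.closure (Set.range t) = ⊤) {d : ℕ} (hG : PG d G) :
    ∃ (H : Type) (_ : NormedAddCommGroup H) (_ : InnerProductSpace ℝ H) (_ : CompleteSpace H)
      (π : G →* (H →L[ℝ] H)) (B : G → H), (∀ g v, ‖π g v‖ = ‖v‖) ∧
      (∀ g h, B (g * h) = B g + π g (B h)) ∧
      ∑ p : ι × ι, B (t p.1 * t p.2) = 0 ∧
      ∑ p : ι × ι, ‖B (t p.1 * t p.2)‖ ^ 2 = 2 * (Fintype.card ι : ℝ) ^ 2 := by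
  obtain ⟨E, _, _, π, u, hπ, ho⟩ := exists_regular G
  have hm : (Fintype.card ι : ℝ) ≠ 0 := by exact_mod_cast Fintype.card_ne_zero
  have hk : ∀ j : ℕ, ∃ k, 0 < ck π t u k ∧ ck π t u k - ck π t u (k + 1) ≤ (1 / ((j:ℝ) + 2)) * ck π t u k := by
    intro j
    refine exists_good_k π hπ t σ hσ u h1 hgen ho hG _ (by positivity) ?_
    rw [div_lt_one (by positivity)]
    have : (0:ℝ) ≤ j := Nat.cast_nonneg j
    linarith
  choose k hk0 hk1 using hk
  let b : ℕ → G → E := fun j g => (Real.sqrt (ck π t u (k j)))⁻¹ • (π g (uk π t u (k j)) - uk π t u (k j))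
  have hs : ∀ j, (Real.sqrt (ck π t u (k j))) ^ 2 = ck π t u (k j) := fun j => Real.sq_sqrt (hk0 j).le
  have hbc : ∀ j g h, b j (g * h) = b j g + π g (b j h) := by
    intro j g h
    simp only [b, map_smul, ← smul_add, rep_mul, map_sub]
    congr 1; abel
  have hbe : ∀ j, ∑ p : ι × ι, ‖b j (t p.1 * t p.2)‖ ^ 2 = 2 * (Fintype.card ι : ℝ) ^ 2 := by
    intro j
    have h2 := avg_energy π hπ t σ hσ (uk π t u (k j))
    change _ = (Fintype.card ι : ℝ) ^ 2 * (2 * ck π t u (k j)) at h2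
    simp only [b, norm_smul, mul_pow, ← Finset.mul_sum, h2]
    rw [norm_inv, inv_pow, Real.norm_eq_abs, sq_abs, hs]
    have := (hk0 j).ne'
    field_simp
  have hbs : ∀ j, ‖∑ p : ι × ι, b j (t p.1 * t p.2)‖ ^ 2 ≤ ((Fintype.card ι : ℝ) ^ 2) ^ 2 * (1 / ((j:ℝ) + 2)) := by
    intro j
    have h2 := avgOp_sq π t (uk π t u (k j))
    have h3 : ∑ p : ι × ι, π (t p.1 * t p.2) (uk π t u (k j)) = (Fintype.card ι : ℝ) ^ 2 • uk π t u (k j + 2) := by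
      change _ = (Fintype.card ι : ℝ) ^ 2 • avgOp π t (avgOp π t _)
      rw [← h2, smul_smul, ← mul_pow, mul_inv_cancel₀ hm]; simp
    have h4 : ∑ p : ι × ι, b j (t p.1 * t p.2) = (Real.sqrt (ck π t u (k j)))⁻¹ •
        ((Fintype.card ι : ℝ) ^ 2 • (uk π t u (k j + 2) - uk π t u (k j))) := by
      simp only [b, ← Finset.smul_sum, Finset.sum_sub_distrib, h3, smul_sub]
      congr 2
      simp only [Finset.sum_const, Finset.card_univ, Fintype.card_prod]
      rw [← Nat.cast_smul_eq_nsmul ℝ]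
      push_cast; rw [sq]
    rw [h4, norm_smul, norm_smul, mul_pow, mul_pow, ← ck_diff π hπ t σ hσ, norm_inv, inv_pow, Real.norm_eq_abs,
      sq_abs, hs, Real.norm_eq_abs, sq_abs]
    rw [inv_mul_le_iff₀ (hk0 j)]
    calc _ ≤ ((Fintype.card ι : ℝ) ^ 2) ^ 2 * ((1 / ((j:ℝ) + 2)) * ck π t u (k j)) :=
          mul_le_mul_of_nonneg_left (hk1 j) (by positivity)
      _ = _ := by ring
  have hbd : ∀ g, ∃ C : ℝ, ∀ j, ‖b j g‖ ≤ C := by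
    intro g
    have hg : g ∈ Subgroup.closure (Set.range t) := by rw [hgen]; trivial
    induction hg using Subgroup.closure_induction with
    | mem x hx =>
      obtain ⟨i, rfl⟩ := hx
      obtain ⟨i', hi'⟩ := h1
      refine ⟨Real.sqrt (2 * (Fintype.card ι : ℝ) ^ 2), fun j => ?_⟩
      apply Real.le_sqrt_of_sq_le
      rw [← hbe j]
      have h2 := Finset.single_le_sum (f := fun p : ι × ι => ‖b j (t p.1 * t p.2)‖ ^ 2)
        (fun _ _ => sq_nonneg _) (Finset.mem_univ (i, i'))
      simpa [hi'] using h2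
    | one => exact ⟨0, fun j => by simp [b]⟩
    | mul x y _ _ hx hy =>
      obtain ⟨C, hC⟩ := hx
      obtain ⟨D, hD⟩ := hy
      refine ⟨C + D, fun j => ?_⟩
      rw [hbc]
      refine (norm_add_le _ _).trans ?_
      rw [hπ]
      exact add_le_add (hC j) (hD j)
    | inv x _ hx =>
      obtain ⟨C, hC⟩ := hx
      refine ⟨C, fun j => ?_⟩
      have h2 := hbc j x x⁻¹
      have h3 : b j (x * x⁻¹) = 0 := by simp [b]
      rw [h3] at h2
      have h4 : ‖π x (b j x⁻¹)‖ = ‖b j x‖ := by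
        rw [← neg_eq_of_add_eq_zero_right h2.symm, norm_neg]
      rw [hπ] at h4
      rw [h4]; exact hC j
  obtain ⟨H, i1, i2, i3, P, B, hP, hB, hlim⟩ := ultra_limit π hπ b hbc hbd
  refine ⟨H, i1, i2, i3, P, B, hP, hB, ?_, ?_⟩
  · have h2 : Tendsto (fun j => ‖∑ p : ι × ι, b j (t p.1 * t p.2)‖ ^ 2) (hyperfilter ℕ : Filter ℕ)
        (𝓝 (‖∑ p : ι × ι, B (t p.1 * t p.2)‖ ^ 2)) := by
      simp only [← real_inner_self_eq_norm_sq, sum_inner, inner_sum]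
      exact tendsto_finsetSum _ fun p _ => tendsto_finsetSum _ fun q _ => hlim _ _
    have h3 : Tendsto (fun j : ℕ => ((Fintype.card ι : ℝ) ^ 2) ^ 2 * (1 / ((j:ℝ) + 2))) (hyperfilter ℕ : Filter ℕ) (𝓝 0) := by
      have h5 : Tendsto (fun j : ℕ => ((Fintype.card ι : ℝ) ^ 2) ^ 2 * (1 / ((j:ℝ) + 2))) atTop (𝓝 (((Fintype.card ι : ℝ) ^ 2) ^ 2 * 0)) := by
        refine Tendsto.const_mul _ ?_
        have := tendsto_one_div_atTop_nhds_zero_nat (𝕜 := ℝ)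
        refine (this.comp (tendsto_add_atTop_nat 2)).congr fun j => ?_
        simp
      rw [mul_zero] at h5
      exact h5.mono_left (Nat.hyperfilter_le_atTop)
    have h4 := le_of_tendsto_of_tendsto' h2 h3 hbs
    have h5 : ‖∑ p : ι × ι, B (t p.1 * t p.2)‖ = 0 := by
      have := sq_nonneg ‖∑ p : ι × ι, B (t p.1 * t p.2)‖
      exact pow_eq_zero_iff (two_ne_zero) |>.1 (le_antisymm h4 this)
    exact norm_eq_zero.1 h5
  · have h2 : Tendsto (fun j => ∑ p : ι × ι, ‖b j (t p.1 * t p.2)‖ ^ 2) (hyperfilter ℕ : Filter ℕ)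
        (𝓝 (∑ p : ι × ι, ‖B (t p.1 * t p.2)‖ ^ 2)) := by
      simp only [← real_inner_self_eq_norm_sq]
      exact tendsto_finsetSum _ fun p _ => hlim _ _
    simp only [hbe] at h2
    exact tendsto_nhds_unique h2 tendsto_const_nhds

end PartP7b

section PartP8
open scoped Pointwise
set_option linter.unusedSectionVars false

section
variable {G κ : Type} [Group G] [Fintype κ] [Nonempty κ] (s : κ → G)

/-- expectation of a function under the n-step random walk -/
noncomputable def ex : ℕ → ((G → ℝ) →ₗ[ℝ] ℝ)
  | 0 => LinearMap.proj 1
  | n + 1 => (Fintype.card κ : ℝ)⁻¹ • ∑ i, (ex n).comp (LinearMap.funLeft ℝ ℝ (fun x => s i * x))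

theorem ex_zero (F : G → ℝ) : ex s 0 F = F 1 := rfl

theorem ex_succ (n : ℕ) (F : G → ℝ) : ex s (n + 1) F = (Fintype.card κ : ℝ)⁻¹ * ∑ i, ex s n (fun x => F (s i * x)) := by
  simp only [ex, LinearMap.smul_apply, LinearMap.sum_apply, LinearMap.comp_apply, smul_eq_mul]
  rfl

theorem cardK_pos : (0 : ℝ) < Fintype.card κ := by exact_mod_cast Fintype.card_pos (α := κ)

theorem ex_mono (n : ℕ) (F F' : G → ℝ) (h : ∀ x ∈ (Set.range s) ^ n, F x ≤ F' x) : ex s n F ≤ ex s n F' := by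
  induction n generalizing F F' with
  | zero => exact h 1 (by simp)
  | succ n ih =>
    rw [ex_succ, ex_succ]
    refine mul_le_mul_of_nonneg_left (Finset.sum_le_sum fun i _ => ih _ _ fun x hx => h _ ?_) (by positivity)
    rw [pow_succ']
    exact Set.mul_mem_mul ⟨i, rfl⟩ hx

theorem ex_congr (n : ℕ) (F F' : G → ℝ) (h : ∀ x ∈ (Set.range s) ^ n, F x = F' x) : ex s n F = ex s n F' :=
  le_antisymm (ex_mono s n _ _ fun x hx => (h x hx).le) (ex_mono s n _ _ fun x hx => (h x hx).ge)

theorem ex_const (n : ℕ) (c : ℝ) : ex s n (fun _ => c) = c := by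
  induction n with
  | zero => rfl
  | succ n ih =>
    rw [ex_succ, ih]
    have := (cardK_pos (κ := κ)).ne'
    simp [this]

theorem ex_nonneg (n : ℕ) (F : G → ℝ) (h : ∀ x, 0 ≤ F x) : 0 ≤ ex s n F := by
  rw [← ex_const s n 0]; exact ex_mono s n _ _ fun x _ => h x

theorem ex_add (n : ℕ) (F F' : G → ℝ) : ex s n (fun x => F x + F' x) = ex s n F + ex s n F' := map_add (ex s n) F F'
theorem ex_sub (n : ℕ) (F F' : G → ℝ) : ex s n (fun x => F x - F' x) = ex s n F - ex s n F' := map_sub (ex s n) F F'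
theorem ex_mul (n : ℕ) (c : ℝ) (F : G → ℝ) : ex s n (fun x => c * F x) = c * ex s n F := map_smul (ex s n) c F
theorem ex_sum {α : Type} (W : Finset α) (n : ℕ) (F : α → G → ℝ) :
    ex s n (fun x => ∑ a ∈ W, F a x) = ∑ a ∈ W, ex s n (F a) := by
  rw [← map_sum]; congr 1; ext x; simp

theorem ex_right (n : ℕ) (F : G → ℝ) : ex s (n + 1) F = (Fintype.card κ : ℝ)⁻¹ * ∑ i, ex s n (fun x => F (x * s i)) := by
  induction n generalizing F with
  | zero => rw [ex_succ]; simp [ex_zero]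
  | succ n ih =>
    rw [ex_succ]
    have h1 : ∀ i, ex s (n+1) (fun x => F (x * s i)) = (Fintype.card κ : ℝ)⁻¹ * ∑ j, ex s n (fun x => F (s j * x * s i)) :=
      fun i => ex_succ s n _
    have h2 : ∀ i, ex s (n+1) (fun x => F (s i * x)) = (Fintype.card κ : ℝ)⁻¹ * ∑ j, ex s n (fun x => F (s i * (x * s j))) :=
      fun i => ih _
    simp only [h1, h2, ← Finset.mul_sum]
    rw [Finset.sum_comm]
    simp only [mul_assoc]

open Classical in
/-- point masses -/
noncomputable def pn (n : ℕ) (x : G) : ℝ := ex s n (fun y => if y = x then 1 else 0)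

theorem pn_nonneg (n : ℕ) (x : G) : 0 ≤ pn s n x := ex_nonneg s n _ fun y => by split_ifs <;> norm_num

theorem ex_eq_sum (n : ℕ) (F : G → ℝ) (W : Finset G) (hW : (Set.range s) ^ n ⊆ W) :
    ex s n F = ∑ x ∈ W, pn s n x * F x := by
  classical
  have h1 : ex s n F = ex s n (fun y => ∑ x ∈ W, F x * (if y = x then 1 else 0)) := by
    refine ex_congr s n _ _ fun y hy => ?_
    simp [Finset.sum_ite_eq, show y ∈ W from hW hy]
  rw [h1, ex_sum]
  refine Finset.sum_congr rfl fun x _ => ?_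
  rw [ex_mul, mul_comm]; unfold pn; congr!

theorem pn_zero_of_notMem (n : ℕ) (x : G) (hx : x ∉ (Set.range s) ^ n) : pn s n x = 0 := by
  unfold pn
  refine (ex_congr s n _ (fun _ => 0) fun y hy => if_neg ?_).trans (ex_const s n 0)
  rintro rfl; exact hx hy

theorem pn_sum_le (n : ℕ) (W : Finset G) : ∑ x ∈ W, pn s n x ≤ 1 := by
  classical
  unfold pn
  rw [← ex_sum]
  refine (ex_mono s n _ (fun _ => 1) fun y _ => ?_).trans (ex_const s n 1).le
  rw [Finset.sum_ite_eq]; split_ifs <;> norm_num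

theorem pn_sum (n : ℕ) (W : Finset G) (hW : (Set.range s) ^ n ⊆ W) : ∑ x ∈ W, pn s n x = 1 := by
  have := ex_eq_sum s n (fun _ => 1) W hW
  simpa [ex_const] using this.symm

theorem pn_step (n : ℕ) (i : κ) (x : G) : pn s n x ≤ Fintype.card κ * pn s (n + 1) (s i * x) := by
  classical
  have hm := cardK_pos (κ := κ)
  unfold pn
  rw [ex_succ, ← mul_assoc, mul_inv_cancel₀ hm.ne', one_mul]
  have h2 := Finset.single_le_sum (f := fun j => ex s n (fun y => if s j * y = s i * x then (1:ℝ) else 0))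
    (fun j _ => ex_nonneg s n _ fun y => by split_ifs <;> norm_num) (Finset.mem_univ i)
  refine le_trans (le_of_eq ?_) (h2.trans (le_of_eq ?_))
  · congr 1; ext y; simp
  · rfl

/-- entropy -/
noncomputable def ent (n : ℕ) : ℝ := ex s n (fun x => - Real.log (pn s n x))

theorem ent_le (n : ℕ) : ent s n ≤ Real.log (((Set.range s) ^ n).ncard : ℝ) := by
  have hfin : ((Set.range s) ^ n).Finite := set_pow_finite (Set.finite_range s) n
  set W := hfin.toFinset with hWd
  have hW : (Set.range s) ^ n ⊆ W := by simp [hWd]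
  have hN : ((Set.range s) ^ n).ncard = W.card := Set.ncard_eq_toFinset_card _ hfin
  have hne : W.Nonempty := by
    rw [hWd, Set.Finite.toFinset_nonempty]
    exact (Set.range_nonempty s).pow
  rw [hN]
  have hNpos : (0:ℝ) < W.card := by exact_mod_cast hne.card_pos
  have h1 : ent s n - Real.log W.card = ∑ x ∈ W, pn s n x * (- Real.log (pn s n x) - Real.log W.card) := by
    rw [← ex_eq_sum s n _ W hW, ex_sub, ex_const]; rfl
  have h2 : ∑ x ∈ W, pn s n x * (- Real.log (pn s n x) - Real.log W.card) ≤ ∑ x ∈ W, ((W.card : ℝ)⁻¹ - pn s n x) := by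
    refine Finset.sum_le_sum fun x _ => ?_
    rcases (pn_nonneg s n x).lt_or_eq with h | h
    · have h3 : - Real.log (pn s n x) - Real.log W.card = Real.log ((pn s n x * W.card)⁻¹) := by
        rw [Real.log_inv, Real.log_mul h.ne' hNpos.ne']; ring
      have h4 := Real.log_le_sub_one_of_pos (x := (pn s n x * W.card)⁻¹) (by positivity)
      rw [h3]
      calc _ ≤ pn s n x * ((pn s n x * W.card)⁻¹ - 1) := mul_le_mul_of_nonneg_left h4 h.le
        _ = _ := by field_simp
    · rw [← h]; simp
  rw [Finset.sum_sub_distrib, pn_sum s n W hW] at h2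
  have h5 : ∑ x ∈ W, (W.card : ℝ)⁻¹ = 1 := by
    rw [Finset.sum_const, nsmul_eq_mul, mul_inv_cancel₀ hNpos.ne']
  rw [h5] at h2
  linarith

theorem kl_pt (p r : ℝ) (hp : 0 ≤ p) (hr : 0 ≤ r) (h : 0 < p → 0 < r) :
    (Real.sqrt p - Real.sqrt r) ^ 2 + (p - r) ≤ p * (Real.log p - Real.log r) := by
  rcases hp.lt_or_eq with hp' | hp'
  · have hr' := h hp'
    have h1 := Real.log_le_sub_one_of_pos (x := Real.sqrt r / Real.sqrt p) (by positivity)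
    rw [Real.log_div (by positivity) (by positivity), Real.log_sqrt hr, Real.log_sqrt hp] at h1
    have h2 := Real.sq_sqrt hp
    have h3 := Real.sq_sqrt hr
    have hsp : 0 < Real.sqrt p := Real.sqrt_pos.2 hp'
    have h4 : p * (Real.sqrt r / Real.sqrt p) = Real.sqrt p * Real.sqrt r := by
      field_simp; exact h2.symm
    have h5 := mul_le_mul_of_nonneg_left h1 hp
    rw [mul_sub, mul_sub, h4] at h5
    nlinarith
  · subst hp'
    simp [Real.sq_sqrt hr]

/-- relative entropy of a step -/
noncomputable def dn (n : ℕ) (i : κ) : ℝ := ex s n (fun x => Real.log (pn s n x) - Real.log (pn s (n+1) (s i * x)))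

theorem ent_diff (n : ℕ) : ∑ i, dn s n i = Fintype.card κ * (ent s (n + 1) - ent s n) := by
  have hm := cardK_pos (κ := κ)
  unfold dn ent
  rw [ex_succ, mul_sub, ← mul_assoc, mul_inv_cancel₀ hm.ne', one_mul]
  have e1 : ∀ (k : ℕ) (F : G → ℝ), ex s k (fun x => - F x) = - ex s k F := fun k F => map_neg (ex s k) F
  simp only [e1, ex_sub, Finset.sum_sub_distrib, Finset.sum_neg_distrib, Finset.sum_const, Finset.card_univ, nsmul_eq_mul]
  ring

theorem dn_ge (n : ℕ) (i : κ) (W : Finset G) (hW : (Set.range s) ^ n ⊆ W) :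
    ∑ x ∈ W, (Real.sqrt (pn s n x) - Real.sqrt (pn s (n+1) (s i * x))) ^ 2 ≤ dn s n i := by
  classical
  unfold dn
  rw [ex_eq_sum s n _ W hW]
  have h1 : ∑ x ∈ W, ((Real.sqrt (pn s n x) - Real.sqrt (pn s (n+1) (s i * x))) ^ 2 + (pn s n x - pn s (n+1) (s i * x))) ≤
      ∑ x ∈ W, pn s n x * (Real.log (pn s n x) - Real.log (pn s (n+1) (s i * x))) := by
    refine Finset.sum_le_sum fun x _ => kl_pt _ _ (pn_nonneg s n x) (pn_nonneg s _ _) fun h => ?_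
    have := pn_step s n i x
    have hm := cardK_pos (κ := κ)
    by_contra hc
    have : pn s (n+1) (s i * x) = 0 := le_antisymm (not_lt.1 hc) (pn_nonneg s _ _)
    simp_all
    linarith
  rw [Finset.sum_add_distrib, Finset.sum_sub_distrib, pn_sum s n W hW] at h1
  have h2 : ∑ x ∈ W, pn s (n+1) (s i * x) ≤ 1 := by
    have := pn_sum_le s (n+1) (W.image fun x => s i * x)
    rwa [Finset.sum_image (by intro a _ b _ hab; simpa using hab)] at this
  linarith

theorem dn_nonneg (n : ℕ) (i : κ) : 0 ≤ dn s n i := by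
  have hfin : ((Set.range s) ^ n).Finite := set_pow_finite (Set.finite_range s) n
  refine le_trans ?_ (dn_ge s n i hfin.toFinset (by simp))
  exact Finset.sum_nonneg fun _ _ => sq_nonneg _

theorem ent_ineq (n : ℕ) (i : κ) (F : G → ℝ) :
    (ex s n (fun x => F (s i * x)) - ex s (n+1) F) ^ 2 ≤
      (Fintype.card κ * (ent s (n + 1) - ent s n)) * (2 * (Fintype.card κ + 1)) * ex s (n+1) (fun x => F x ^ 2) := by
  classical
  have hfin : ((Set.range s) ^ (n+1)).Finite := set_pow_finite (Set.finite_range s) (n+1)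
  set W := hfin.toFinset.image (fun y => (s i)⁻¹ * y) with hWd
  have hW : (Set.range s) ^ n ⊆ W := by
    intro x hx
    rw [hWd, Finset.coe_image]
    refine ⟨s i * x, ?_, by simp⟩
    rw [Set.Finite.coe_toFinset, pow_succ']
    exact Set.mul_mem_mul ⟨i, rfl⟩ hx
  have hq : ∀ f : G → ℝ, ex s (n+1) f = ∑ x ∈ W, pn s (n+1) (s i * x) * f (s i * x) := by
    intro f
    rw [hWd, Finset.sum_image (by intro a _ b _ hab; simpa using hab), ex_eq_sum s (n+1) f hfin.toFinset (by simp)]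
    simp
  have h1 : ex s n (fun x => F (s i * x)) - ex s (n+1) F = ∑ x ∈ W,
      (Real.sqrt (pn s n x) - Real.sqrt (pn s (n+1) (s i * x))) *
        ((Real.sqrt (pn s n x) + Real.sqrt (pn s (n+1) (s i * x))) * F (s i * x)) := by
    rw [hq, ex_eq_sum s n _ W hW, ← Finset.sum_sub_distrib]
    refine Finset.sum_congr rfl fun x _ => ?_
    have a1 := Real.sq_sqrt (pn_nonneg s n x)
    have a2 := Real.sq_sqrt (pn_nonneg s (n+1) (s i * x))
    nth_rewrite 1 [← a1]
    nth_rewrite 1 [← a2]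
    ring
  rw [h1]
  refine (Finset.sum_mul_sq_le_sq_mul_sq _ _ _).trans ?_
  have h2 : dn s n i ≤ Fintype.card κ * (ent s (n + 1) - ent s n) := by
    rw [← ent_diff]
    exact Finset.single_le_sum (fun j _ => dn_nonneg s n j) (Finset.mem_univ i)
  have h3 := (dn_ge s n i W hW).trans h2
  rw [mul_assoc]
  refine mul_le_mul h3 ?_ (Finset.sum_nonneg fun _ _ => sq_nonneg _) ((dn_nonneg s n i).trans h2)
  rw [hq, Finset.mul_sum]
  refine Finset.sum_le_sum fun x _ => ?_
  rw [mul_pow, ← mul_assoc]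
  refine mul_le_mul_of_nonneg_right ?_ (sq_nonneg _)
  have a1 := Real.sq_sqrt (pn_nonneg s n x)
  have a2 := Real.sq_sqrt (pn_nonneg s (n+1) (s i * x))
  have a3 := pn_step s n i x
  nlinarith [sq_nonneg (Real.sqrt (pn s n x) - Real.sqrt (pn s (n+1) (s i * x)))]

open Filter in
theorem ent_good {d : ℕ} (hG : PG d G) : ∃ᶠ n : ℕ in atTop, ent s (n + 1) - ent s n ≤ ((d:ℝ) + 1) / ((n:ℝ) + 1) := by
  rw [Filter.Frequently, eventually_atTop]
  rintro ⟨N, hN⟩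
  obtain ⟨C, hC⟩ := hG (Set.range s) (Set.finite_range s)
  have hlow : ∀ k, ent s N + ((d:ℝ) + 1) * (Real.log ((N + k : ℕ) + 1) - Real.log ((N:ℝ) + 1)) ≤ ent s (N + k) := by
    intro k
    induction k with
    | zero => simp
    | succ k ih =>
      have h1 := hN (N + k) (by omega)
      rw [not_le] at h1
      have h2 : Real.log ((N + (k+1) : ℕ) + 1) - Real.log ((N + k : ℕ) + 1) ≤ 1 / (((N + k : ℕ):ℝ) + 1) := by
        rw [← Real.log_div (by positivity) (by positivity)]
        refine (Real.log_le_sub_one_of_pos (by positivity)).trans (le_of_eq ?_)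
        push_cast
        field_simp
        ring
      have h3 := mul_le_mul_of_nonneg_left h2 (show (0:ℝ) ≤ (d:ℝ) + 1 by positivity)
      rw [mul_one_div] at h3
      rw [← add_assoc N k 1]
      rw [← add_assoc N k 1] at h3
      linarith
  have hup : ∀ n, ent s n ≤ Real.log (C + 1) + d * Real.log ((n:ℝ) + 1) := by
    intro n
    refine (ent_le s n).trans ?_
    have hfin : ((Set.range s) ^ n).Finite := set_pow_finite (Set.finite_range s) n
    have hpos : 0 < ((Set.range s) ^ n).ncard := (Set.ncard_pos hfin).2 ((Set.range_nonempty s).pow)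
    rw [← Real.log_pow, ← Real.log_mul (by positivity) (by positivity)]
    refine Real.log_le_log (by exact_mod_cast hpos) ?_
    have : (((Set.range s) ^ n).ncard : ℝ) ≤ C * ((n:ℝ) + 1) ^ d := by exact_mod_cast hC n
    refine this.trans ?_
    gcongr; linarith
  have hlim : Tendsto (fun k : ℕ => Real.log ((N + k : ℕ) + 1)) atTop atTop := by
    refine Real.tendsto_log_atTop.comp ?_
    refine tendsto_atTop_mono (fun k => ?_) (tendsto_natCast_atTop_atTop (R := ℝ))
    push_cast
    have : (0:ℝ) ≤ N := Nat.cast_nonneg N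
    linarith
  obtain ⟨k, hk⟩ := (hlim.eventually_gt_atTop (Real.log (C + 1) + ((d:ℝ) + 1) * Real.log ((N:ℝ) + 1) - ent s N)).exists
  have := hlow k
  have := hup (N + k)
  nlinarith
end

end PartP8

section PartP9
open scoped Pointwise

section
variable {H : Type} [NormedAddCommGroup H] [InnerProductSpace ℝ H]
  (T : H →L[ℝ] H) (hs : ∀ v w, inner ℝ (T v) w = inner ℝ v (T w)) (hp : ∀ v, 0 ≤ inner ℝ (T v) v)

include hs hp in
theorem pos_norm_le (v : H) : ‖T v‖ ^ 2 ≤ ‖T‖ * inner ℝ (T v) v := by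
  let B : LinearMap.BilinForm ℝ H := (innerₗ H).comp T.toLinearMap
  have hB : ∀ x y, B x y = inner ℝ (T x) y := fun _ _ => rfl
  have h := LinearMap.BilinForm.apply_mul_apply_le_of_forall_zero_le B (fun x => by rw [hB]; exact hp x) v (T v)
  simp only [hB] at h
  rw [hs (T v) v, real_inner_self_eq_norm_sq] at h
  have h2 : inner ℝ (T (T v)) (T v) ≤ ‖T‖ * ‖T v‖ ^ 2 := by
    refine (real_inner_le_norm _ _).trans ?_
    have := T.le_opNorm (T v)
    nlinarith [norm_nonneg (T v)]
  rcases (norm_nonneg (T v)).lt_or_eq with h3 | h3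
  · have h4 : 0 < ‖T v‖ ^ 2 := by positivity
    have h5 := mul_le_mul_of_nonneg_left h2 (hp v)
    nlinarith
  · rw [← h3]
    have := mul_nonneg (norm_nonneg T) (hp v)
    simpa using this

include hs hp in
open Filter Topology in
theorem trace_compact [CompleteSpace H] (K : ℝ)
    (htr : ∀ (α : Type) [Fintype α] (e : α → H), Orthonormal ℝ e → ∑ i, inner ℝ (T (e i)) (e i) ≤ K) :
    IsCompactOperator T := by
  classical
  let A : Set ℝ := {x | ∃ (α : Type) (_ : Fintype α) (e : α → H), Orthonormal ℝ e ∧ x = ∑ i, inner ℝ (T (e i)) (e i)}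
  have hA : BddAbove A := ⟨K, by rintro x ⟨α, _, e, he, rfl⟩; exact htr α e he⟩
  have hne : A.Nonempty := ⟨0, Empty, inferInstance, Empty.elim, ⟨fun i => i.elim, fun i => i.elim⟩, by simp⟩
  have key : ∀ ε > 0, ∃ L : H →L[ℝ] H, IsCompactOperator L ∧ ‖T - L‖ ≤ Real.sqrt (‖T‖ * ε) := by
    intro ε hε
    obtain ⟨x, ⟨α, _, e, he, rfl⟩, hx⟩ := exists_lt_of_lt_csSup hne (show sSup A - ε < sSup A by linarith)
    let W : Submodule ℝ H := Submodule.span ℝ (Set.range e)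
    have : FiniteDimensional ℝ W := FiniteDimensional.span_of_finite ℝ (Set.finite_range e)
    have hW : ∀ w ∈ Wᗮ, inner ℝ (T w) w ≤ ε * ‖w‖ ^ 2 := by
      intro w hw
      by_cases h0 : w = 0
      · simp [h0]
      have hn : ‖w‖ ≠ 0 := norm_ne_zero_iff.2 h0
      let f : Option α → H := fun o => o.elim ((‖w‖)⁻¹ • w) e
      have hwe : ∀ i, inner ℝ (e i) w = 0 := fun i =>
        (Submodule.mem_orthogonal W w).1 hw (e i) (Submodule.subset_span ⟨i, rfl⟩)
      have hf : Orthonormal ℝ f := by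
        constructor
        · rintro (_ | i)
          · simp [f, norm_smul, hn]
          · exact he.1 i
        · rintro (_ | i) (_ | j) hij
          · exact absurd rfl hij
          · change inner ℝ ((‖w‖)⁻¹ • w) (e j) = 0
            rw [real_inner_smul_left, real_inner_comm, hwe, mul_zero]
          · simp [f, real_inner_smul_right, hwe]
          · exact he.2 (by simpa using hij)
      have h1 : ∑ o, inner ℝ (T (f o)) (f o) ≤ sSup A := le_csSup hA ⟨Option α, inferInstance, f, hf, rfl⟩
      rw [Fintype.sum_option] at h1
      have h2 : inner ℝ (T (f none)) (f none) = (‖w‖ ^ 2)⁻¹ * inner ℝ (T w) w := by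
        simp [f, real_inner_smul_left, real_inner_smul_right]; ring
      have h3 : (‖w‖ ^ 2)⁻¹ * inner ℝ (T w) w ≤ ε := by
        rw [← h2]
        change _ + ∑ i, inner ℝ (T (e i)) (e i) ≤ _ at h1
        linarith
      rw [inv_mul_le_iff₀ (by positivity)] at h3
      linarith
    refine ⟨T.comp W.starProjection, ?_, ?_⟩
    · have h1 : IsCompactOperator (T.comp W.subtypeL) := isCompactOperator_of_locallyCompactSpace_rng _
      have := h1.comp_clm (W.orthogonalProjectionOnto)
      exact this
    · refine ContinuousLinearMap.opNorm_le_bound _ (Real.sqrt_nonneg _) fun x => ?_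
      have h1 : (T - T.comp W.starProjection) x = T (x - W.starProjection x) := by simp
      rw [h1]
      have h2 : x - W.starProjection x ∈ Wᗮ := Submodule.sub_starProjection_mem_orthogonal x
      have h3 : ‖x - W.starProjection x‖ ≤ ‖x‖ := by
        have h5 : x - W.starProjection x = Wᗮ.starProjection x := by
          rw [Submodule.starProjection_orthogonal']; rfl
        rw [h5]
        exact Submodule.norm_starProjection_apply_le _ _
      have h4 := pos_norm_le T hs hp (x - W.starProjection x)
      have h5 := hW _ h2
      have h6 : ‖x - W.starProjection x‖ ^ 2 ≤ ‖x‖ ^ 2 := pow_le_pow_left₀ (norm_nonneg _) h3 2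
      refine abs_le_of_sq_le_sq' ?_ (by positivity) |>.2
      rw [mul_pow, Real.sq_sqrt (by positivity)]
      calc _ ≤ ‖T‖ * (ε * ‖x‖ ^ 2) := h4.trans (mul_le_mul_of_nonneg_left (h5.trans (mul_le_mul_of_nonneg_left h6 hε.le)) (norm_nonneg _))
        _ = _ := by ring
  have hcl := isClosed_setOfPred_isCompactOperator (σ₁₂ := RingHom.id ℝ) (M₁ := H) (M₂ := H)
  refine hcl.closure_subset ?_
  rw [Metric.mem_closure_iff]
  intro δ hδ
  obtain ⟨L, hL, hTL⟩ := key (δ ^ 2 / (4 * (‖T‖ + 1))) (by positivity)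
  refine ⟨L, hL, ?_⟩
  rw [dist_eq_norm]
  refine hTL.trans_lt ?_
  rw [Real.sqrt_lt' hδ]
  have : ‖T‖ * (δ ^ 2 / (4 * (‖T‖ + 1))) = δ ^ 2 * (‖T‖ / (4 * (‖T‖ + 1))) := by ring
  rw [this]
  have h2 : ‖T‖ / (4 * (‖T‖ + 1)) < 1 := by
    rw [div_lt_one (by positivity)]
    have := norm_nonneg T; linarith
  have : 0 < δ ^ 2 := by positivity
  nlinarith

include hs hp in
open Filter Topology in
theorem top_eigen (hc : IsCompactOperator T) (hT : 0 < ‖T‖) : ∃ v, v ≠ 0 ∧ T v = ‖T‖ • v := by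
  have h1 : ∀ j : ℕ, ∃ x : H, ‖x‖ < 1 ∧ ‖T‖ - 1 / ((j:ℝ) + 1) < ‖T x‖ := fun j =>
    T.exists_lt_apply_of_lt_opNorm (by have : (0:ℝ) < 1 / ((j:ℝ) + 1) := by positivity
                                       linarith)
  choose v hv1 hv2 using h1
  have hK := hc.isCompact_closure_image_closedBall (f := T.toLinearMap) 1
  obtain ⟨w, hw, φ, hφ, hlim⟩ := hK.tendsto_subseq (x := fun j => T (v j)) (fun j => subset_closure
    ⟨v j, by simpa using (hv1 j).le, rfl⟩)
  have hle : ∀ j, ‖T (v j)‖ ≤ ‖T‖ := fun j => T.le_of_opNorm_le_of_le le_rfl (hv1 j).le |>.trans (by simp)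
  have hno : Tendsto (fun j => ‖T (v j)‖) atTop (𝓝 ‖T‖) := by
    refine tendsto_of_tendsto_of_tendsto_of_le_of_le ?_ tendsto_const_nhds (fun j => (hv2 j).le) hle
    have := (tendsto_const_nhds (x := ‖T‖)).sub (tendsto_one_div_add_atTop_nhds_zero_nat (𝕜 := ℝ))
    simpa using this
  have hwn : ‖w‖ = ‖T‖ := tendsto_nhds_unique hlim.norm (hno.comp hφ.tendsto_atTop)
  have hd : ∀ j, ‖T (v j) - ‖T‖ • v j‖ ^ 2 ≤ ‖T‖ ^ 2 - ‖T (v j)‖ ^ 2 := by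
    intro j
    rw [norm_sub_sq_real, norm_smul, real_inner_smul_right, norm_norm]
    have a1 := pos_norm_le T hs hp (v j)
    have a2 : (‖T‖ * ‖v j‖) ^ 2 ≤ ‖T‖ ^ 2 := by
      refine pow_le_pow_left₀ (by positivity) ?_ 2
      have := hv1 j
      nlinarith
    linarith
  have hd2 : Tendsto (fun j => ‖T (v j) - ‖T‖ • v j‖ ^ 2) atTop (𝓝 0) := by
    refine squeeze_zero (fun _ => sq_nonneg _) hd ?_
    have := (tendsto_const_nhds (x := ‖T‖ ^ 2)).sub (hno.pow 2)
    simpa using this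
  have hd3 : Tendsto (fun j => T (v j) - ‖T‖ • v j) atTop (𝓝 0) := by
    rw [tendsto_zero_iff_norm_tendsto_zero]
    have := hd2.sqrt
    simpa using this
  have hd4 : Tendsto (fun j => ‖T‖ • v (φ j)) atTop (𝓝 w) := by
    have := hlim.sub (hd3.comp hφ.tendsto_atTop)
    simpa [Function.comp_def] using this
  have hd5 : Tendsto (fun j => T (‖T‖ • v (φ j))) atTop (𝓝 (T w)) := (T.continuous.tendsto w).comp hd4
  have hd6 : Tendsto (fun j => T (‖T‖ • v (φ j))) atTop (𝓝 (‖T‖ • w)) := by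
    simp only [map_smul]
    exact hlim.const_smul _
  refine ⟨w, ?_, tendsto_nhds_unique hd5 hd6⟩
  rintro rfl
  rw [norm_zero] at hwn; exact hT.ne hwn

include hs hp in
theorem eigen_of_rayleigh (v : H) (hv : inner ℝ (T v) v = ‖T‖ * ‖v‖ ^ 2) : T v = ‖T‖ • v := by
  rw [← sub_eq_zero, ← norm_eq_zero, ← sq_eq_zero_iff]
  refine le_antisymm ?_ (sq_nonneg _)
  rw [norm_sub_sq_real, norm_smul, real_inner_smul_right, norm_norm, hv]
  have := pos_norm_le T hs hp v
  rw [hv] at this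
  nlinarith

theorem rayleigh_le (v : H) : inner ℝ (T v) v ≤ ‖T‖ * ‖v‖ ^ 2 := by
  refine (real_inner_le_norm _ _).trans ?_
  have := T.le_opNorm v
  nlinarith [norm_nonneg v]
end

end PartP9

section PartP10
open scoped Pointwise
open Filter Topology
set_option linter.unusedSectionVars false

section
variable {G κ H : Type} [Group G] [Fintype κ] [Nonempty κ] (s : κ → G)
  [NormedAddCommGroup H] [InnerProductSpace ℝ H]
  (π : G →* (H →L[ℝ] H)) (hπ : ∀ g v, ‖π g v‖ = ‖v‖)
  (B : G → H) (hB : ∀ g h, B (g * h) = B g + π g (B h))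
  (hB0 : ∑ i, B (s i) = 0) (hB2 : ∑ i, ‖B (s i)‖ ^ 2 = 2 * (Fintype.card κ : ℝ))

include hB in
theorem B_one : B 1 = 0 := by
  have := hB 1 1
  simpa using this

include hB hB0 in
theorem ex_B (n : ℕ) (v : H) : ex s n (fun x => inner ℝ (B x) v) = 0 := by
  induction n with
  | zero => rw [ex_zero, B_one π B hB, inner_zero_left]
  | succ n ih =>
    rw [ex_right, ← ex_sum]
    have h : (fun x => ∑ i, inner ℝ (B (x * s i)) v) = fun x => (Fintype.card κ : ℝ) * inner ℝ (B x) v := by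
      ext x
      simp only [hB, inner_add_left, Finset.sum_add_distrib]
      have e : ∑ i, inner ℝ (π x (B (s i))) v = 0 := by rw [← sum_inner, ← map_sum, hB0]; simp
      rw [e]; simp
    rw [h, ex_mul, ih]; simp

include hB hB0 hB2 hπ in
theorem ex_B2 (n : ℕ) : ex s n (fun x => ‖B x‖ ^ 2) = 2 * n := by
  induction n with
  | zero => rw [ex_zero, B_one π B hB]; simp
  | succ n ih =>
    rw [ex_right, ← ex_sum]
    have h : (fun x => ∑ i, ‖B (x * s i)‖ ^ 2) = fun x => (Fintype.card κ : ℝ) * ‖B x‖ ^ 2 + 2 * Fintype.card κ := by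
      ext x
      simp only [hB, norm_add_sq_real, Finset.sum_add_distrib, hπ, hB2]
      rw [← Finset.mul_sum, ← inner_sum, ← map_sum, hB0]
      simp
    rw [h, ex_add, ex_mul, ih, ex_const]
    have := (cardK_pos (κ := κ)).ne'
    push_cast; field_simp

include hπ hB hB0 in
theorem ex_Bshift (n : ℕ) (g : G) (v : H) : ex s n (fun x => inner ℝ (B (g * x)) v) = inner ℝ (B g) v := by
  have h : (fun x => inner ℝ (B (g * x)) v) = fun x => inner ℝ (B g) v + inner ℝ (B x) (π g⁻¹ v) := by
    ext x
    rw [hB, inner_add_left, rep_inner_left π hπ]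
  rw [h, ex_add, ex_const, ex_B s π B hB hB0, add_zero]

include hπ hB hB0 in
theorem ent_B {C : ℝ} (n : ℕ) (hn : ent s (n + 1) - ent s n ≤ C / ((n : ℝ) + 1)) (i : κ) (v : H) :
    (inner ℝ (B (s i)) v) ^ 2 ≤ (Fintype.card κ * C * (2 * (Fintype.card κ + 1))) *
      (((n : ℝ) + 1)⁻¹ * ex s (n + 1) (fun x => (inner ℝ (B x) v) ^ 2)) := by
  have h := ent_ineq s n i (fun x => inner ℝ (B x) v)
  rw [ex_Bshift s π hπ B hB hB0, ex_B s π B hB hB0, sub_zero] at h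
  refine h.trans ?_
  have h0 : 0 ≤ ex s (n + 1) (fun x => (inner ℝ (B x) v) ^ 2) := ex_nonneg s _ _ fun x => sq_nonneg _
  have hm := cardK_pos (κ := κ)
  calc _ ≤ (Fintype.card κ * (C / ((n : ℝ) + 1))) * (2 * (Fintype.card κ + 1)) * ex s (n + 1) (fun x => (inner ℝ (B x) v) ^ 2) := by
        gcongr
    _ = _ := by rw [div_eq_mul_inv]; ring

include hπ hB hB0 in
theorem ex_left_sq (n : ℕ) (v : H) : ex s (n + 1) (fun x => (inner ℝ (B x) v) ^ 2) =
    (Fintype.card κ : ℝ)⁻¹ * ∑ i, (inner ℝ (B (s i)) v) ^ 2 +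
      (Fintype.card κ : ℝ)⁻¹ * ∑ i, ex s n (fun x => (inner ℝ (B x) (π (s i)⁻¹ v)) ^ 2) := by
  rw [ex_succ, ← mul_add, ← Finset.sum_add_distrib]
  congr 1
  refine Finset.sum_congr rfl fun i _ => ?_
  have h : (fun x => (inner ℝ (B (s i * x)) v) ^ 2) = fun x => ((inner ℝ (B (s i)) v) ^ 2 +
      (2 * inner ℝ (B (s i)) v) * inner ℝ (B x) (π (s i)⁻¹ v)) + (inner ℝ (B x) (π (s i)⁻¹ v)) ^ 2 := by
    ext x
    rw [hB, inner_add_left, rep_inner_left π hπ]; ring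
  rw [h, ex_add, ex_add, ex_const, ex_mul, ex_B s π B hB hB0]; ring

include hπ hB2 in
theorem sum_inner_sq_le (x : G) (v : H) : (Fintype.card κ : ℝ)⁻¹ * ∑ i, (inner ℝ (π x (B (s i))) v) ^ 2 ≤ 2 * ‖v‖ ^ 2 := by
  have h : ∑ i, (inner ℝ (π x (B (s i))) v) ^ 2 ≤ ∑ i, ‖B (s i)‖ ^ 2 * ‖v‖ ^ 2 := by
    refine Finset.sum_le_sum fun i _ => ?_
    rw [← mul_pow, ← hπ x (B (s i))]
    exact sq_le_sq' (neg_le_of_abs_le (abs_real_inner_le_norm _ _)) (real_inner_le_norm _ _)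
  rw [← Finset.sum_mul, hB2] at h
  have := cardK_pos (κ := κ)
  rw [inv_mul_le_iff₀ this]
  linarith

include hπ hB hB0 hB2 in
theorem ex_right_sq (n : ℕ) (v : H) : ex s n (fun x => (inner ℝ (B x) v) ^ 2) ≤ ex s (n + 1) (fun x => (inner ℝ (B x) v) ^ 2)
    ∧ ex s (n + 1) (fun x => (inner ℝ (B x) v) ^ 2) ≤ ex s n (fun x => (inner ℝ (B x) v) ^ 2) + 2 * ‖v‖ ^ 2 := by
  have hm := (cardK_pos (κ := κ)).ne'
  have h : ex s (n + 1) (fun x => (inner ℝ (B x) v) ^ 2) = ex s n (fun x => (inner ℝ (B x) v) ^ 2) +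
      ex s n (fun x => (Fintype.card κ : ℝ)⁻¹ * ∑ i, (inner ℝ (π x (B (s i))) v) ^ 2) := by
    rw [ex_right, ← ex_sum, ← ex_mul, ← ex_add]
    congr 1
    ext x
    have : ∑ i, (inner ℝ (B (x * s i)) v) ^ 2 = Fintype.card κ * (inner ℝ (B x) v) ^ 2 + ∑ i, (inner ℝ (π x (B (s i))) v) ^ 2 := by
      have e : ∀ i, (inner ℝ (B (x * s i)) v) ^ 2 = (inner ℝ (B x) v) ^ 2 + 2 * inner ℝ (B x) v * inner ℝ (π x (B (s i))) v + (inner ℝ (π x (B (s i))) v) ^ 2 := by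
        intro i; rw [hB, inner_add_left]; ring
      simp only [e, Finset.sum_add_distrib]
      rw [← Finset.mul_sum, ← sum_inner, ← map_sum, hB0]
      simp
    rw [this]; field_simp
  rw [h]
  constructor
  · have := ex_nonneg s n (fun x => (Fintype.card κ : ℝ)⁻¹ * ∑ i, (inner ℝ (π x (B (s i))) v) ^ 2) fun x => by positivity
    linarith
  · have := ex_mono s n (fun x => (Fintype.card κ : ℝ)⁻¹ * ∑ i, (inner ℝ (π x (B (s i))) v) ^ 2) (fun _ => 2 * ‖v‖ ^ 2)
      fun x _ => sum_inner_sq_le s π hπ B hB2 x v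
    rw [ex_const] at this
    linarith

include hπ hB hB0 hB2 in
theorem ex_inv (n : ℕ) (v : H) : |ex s n (fun x => (inner ℝ (B x) v) ^ 2) -
    (Fintype.card κ : ℝ)⁻¹ * ∑ i, ex s n (fun x => (inner ℝ (B x) (π (s i)⁻¹ v)) ^ 2)| ≤ 2 * ‖v‖ ^ 2 := by
  have h1 := ex_left_sq s π hπ B hB hB0 n v
  have h2 := ex_right_sq s π hπ B hB hB0 hB2 n v
  have h3 := sum_inner_sq_le s π hπ B hB2 1 v
  simp only [map_one, one_apply_eq_self] at h3
  have h4 : 0 ≤ (Fintype.card κ : ℝ)⁻¹ * ∑ i, (inner ℝ (B (s i)) v) ^ 2 := by positivity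
  rw [abs_le]; constructor <;> linarith [h2.1, h2.2]

/-- normalized covariance form -/
noncomputable def Qf (n : ℕ) (v w : H) : ℝ := (n : ℝ)⁻¹ * ex s n (fun x => inner ℝ (B x) v * inner ℝ (B x) w)

include hπ hB hB0 hB2 in
theorem Qf_bound (n : ℕ) (v w : H) : |Qf s B n v w| ≤ 2 * ‖v‖ * ‖w‖ := by
  have key : ∀ x, |inner ℝ (B x) v * inner ℝ (B x) w| ≤ (‖v‖ * ‖w‖) * ‖B x‖ ^ 2 := by
    intro x
    rw [abs_mul]
    calc _ ≤ (‖B x‖ * ‖v‖) * (‖B x‖ * ‖w‖) := by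
          gcongr <;> exact abs_real_inner_le_norm _ _
      _ = _ := by ring
  have h1 := ex_mono s n (fun x => inner ℝ (B x) v * inner ℝ (B x) w) (fun x => (‖v‖ * ‖w‖) * ‖B x‖ ^ 2) fun x _ => (le_abs_self _).trans (key x)
  have h2 := ex_mono s n (fun x => (-(‖v‖ * ‖w‖)) * ‖B x‖ ^ 2) (fun x => inner ℝ (B x) v * inner ℝ (B x) w) fun x _ => by
    have := neg_le_of_abs_le (key x); linarith
  rw [ex_mul, ex_B2 s π hπ B hB hB0 hB2] at h1 h2
  rw [Qf, abs_mul, abs_of_nonneg (by positivity)]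
  rcases Nat.eq_zero_or_pos n with rfl | hn
  · simp; positivity
  have hn' : (0 : ℝ) < n := by exact_mod_cast hn
  rw [inv_mul_le_iff₀ hn', abs_le]
  constructor <;> linarith

theorem Qf_symm (n : ℕ) (v w : H) : Qf s B n v w = Qf s B n w v := by
  unfold Qf; congr 2; ext x; ring

theorem Qf_add (n : ℕ) (v v' w : H) : Qf s B n (v + v') w = Qf s B n v w + Qf s B n v' w := by
  unfold Qf; rw [← mul_add, ← ex_add]; congr 2; ext x; rw [inner_add_right]; ring

theorem Qf_smul (n : ℕ) (c : ℝ) (v w : H) : Qf s B n (c • v) w = c * Qf s B n v w := by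
  unfold Qf; rw [mul_left_comm, ← ex_mul s n c]; congr 2; ext x; rw [real_inner_smul_right]; ring

theorem Qf_self (n : ℕ) (v : H) : Qf s B n v v = (n : ℝ)⁻¹ * ex s n (fun x => (inner ℝ (B x) v) ^ 2) := by
  unfold Qf; congr 2; ext x; ring

theorem Qf_nonneg (n : ℕ) (v : H) : 0 ≤ Qf s B n v v := by
  rw [Qf_self]; exact mul_nonneg (by positivity) (ex_nonneg s n _ fun x => sq_nonneg _)

include hπ hB hB0 hB2 in
theorem Qf_trace (n : ℕ) {α : Type} [Fintype α] (e : α → H) (he : Orthonormal ℝ e) :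
    ∑ i, Qf s B n (e i) (e i) ≤ 2 := by
  simp only [Qf_self]
  rw [← Finset.mul_sum, ← ex_sum]
  have h := ex_mono s n (fun x => ∑ i, (inner ℝ (B x) (e i)) ^ 2) (fun x => ‖B x‖ ^ 2) fun x _ => by
    have := he.sum_inner_products_le (B x) (s := Finset.univ)
    simp only [Real.norm_eq_abs, sq_abs] at this
    simpa only [real_inner_comm] using this
  rw [ex_B2 s π hπ B hB hB0 hB2] at h
  rcases Nat.eq_zero_or_pos n with rfl | hn
  · simp
  have hn' : (0 : ℝ) < n := by exact_mod_cast hn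
  rw [inv_mul_le_iff₀ hn']
  linarith

include hπ hB hB0 hB2 in
theorem Qf_inv (n : ℕ) (v : H) : |Qf s B n v v - (Fintype.card κ : ℝ)⁻¹ * ∑ i, Qf s B n (π (s i)⁻¹ v) (π (s i)⁻¹ v)| ≤ (n : ℝ)⁻¹ * (2 * ‖v‖ ^ 2) := by
  simp only [Qf_self]
  rw [← Finset.mul_sum, mul_left_comm, ← mul_sub, abs_mul, abs_of_nonneg (a := (n : ℝ)⁻¹) (by positivity)]
  exact mul_le_mul_of_nonneg_left (ex_inv s π hπ B hB hB0 hB2 n v) (by positivity)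

end

end PartP10

section PartP11
open scoped Pointwise
open Filter Topology
set_option linter.unusedSectionVars false

section
variable {G κ H : Type} [Group G] [Fintype κ] [Nonempty κ] (s : κ → G)
  [NormedAddCommGroup H] [InnerProductSpace ℝ H]
  (π : G →* (H →L[ℝ] H)) (hπ : ∀ g v, ‖π g v‖ = ‖v‖)
  (B : G → H) (hB : ∀ g h, B (g * h) = B g + π g (B h))
  (hB0 : ∑ i, B (s i) = 0) (hB2 : ∑ i, ‖B (s i)‖ ^ 2 = 2 * (Fintype.card κ : ℝ))

include hπ hB hB0 hB2 in
theorem exists_T [CompleteSpace H] (N : ℕ → ℕ) : ∃ T : H →L[ℝ] H, ∀ v w,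
    Tendsto (fun k => Qf s B (N k) v w) (hyperfilter ℕ : Filter ℕ) (𝓝 (inner ℝ (T v) w)) := by
  have ht : ∀ v w, Tendsto (fun k => Qf s B (N k) v w) (hyperfilter ℕ : Filter ℕ) (𝓝 (ulim fun k => Qf s B (N k) v w)) :=
    fun v w => ulim_tendsto _ _ fun k => Qf_bound s π hπ B hB hB0 hB2 (N k) v w
  have hsymm : ∀ v w, (ulim fun k => Qf s B (N k) v w) = ulim fun k => Qf s B (N k) w v := fun v w => by
    congr 1; ext k; exact Qf_symm _ _ _ _ _
  have hadd : ∀ v v' w, (ulim fun k => Qf s B (N k) (v + v') w) = (ulim fun k => Qf s B (N k) v w) + ulim fun k => Qf s B (N k) v' w := by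
    intro v v' w
    apply ulim_eq
    simp only [Qf_add]
    exact (ht v w).add (ht v' w)
  have hsmul : ∀ (c : ℝ) v w, (ulim fun k => Qf s B (N k) (c • v) w) = c * (ulim fun k => Qf s B (N k) v w) := by
    intro c v w
    apply ulim_eq
    simp only [Qf_smul]
    exact (ht v w).const_mul c
  let F := LinearMap.mk₂'ₛₗ (starRingEnd ℝ) (RingHom.id ℝ) (fun v w : H => ulim fun k => Qf s B (N k) v w) hadd
    (fun c v w => by rw [hsmul]; simp)
    (fun v w w' => by rw [hsymm, hadd, hsymm w, hsymm w'])
    (fun c v w => by rw [hsymm, hsmul, hsymm w]; simp)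
  have hF : ∀ v w, ‖F v w‖ ≤ 2 * ‖v‖ * ‖w‖ := by
    intro v w
    refine le_of_tendsto ((ht v w).norm) (Eventually.of_forall fun k => ?_)
    exact Qf_bound s π hπ B hB hB0 hB2 (N k) v w
  refine ⟨InnerProductSpace.continuousLinearMapOfBilin (F.mkContinuous₂ 2 hF), fun v w => ?_⟩
  rw [InnerProductSpace.continuousLinearMapOfBilin_apply]
  exact ht v w

include hπ hB hB0 hB2 in
theorem exists_T_good [CompleteSpace H] {d : ℕ} (hG : PG d G) : ∃ T : H →L[ℝ] H,
    (∀ v w, inner ℝ (T v) w = inner ℝ v (T w)) ∧ (∀ v, 0 ≤ inner ℝ (T v) v) ∧ IsCompactOperator T ∧ 0 < ‖T‖ ∧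
    (∀ v, inner ℝ (T v) v = (Fintype.card κ : ℝ)⁻¹ * ∑ i, inner ℝ (T (π (s i)⁻¹ v)) (π (s i)⁻¹ v)) ∧
    (∀ v, (∃ M : ℝ, ∀ x, |inner ℝ (B x) v| ≤ M) → inner ℝ (T v) v = 0) := by
  obtain ⟨n, hn, hgood⟩ := extraction_of_frequently_atTop (ent_good s hG)
  obtain ⟨T, hT⟩ := exists_T s π hπ B hB hB0 hB2 (fun k => n k + 1)
  have hle : (hyperfilter ℕ : Filter ℕ) ≤ atTop := Nat.hyperfilter_le_atTop
  have hs : ∀ v w, inner ℝ (T v) w = inner ℝ v (T w) := by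
    intro v w
    rw [← real_inner_comm v]
    refine tendsto_nhds_unique (hT v w) ?_
    have := hT w v
    simp only [Qf_symm s B _ w v] at this
    exact this
  have hp : ∀ v, 0 ≤ inner ℝ (T v) v := fun v =>
    ge_of_tendsto (hT v v) (Eventually.of_forall fun k => Qf_nonneg _ _ _ _)
  have hN : Tendsto (fun k => ((n k + 1 : ℕ) : ℝ)⁻¹) (hyperfilter ℕ : Filter ℕ) (𝓝 0) := by
    refine Tendsto.mono_left ?_ hle
    refine tendsto_inv_atTop_zero.comp (tendsto_natCast_atTop_atTop.comp ?_)
    exact (tendsto_add_atTop_nat 1).comp hn.tendsto_atTop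
  refine ⟨T, hs, hp, ?_, ?_, ?_, ?_⟩
  · refine trace_compact T hs hp 2 fun α _ e he => ?_
    refine le_of_tendsto (tendsto_finsetSum _ fun i _ => hT (e i) (e i)) (Eventually.of_forall fun k => ?_)
    exact Qf_trace s π hπ B hB hB0 hB2 _ e he
  · rw [norm_pos_iff]
    rintro rfl
    have hz : ∀ i, B (s i) = 0 := by
      intro i
      have h0 := (hT (B (s i)) (B (s i))).const_mul (Fintype.card κ * ((d : ℝ) + 1) * (2 * (Fintype.card κ + 1)))
      have h1 := ge_of_tendsto h0 (Eventually.of_forall fun k => by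
        have := ent_B s π hπ B hB hB0 (n k) (hgood k) i (B (s i))
        rw [Qf_self]; push_cast; exact this)
      simp only [zero_apply, inner_zero_left, mul_zero] at h1
      have h2 : inner ℝ (B (s i)) (B (s i)) = 0 := by nlinarith [sq_nonneg (inner ℝ (B (s i)) (B (s i)))]
      simpa using h2
    have := cardK_pos (κ := κ)
    simp [hz] at hB2
  · intro v
    have h1 : Tendsto (fun k => Qf s B (n k + 1) v v - (Fintype.card κ : ℝ)⁻¹ * ∑ i, Qf s B (n k + 1) (π (s i)⁻¹ v) (π (s i)⁻¹ v))
        (hyperfilter ℕ : Filter ℕ) (𝓝 (inner ℝ (T v) v - (Fintype.card κ : ℝ)⁻¹ * ∑ i, inner ℝ (T (π (s i)⁻¹ v)) (π (s i)⁻¹ v))) :=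
      (hT v v).sub ((tendsto_finsetSum _ fun i _ => hT _ _).const_mul _)
    have h2 : Tendsto (fun k => Qf s B (n k + 1) v v - (Fintype.card κ : ℝ)⁻¹ * ∑ i, Qf s B (n k + 1) (π (s i)⁻¹ v) (π (s i)⁻¹ v))
        (hyperfilter ℕ : Filter ℕ) (𝓝 0) := by
      refine squeeze_zero_norm (fun k => Qf_inv s π hπ B hB hB0 hB2 (n k + 1) v) ?_
      simpa using hN.mul_const (2 * ‖v‖ ^ 2)
    exact sub_eq_zero.1 (tendsto_nhds_unique h1 h2)
  · rintro v ⟨M, hM⟩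
    have h2 : Tendsto (fun k => Qf s B (n k + 1) v v) (hyperfilter ℕ : Filter ℕ) (𝓝 0) := by
      refine squeeze_zero (fun k => Qf_nonneg s B _ v) (g := fun k => ((n k + 1 : ℕ) : ℝ)⁻¹ * M ^ 2) (fun k => ?_) ?_
      · rw [Qf_self]
        refine mul_le_mul_of_nonneg_left ?_ (by positivity)
        have h := ex_mono s (n k + 1) (fun x => (inner ℝ (B x) v) ^ 2) (fun _ => M ^ 2) fun x _ => by
          have := hM x
          exact sq_le_sq' (neg_le_of_abs_le this) (le_of_abs_le this)
        rwa [ex_const] at h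
      · simpa using hN.mul_const (M ^ 2)
    exact tendsto_nhds_unique (hT v v) h2

include hπ hB hB0 hB2 in
theorem finite_dim_cocycle [CompleteSpace H] {d : ℕ} (hG : PG d G) (hgen : Subgroup.closure (Set.range s) = ⊤) :
    ∃ (E : Type) (_ : NormedAddCommGroup E) (_ : InnerProductSpace ℝ E) (_ : FiniteDimensional ℝ E)
      (ρ : G →* (E →L[ℝ] E)) (c : G → E), (∀ g, ‖ρ g‖ ≤ 1) ∧ (∀ g h, c (g * h) = c g + ρ g (c h)) ∧
      ∀ K : Subgroup G, K.FiniteIndex → ∃ g ∈ K, c g ≠ 0 := by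
  obtain ⟨T, hs, hp, hc, hT, hinv, hbd⟩ := exists_T_good s π hπ B hB hB0 hB2 hG
  let E := Module.End.eigenspace T.toLinearMap ‖T‖
  have hE : ∀ v, v ∈ E ↔ T v = ‖T‖ • v := fun v => Module.End.mem_eigenspace_iff
  haveI : FiniteDimensional ℝ E := ContinuousLinearMap.finite_dimensional_eigenspace hc _ hT.ne'
  have hE' : ∀ v, v ∈ E ↔ inner ℝ (T v) v = ‖T‖ * ‖v‖ ^ 2 := by
    intro v
    rw [hE]
    constructor
    · intro h; rw [h, real_inner_smul_left, real_inner_self_eq_norm_sq]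
    · exact eigen_of_rayleigh T hs hp v
  have hstep : ∀ i, ∀ v ∈ E, π (s i)⁻¹ v ∈ E := by
    intro i v hv
    rw [hE'] at hv ⊢
    rw [hπ]
    by_contra hne
    have h1 : ∀ j, inner ℝ (T (π (s j)⁻¹ v)) (π (s j)⁻¹ v) ≤ ‖T‖ * ‖v‖ ^ 2 := by
      intro j
      have := rayleigh_le T (π (s j)⁻¹ v)
      rwa [hπ] at this
    have h2 : ∑ j, inner ℝ (T (π (s j)⁻¹ v)) (π (s j)⁻¹ v) < ∑ j : κ, ‖T‖ * ‖v‖ ^ 2 :=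
      Finset.sum_lt_sum (fun j _ => h1 j) ⟨i, Finset.mem_univ _, lt_of_le_of_ne (h1 i) hne⟩
    have h3 := hinv v
    have hm := cardK_pos (κ := κ)
    rw [hv, eq_inv_mul_iff_mul_eq₀ hm.ne'] at h3
    simp only [Finset.sum_const, Finset.card_univ, nsmul_eq_mul] at h2
    linarith
  have hstepF : ∀ i, ∀ v ∈ E, π (s i) v ∈ E := by
    intro i v hv
    let f : E →ₗ[ℝ] E := (π (s i)⁻¹).toLinearMap.restrict (hstep i)
    have hf : Function.Injective f := by
      intro a b hab
      have : π (s i)⁻¹ a = π (s i)⁻¹ b := congrArg Subtype.val hab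
      have h := congrArg (π (s i)) this
      rw [← rep_mul, ← rep_mul] at h
      simpa using h
    obtain ⟨w, hw⟩ := (LinearMap.injective_iff_surjective.1 hf) ⟨v, hv⟩
    have : π (s i)⁻¹ w = v := congrArg Subtype.val hw
    rw [← this, ← rep_mul]
    simp
  have hEinv : ∀ g, ∀ v ∈ E, π g v ∈ E := by
    intro g
    have hg : g ∈ Subgroup.closure (Set.range s) := by rw [hgen]; trivial
    have : (∀ v ∈ E, π g v ∈ E) ∧ ∀ v ∈ E, π g⁻¹ v ∈ E := by
      induction hg using Subgroup.closure_induction with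
      | mem x hx => obtain ⟨i, rfl⟩ := hx; exact ⟨hstepF i, hstep i⟩
      | one => simp
      | mul x y _ _ hx hy =>
        refine ⟨fun v hv => ?_, fun v hv => ?_⟩
        · rw [rep_mul]; exact hx.1 _ (hy.1 _ hv)
        · rw [mul_inv_rev, rep_mul]; exact hy.2 _ (hx.2 _ hv)
      | inv x _ hx => exact ⟨hx.2, by simpa using hx.1⟩
    exact this.1
  let r : G →* (E →L[ℝ] E) :=
    { toFun := fun g => (π g).restrict (hEinv g)
      map_one' := by ext v; simp
      map_mul' := fun g h => by
        ext v
        exact rep_mul π g h (v : H) }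
  have hr : ∀ g (v : E), ((r g v : E) : H) = π g v := fun g v => rfl
  let c : G → E := fun g => E.orthogonalProjectionOnto (B g)
  have hcv : ∀ g (v : E), inner ℝ (c g) v = inner ℝ (B g) (v : H) := fun g v => by
    rw [Submodule.coe_inner]
    exact Submodule.inner_orthogonalProjectionOnto_eq_of_mem_right v (B g)
  refine ⟨E, inferInstance, inferInstance, this, r, c, ?_, ?_, ?_⟩
  · intro g
    refine ContinuousLinearMap.opNorm_le_bound _ zero_le_one fun v => ?_
    rw [one_mul]
    exact (hπ g v).le
  · intro g h
    refine ext_inner_right ℝ fun v => ?_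
    rw [inner_add_left, hcv, hcv, hB, inner_add_left]
    congr 1
    rw [Submodule.coe_inner, hr, rep_inner_left π hπ, rep_inner_left π hπ]
    exact (hcv h ⟨_, hEinv _ v v.2⟩).symm
  · intro K hK
    by_contra! hzero
    obtain ⟨v, hv0, hv⟩ := top_eigen T hs hp hc hT
    have hvE := (hE v).2 hv
    have h0 : inner ℝ (T v) v = 0 := by
      refine hbd v ?_
      haveI : Finite (G ⧸ K) := inferInstance
      have hconst : ∀ x k, k ∈ K → inner ℝ (B (x * k)) v = inner ℝ (B x) v := by
        intro x k hk
        rw [hB, inner_add_left, rep_inner_left π hπ, ← hcv k ⟨_, hEinv _ v hvE⟩, hzero k hk]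
        simp
      obtain ⟨M, hM⟩ := (Set.finite_range fun q : G ⧸ K => |inner ℝ (B q.out) v|).bddAbove
      refine ⟨M, fun x => ?_⟩
      have := hM ⟨(x : G ⧸ K), rfl⟩
      obtain ⟨k, hk⟩ := QuotientGroup.mk_out_eq_mul K x
      simp only [hk, hconst x k k.2] at this
      exact this
    rw [hv, real_inner_smul_left, real_inner_self_eq_norm_sq] at h0
    have := norm_pos_iff.2 hv0
    have : 0 < ‖T‖ * ‖v‖ ^ 2 := by positivity
    linarith
end

end PartP11

section PartP12
open scoped Pointwise
open Filter Topology

theorem exists_finiteIndex_surjZ {G : Type} [Group G] [Infinite G] [hFG : Group.FG G] {d : ℕ} (hG : PG d G) :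
    ∃ K : Subgroup G, K.FiniteIndex ∧ SurjZ K := by
  classical
  obtain ⟨S, hS⟩ := hFG.out
  let S' : Finset G := insert 1 (S ∪ S⁻¹)
  have hinv : ∀ x ∈ S', x⁻¹ ∈ S' := by
    intro x hx
    simp only [S', Finset.mem_insert, Finset.mem_union, Finset.mem_inv'] at hx ⊢
    rcases hx with rfl | h | h
    · simp
    · right; right; simpa using h
    · right; left; simpa using h
  let t : S' → G := Subtype.val
  let σ : S' ≃ S' := ⟨fun x => ⟨x.1⁻¹, hinv _ x.2⟩, fun x => ⟨x.1⁻¹, hinv _ x.2⟩, fun x => by simp, fun x => by simp⟩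
  have h1 : (1 : G) ∈ Set.range t := ⟨⟨1, Finset.mem_insert_self _ _⟩, rfl⟩
  have hSr : (S : Set G) ⊆ Set.range t := fun x hx => ⟨⟨x, Finset.mem_insert_of_mem (Finset.mem_union_left _ hx)⟩, rfl⟩
  have hgen : Subgroup.closure (Set.range t) = ⊤ := by
    rw [eq_top_iff, ← hS]
    exact Subgroup.closure_mono hSr
  have : Nonempty S' := ⟨⟨1, Finset.mem_insert_self _ _⟩⟩
  obtain ⟨H, _, _, _, π, B, hπ, hB, hB0, hB2⟩ := exists_harmonic t σ (fun _ => rfl) h1 hgen hG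
  have hgen2 : Subgroup.closure (Set.range fun p : S' × S' => t p.1 * t p.2) = ⊤ := by
    rw [eq_top_iff, ← hgen]
    refine Subgroup.closure_mono ?_
    rintro _ ⟨i, rfl⟩
    obtain ⟨j, hj⟩ := h1
    exact ⟨(i, j), by simp [hj]⟩
  obtain ⟨E, _, _, _, ρ, c, hρ, hc, hnz⟩ := finite_dim_cocycle (fun p : S' × S' => t p.1 * t p.2) π hπ B hB hB0
    (by rw [hB2, Fintype.card_prod]; push_cast; ring) hG hgen2
  have : ProperSpace (E →L[ℝ] E) := FiniteDimensional.proper ℝ _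
  obtain ⟨G', hfi, hnil⟩ := compact_linear_nilp ρ hρ hG
  have : Group.FG G' := Subgroup.fg_of_index_ne_zero G'
  rcases finite_or_infinite (G' ⧸ (ρ.comp G'.subtype).ker) with hfin | hinf
  · let K := (ρ.comp G'.subtype).ker.map G'.subtype
    have hK : K.FiniteIndex := by
      have : (ρ.comp G'.subtype).ker.FiniteIndex := Subgroup.finiteIndex_of_finite_quotient
      constructor
      rw [Subgroup.index_map_subtype]
      exact mul_ne_zero this.index_ne_zero hfi.index_ne_zero
    refine ⟨K, hK, ?_⟩
    have : Group.FG K := Subgroup.fg_of_index_ne_zero K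
    have hρK : ∀ g ∈ K, ρ g = 1 := by
      rintro _ ⟨x, hx, rfl⟩
      exact hx
    obtain ⟨g, hgK, hg⟩ := hnz K hK
    have hc1 : c 1 = 0 := by
      have := hc 1 1
      simpa using this
    let f : K →* Multiplicative E :=
      { toFun := fun x => Multiplicative.ofAdd (c x)
        map_one' := by rw [Subgroup.coe_one, hc1]; rfl
        map_mul' := fun x y => by
          rw [Subgroup.coe_mul, hc, hρK x x.2]; rfl }
    refine surjZ_of_torsionfree f ?_ ⟨g, hgK⟩ ?_
    · intro n a hn ha
      rw [← Nat.cast_smul_eq_nsmul ℝ] at ha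
      exact (smul_eq_zero.1 ha).resolve_left (by exact_mod_cast hn)
    · intro h
      exact hg (Multiplicative.ofAdd.injective h)
  · have := surjZ_of_nilpotent (G' ⧸ (ρ.comp G'.subtype).ker)
    exact ⟨G', hfi, SurjZ.of_surjective (QuotientGroup.mk' _) (QuotientGroup.mk'_surjective _) this⟩

theorem virtNilp_of_finite (G : Type) [Group G] [Finite G] : Group.IsVirtuallyNilpotent G :=
  ⟨⊥, inferInstance, inferInstance⟩

theorem virtNilp_of_finiteIndex {G : Type} [Group G] (H : Subgroup G) [hH : H.FiniteIndex]
    (h : Group.IsVirtuallyNilpotent H) : Group.IsVirtuallyNilpotent G := by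
  obtain ⟨N, hN, hfi⟩ := h
  refine ⟨N.map H.subtype, ?_, ?_⟩
  · exact Group.nilpotent_of_mulEquiv (N.equivMapOfInjective H.subtype H.subtype_injective)
  · constructor
    rw [Subgroup.index_map_subtype]
    exact mul_ne_zero hfi.index_ne_zero hH.index_ne_zero

theorem PG.zero_not_surjZ {G : Type} [Group G] (hG : PG 0 G) : ¬ SurjZ G := by
  rintro ⟨φ, hφ⟩
  obtain ⟨g, hg⟩ := hφ (Multiplicative.ofAdd 1)
  obtain ⟨C, hC⟩ := hG {1, g} (by simp)
  have h1 := hC C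
  have hsub : (Set.range fun k : Fin (C + 1) => g ^ (k : ℕ)) ⊆ ({1, g} : Set G) ^ C := by
    rintro _ ⟨k, rfl⟩
    have hk : (k : ℕ) ≤ C := Nat.lt_succ_iff.1 k.2
    have h2 : ({1, g} : Set G) ^ (k : ℕ) ⊆ ({1, g} : Set G) ^ C := Set.pow_right_monotone (by simp) hk
    exact h2 (Set.pow_mem_pow (by simp))
  have hinj : Function.Injective fun k : Fin (C + 1) => g ^ (k : ℕ) := by
    intro a b hab
    have := congrArg φ hab
    simp only [map_pow, hg, ← ofAdd_nsmul] at this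
    have := Multiplicative.ofAdd.injective this
    ext
    simpa using this
  have h3 := Set.ncard_le_ncard hsub (set_pow_finite (by simp) C)
  rw [← Set.image_univ, Set.ncard_image_of_injective _ hinj, Set.ncard_univ, Nat.card_fin] at h3
  simp at h1
  omega

theorem gromov (d : ℕ) : ∀ (G : Type) [Group G] [Group.FG G], PG d G → AllFG G ∧ Group.IsVirtuallyNilpotent G := by
  induction d with
  | zero =>
    intro G _ _ hG
    rcases finite_or_infinite G with hf | hi
    · exact ⟨AllFG.of_finite G, virtNilp_of_finite G⟩
    · obtain ⟨K, hK, hz⟩ := exists_finiteIndex_surjZ hG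
      exact absurd hz (hG.subgroup K).zero_not_surjZ
  | succ d ih =>
    intro G _ _ hG
    rcases finite_or_infinite G with hf | hi
    · exact ⟨AllFG.of_finite G, virtNilp_of_finite G⟩
    · obtain ⟨K, hK, φ, hφ⟩ := exists_finiteIndex_surjZ hG
      have : Group.FG K := Subgroup.fg_of_index_ne_zero K
      have hGK := hG.subgroup K
      have : Group.FG φ.ker := hGK.ker_fg φ hφ
      obtain ⟨h1, h2⟩ := ih φ.ker (hGK.ker φ hφ)
      obtain ⟨h3, h4⟩ := virt_nilp_of_ker hGK φ hφ h1 h2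
      exact ⟨AllFG.of_finiteIndex K h3, virtNilp_of_finiteIndex K h4⟩

theorem sum_count {A : Type} [AddCommGroup A] (F : Finset A) (n : ℕ) (P : ℕ → Set A)
    (h0 : P 0 ⊆ {0}) (hs : ∀ n, ∀ a ∈ P (n + 1), ∃ a' ∈ P n, ∃ b ∈ F, a = a' + b) :
    ∃ W : Finset A, P n ⊆ W ∧ W.card ≤ (n + 1) ^ F.card := by
  classical
  let I : Finset (F → ℕ) := Fintype.piFinset fun _ => Finset.range (n + 1)
  refine ⟨I.image fun m => ∑ a : F, m a • (a : A), ?_, ?_⟩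
  · have key : ∀ k, ∀ a ∈ P k, ∃ m : F → ℕ, (∀ b, m b ≤ k) ∧ a = ∑ b, m b • (b : A) := by
      intro k
      induction k with
      | zero => intro a ha; exact ⟨0, by simp, by simpa using h0 ha⟩
      | succ k ih =>
        intro a ha
        obtain ⟨a', ha', b, hb, rfl⟩ := hs k a ha
        obtain ⟨m, hm, rfl⟩ := ih a' ha'
        refine ⟨m + Pi.single ⟨b, hb⟩ 1, fun c => ?_, ?_⟩
        · have h1 : (Pi.single (⟨b, hb⟩ : F) 1 : F → ℕ) c ≤ 1 := by
            rw [Pi.single_apply]; split_ifs <;> simp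
          exact add_le_add (hm c) h1
        · simp only [Pi.add_apply, add_smul, Finset.sum_add_distrib]
          congr 1
          rw [Finset.sum_eq_single ⟨b, hb⟩]
          · simp
          · intro c _ hc; simp [Pi.single_apply, hc]
          · simp
    intro a ha
    obtain ⟨m, hm, rfl⟩ := key n a ha
    simp only [Finset.coe_image, Set.mem_image]
    refine ⟨m, ?_, rfl⟩
    simp only [I, Finset.mem_coe, Fintype.mem_piFinset, Finset.mem_range]
    exact fun b => Nat.lt_succ_of_le (hm b)
  · refine Finset.card_image_le.trans ?_
    simp [I, Fintype.card_piFinset]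

theorem PG_of_generating {G : Type} [Group G] (S : Finset G) (h1 : 1 ∈ S) (hinv : ∀ x ∈ S, x⁻¹ ∈ S)
    (hgen : Subgroup.closure (S : Set G) = ⊤) {N d : ℕ} (h : ∀ n, ((S : Set G) ^ n).ncard ≤ N * (n + 1) ^ d) : PG d G := by
  intro T hT
  have hmono : ∀ {a b : ℕ}, a ≤ b → (S : Set G) ^ a ⊆ (S : Set G) ^ b := fun hab => Set.pow_right_monotone (by simpa using h1) hab
  have hmem : ∀ x : G, ∃ k, x ∈ (S : Set G) ^ k := by
    intro x
    have hx : x ∈ Subgroup.closure (S : Set G) := by rw [hgen]; trivial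
    have : ∃ k, x ∈ (S : Set G) ^ k ∧ x⁻¹ ∈ (S : Set G) ^ k := by
      induction hx using Subgroup.closure_induction with
      | mem x hx => exact ⟨1, by simpa using hx, by simpa using hinv x hx⟩
      | one => exact ⟨0, by simp, by simp⟩
      | mul x y _ _ hx hy =>
        obtain ⟨a, ha, ha'⟩ := hx
        obtain ⟨b, hb, hb'⟩ := hy
        refine ⟨a + b, ?_, ?_⟩
        · rw [pow_add]; exact Set.mul_mem_mul ha hb
        · rw [mul_inv_rev, add_comm, pow_add]; exact Set.mul_mem_mul hb' ha'
      | inv x _ hx =>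
        obtain ⟨a, ha, ha'⟩ := hx
        exact ⟨a, ha', by simpa using ha⟩
    exact this.imp fun k hk => hk.1
  choose k hk using hmem
  obtain ⟨c, hc⟩ := (hT.image k).bddAbove
  have hsub : T ⊆ (S : Set G) ^ c := fun x hx => hmono (hc ⟨x, hx, rfl⟩) (hk x)
  refine ⟨N * (c + 1) ^ d, fun n => ?_⟩
  have h2 : T ^ n ⊆ (S : Set G) ^ (c * n) := by
    rw [pow_mul]; exact Set.pow_subset_pow_left hsub
  refine (Set.ncard_le_ncard h2 (set_pow_finite S.finite_toSet _)).trans ((h _).trans ?_)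
  rw [mul_assoc, ← mul_pow]
  gcongr
  nlinarith

theorem PG_of_coarse {G A : Type} [Group G] [AddCommGroup A] [MetricSpace G] [MetricSpace A] [hFG : Group.FG G]
    (hGinv : ∀ g x y : G, dist (g * x) (g * y) = dist x y)
    (hGprop : ∀ (x : G) (r : ℝ), {y : G | dist x y ≤ r}.Finite)
    (hAinv : ∀ a x y : A, dist (a + x) (a + y) = dist x y)
    (hAprop : ∀ (x : A) (r : ℝ), {y : A | dist x y ≤ r}.Finite)
    (f : G → A)
    (hf1 : ∀ δ : ℝ, 0 ≤ δ → ∃ ε : ℝ, 0 ≤ ε ∧ ∀ x x' : G, dist x x' ≤ δ → dist (f x) (f x') ≤ ε)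
    (hf2 : ∀ R : ℝ, 0 ≤ R → ∃ S : ℝ, 0 ≤ S ∧ ∀ x x' : G, dist (f x) (f x') ≤ R → dist x x' ≤ S) :
    ∃ d, PG d G := by
  classical
  obtain ⟨S₀, hS⟩ := hFG.out
  let S : Finset G := insert 1 (S₀ ∪ S₀⁻¹)
  have hinv : ∀ x ∈ S, x⁻¹ ∈ S := by
    intro x hx
    simp only [S, Finset.mem_insert, Finset.mem_union, Finset.mem_inv'] at hx ⊢
    rcases hx with rfl | h | h
    · simp
    · right; right; simpa using h
    · right; left; simpa using h
  have h1 : 1 ∈ S := Finset.mem_insert_self _ _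
  have hgen : Subgroup.closure (S : Set G) = ⊤ := by
    rw [eq_top_iff, ← hS]
    exact Subgroup.closure_mono fun x hx => Finset.mem_insert_of_mem (Finset.mem_union_left _ hx)
  obtain ⟨δ, hδ⟩ := (S.finite_toSet.image fun x => dist 1 x).bddAbove
  have hδ' : ∀ x ∈ S, dist 1 x ≤ δ := fun x hx => hδ ⟨x, hx, rfl⟩
  obtain ⟨ε, _, hε⟩ := hf1 δ (by simpa using hδ' 1 h1)
  obtain ⟨r, _, hr⟩ := hf2 0 le_rfl
  let F := (hAprop 0 ε).toFinset
  let N := (hGprop 1 r).toFinset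
  refine ⟨F.card, PG_of_generating S h1 hinv hgen (N := N.card) fun n => ?_⟩
  obtain ⟨W, hW, hWc⟩ := sum_count F n (fun n => (fun x => f x - f 1) '' ((S : Set G) ^ n)) (by simp) (by
    rintro n _ ⟨x, hx, rfl⟩
    rw [pow_succ] at hx
    obtain ⟨y, hy, z, hz, rfl⟩ := hx
    refine ⟨f y - f 1, ⟨y, hy, rfl⟩, f (y * z) - f y, ?_, by simp⟩
    simp only [F, Set.Finite.mem_toFinset, Set.mem_setOf_eq]
    have h2 : dist (f y) (f (y * z)) ≤ ε := hε _ _ (by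
      have := hGinv y 1 z
      rw [mul_one] at this
      rw [this]; exact hδ' z hz)
    rw [← hAinv (f y)]
    simpa using h2)
  have hfin := set_pow_finite S.finite_toSet n
  rw [Set.ncard_eq_toFinset_card _ hfin]
  have hb := Finset.card_le_mul_card_image (f := fun x => f x - f 1) hfin.toFinset N.card (by
    intro a ha
    simp only [Finset.mem_image, Set.Finite.mem_toFinset] at ha
    obtain ⟨x, hx, rfl⟩ := ha
    refine Finset.card_le_card_of_injOn (fun y => x⁻¹ * y) ?_ (fun y _ z _ h => mul_left_cancel h)
    intro y hy
    simp only [Finset.coe_filter, Set.Finite.mem_toFinset, Set.mem_setOf_eq, sub_left_inj] at hy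
    simp only [N, Finset.mem_coe, Set.Finite.mem_toFinset, Set.mem_setOf_eq]
    have := hr x y (by rw [hy.2, dist_self])
    rw [← hGinv x]
    simpa using this)
  refine hb.trans (Nat.mul_le_mul_left _ (le_trans (Finset.card_le_card ?_) hWc))
  intro a ha
  simp only [Finset.mem_image, Set.Finite.mem_toFinset] at ha
  obtain ⟨x, hx, rfl⟩ := ha
  exact hW ⟨x, hx, rfl⟩

end PartP12

/-- If a countable group `G` with a proper left-invariant metric coarsely embeds into a
countable abelian group with a proper left-invariant metric, then `G` is locally
nilpotent-by-finite. -/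
theorem locally_nilpotentByFinite_of_coarseEmbedding_abelian
    (G A : Type) [Group G] [AddCommGroup A] [Countable G] [Countable A]
    [MetricSpace G] [MetricSpace A]
    (hGinv : ∀ g x y : G, dist (g * x) (g * y) = dist x y)
    (hGprop : ∀ (x : G) (r : ℝ), {y : G | dist x y ≤ r}.Finite)
    (hAinv : ∀ a x y : A, dist (a + x) (a + y) = dist x y)
    (hAprop : ∀ (x : A) (r : ℝ), {y : A | dist x y ≤ r}.Finite)
    (f : G → A) (hf : CoarseEmbedding f) :
    ∀ K : Subgroup G, Group.FG K → NilpotentByFinite K := by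
  intro K hK
  have hfg : Group.FG K := hK
  obtain ⟨d, hd⟩ := PG_of_coarse (G := K) (A := A) (fun g x y => hGinv g x y)
    (fun x r => (hGprop x r).preimage Subtype.val_injective.injOn) hAinv hAprop (fun x => f x)
    (fun δ hδ => by
      obtain ⟨ε, h0, h⟩ := hf.1 δ hδ
      exact ⟨ε, h0, fun x x' hx => h x x' hx⟩)
    (fun R hR => by
      obtain ⟨S, h0, h⟩ := hf.2 R hR
      exact ⟨S, h0, fun x x' hx => h x x' hx⟩)
  obtain ⟨-, N, hN, hfi⟩ := gromov d K hd
  refine ⟨N.normalCore, inferInstance, ?_, inferInstance⟩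
  have hinj := Subgroup.inclusion_injective (Subgroup.normalCore_le N)
  exact Subgroup.isNilpotent_of_ker_le_center (Subgroup.inclusion (Subgroup.normalCore_le N)) (by
    rw [(MonoidHom.ker_eq_bot_iff _).2 hinj]; exact bot_le)
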